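/- arXiv:2404.01449 — 2 statements merged into one kernel-verified Lean document; each statement's English description precedes it below -/
import Mathlib

section
/- Suppose that for every m ∈ ℤ^{r−1}, both completed partial L-series L̂(s,C,ψ_m) and L̂(s,C̃,ψ_{−m}) extend to entire functions of s which are bounded in every vertical strip and satisfy the functional equation L̂(s,C,ψ_m) = ε·i^{−(k_1+⋯+k_r)}·ψ_m(𝔫𝔡²)·L̂(k_0−s, C̃, ψ_{−m}). Then f|_k W_q = ε·f̃, where W_q is the matrix (0, −1; q, 0). -/
open NumberField FractionalIdeal Complex MeasureTheory
open scoped nonZeroDivisors Classical Real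

noncomputable section

variable (F : Type*) [Field F] [NumberField F]

/-- Extension by zero of a coefficient function on integral ideals to all fractional
ideals: `Aext A I = A J` if `I` is (the image of) an integral ideal `J`, and `0`
otherwise. -/
def Aext (A : Ideal (𝓞 F) → ℂ) (I : FractionalIdeal (𝓞 F)⁰ F) : ℂ :=
  if h : ∃ J : Ideal (𝓞 F), (J : FractionalIdeal (𝓞 F)⁰ F) = I then A h.choose else 0

/-- The weight-`k` slash operator `g ↦ g|_k γ` on functions on `ℋ^r`, for
`γ = (a,b;c,d) ∈ GL₂⁺(F)`:
`(g|_k γ)(z) = ∏_j (det γ^{(j)})^{k_j/2}(c^{(j)}z_j+d^{(j)})^{-k_j} · g(γ^{(1)}z_1,…,γ^{(r)}z_r)`. -/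
def slash (r : ℕ) (σ : Fin r → (F →+* ℝ)) (k : Fin r → ℕ)
    (γ : Matrix (Fin 2) (Fin 2) F) (g : (Fin r → ℂ) → ℂ) : (Fin r → ℂ) → ℂ :=
  fun z =>
    (∏ j, ((σ j γ.det : ℝ) : ℂ) ^ (k j / 2) *
      (((σ j (γ 1 0) : ℝ) : ℂ) * z j + ((σ j (γ 1 1) : ℝ) : ℂ)) ^ (-(k j : ℤ))) *
    g (fun j => (((σ j (γ 0 0) : ℝ) : ℂ) * z j + ((σ j (γ 0 1) : ℝ) : ℂ)) /
        (((σ j (γ 1 0) : ℝ) : ℂ) * z j + ((σ j (γ 1 1) : ℝ) : ℂ)))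

/-- The candidate Hilbert modular form attached to the coefficients `A` and the ideal `t`:
`f(z) = Σ_{ξ ≫ 0, ξ ∈ t𝔡⁻¹} N(t)^{k₀/2} · A(ξt⁻¹𝔡) · ∏_j (ξ^{(j)})^{-k'_j/2} · e(tr(ξz))`. -/
def hilbertF (r : ℕ) (σ : Fin r → (F →+* ℝ)) (k : Fin r → ℕ) (k0 : ℕ)
    (A : Ideal (𝓞 F) → ℂ) (t : Ideal (𝓞 F)) : (Fin r → ℂ) → ℂ :=
  fun z => ∑' ξ : {x : F // x ∈ (t : FractionalIdeal (𝓞 F)⁰ F) *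
      ((differentIdeal ℤ (𝓞 F) : FractionalIdeal (𝓞 F)⁰ F))⁻¹ ∧ ∀ j, 0 < σ j x},
    (Ideal.absNorm t : ℂ) ^ (k0 / 2) *
    Aext F A (spanSingleton (𝓞 F)⁰ ξ.1 * ((t : FractionalIdeal (𝓞 F)⁰ F))⁻¹ *
      (differentIdeal ℤ (𝓞 F) : FractionalIdeal (𝓞 F)⁰ F)) *
    (∏ j, ((σ j ξ.1 : ℝ) : ℂ) ^ (-(((k0 - k j) / 2 : ℕ) : ℤ))) *
    Complex.exp (2 * Real.pi * Complex.I * ∑ j, ((σ j ξ.1 : ℝ) : ℂ) * z j)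

/-- Membership of a nonzero integral ideal `a` in the narrow ideal class of the fractional
ideal `I₀`: `a = (ξ)·I₀` for some totally positive `ξ`. -/
def InNarrowClass (r : ℕ) (σ : Fin r → (F →+* ℝ)) (I₀ : FractionalIdeal (𝓞 F)⁰ F)
    (a : Ideal (𝓞 F)) : Prop :=
  ∃ ξ : F, (∀ j, 0 < σ j ξ) ∧
    (a : FractionalIdeal (𝓞 F)⁰ F) = spanSingleton (𝓞 F)⁰ ξ * I₀

/-- Partial twisted L-series over the integral ideals in the narrow class of `I₀`:
`L(s,C,ψ) = Σ_{𝔞∈C} ψ(𝔞) A(𝔞) N(𝔞)^{-s}`. -/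
def Lpartial (r : ℕ) (σ : Fin r → (F →+* ℝ)) (A : Ideal (𝓞 F) → ℂ)
    (ψ : FractionalIdeal (𝓞 F)⁰ F → ℂ) (I₀ : FractionalIdeal (𝓞 F)⁰ F) (s : ℂ) : ℂ :=
  ∑' a : {a : Ideal (𝓞 F) // a ≠ 0 ∧ InNarrowClass F r σ I₀ a},
    ψ (a.1 : FractionalIdeal (𝓞 F)⁰ F) * A a.1 * (Ideal.absNorm a.1 : ℂ) ^ (-s)

/-- Completed partial twisted L-series
`L̂(s,C,ψ) = (2π)^{-rs} N(𝔫𝔡²)^{s/2} ∏_j Γ(s - k'_j/2 + ν_j) L(s,C,ψ)`. -/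
def LhatPartial (r : ℕ) (σ : Fin r → (F →+* ℝ)) (k : Fin r → ℕ) (k0 : ℕ)
    (𝔫 : Ideal (𝓞 F)) (A : Ideal (𝓞 F) → ℂ) (ψ : FractionalIdeal (𝓞 F)⁰ F → ℂ)
    (ν : Fin r → ℂ) (I₀ : FractionalIdeal (𝓞 F)⁰ F) (s : ℂ) : ℂ :=
  ((2 * Real.pi : ℝ) : ℂ) ^ (-((r : ℂ) * s)) *
    (Ideal.absNorm (𝔫 * differentIdeal ℤ (𝓞 F) ^ 2) : ℂ) ^ (s / 2) *
    (∏ j, Complex.Gamma (s - (((k0 - k j) / 2 : ℕ) : ℂ) + ν j)) *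
    Lpartial F r σ A ψ I₀ s

/-! ### One-variable analysis: contour shift and Laplace inversion -/

theorem pl_decay {P : ℂ → ℂ} (hP : Differentiable ℂ P) {a b K M : ℝ} (hab : a < b)
    (hM : ∀ s : ℂ, a ≤ s.re → s.re ≤ b → ‖P s‖ ≤ M)
    (ha : ∀ s : ℂ, s.re = a → ‖P s‖ * (1 + s.im ^ 2) ≤ K)
    (hb : ∀ s : ℂ, s.re = b → ‖P s‖ * (1 + s.im ^ 2) ≤ K)
    (s : ℂ) (h1 : a ≤ s.re) (h2 : s.re ≤ b) :
    ‖P s‖ * (1 + s.im ^ 2) ≤ K * (b - a + 1) ^ 2 := by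
  have hnsq : ∀ z : ℂ, ‖(z - a + 1) ^ 2‖ = (z.re - a + 1) ^ 2 + z.im ^ 2 := by
    intro z
    rw [norm_pow, ← Complex.normSq_eq_norm_sq, Complex.normSq_apply]
    simp; ring
  have hK : 0 ≤ K := le_trans (by positivity) (ha a (by simp))
  have hM0 : 0 ≤ M := le_trans (norm_nonneg _) (hM a (by simp) (by simpa using hab.le))
  have hba : 0 < b - a := sub_pos.2 hab
  have key := PhragmenLindelof.vertical_strip (f := fun z => P z * (z - a + 1) ^ 2)
    (a := a) (b := b) (C := K * (b - a + 1) ^ 2) (z := s) ?_ ?_ ?_ ?_ h1 h2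
  · refine le_trans ?_ key
    rw [norm_mul, hnsq]
    gcongr
    nlinarith
  · apply Differentiable.diffContOnCl
    fun_prop
  · have hc : 0 < π / (b - a) / 2 := by positivity
    set c := π / (b - a) / 2 with hcdef
    refine ⟨c, ?_, 1 / c, ?_⟩
    · rw [hcdef]; linarith [show 0 < π / (b - a) by positivity]
    · refine Asymptotics.IsBigO.of_bound (M * ((b - a + 1) ^ 2 + 2)) ?_
      rw [Filter.eventually_inf_principal]
      refine Filter.Eventually.of_forall ?_
      intro z hz
      have hz1 : a < z.re := hz.1
      have hz2 : z.re < b := hz.2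
      rw [norm_mul, hnsq, Real.norm_of_nonneg (Real.exp_pos _).le]
      have e1 : Real.exp |z.im| ≤ Real.exp (1 / c * Real.exp (c * |z.im|)) := by
        apply Real.exp_le_exp.2
        have := Real.add_one_le_exp (c * |z.im|)
        calc |z.im| = 1 / c * (c * |z.im|) := by field_simp
          _ ≤ _ := by gcongr; linarith
      have e2 : z.im ^ 2 ≤ 2 * Real.exp |z.im| := by
        have := Real.quadratic_le_exp_of_nonneg (abs_nonneg z.im)
        have h3 := abs_nonneg z.im
        rw [← sq_abs]
        nlinarith
      have e3 : 1 ≤ Real.exp |z.im| := Real.one_le_exp (abs_nonneg _)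
      have e4 : (z.re - a + 1) ^ 2 ≤ (b - a + 1) ^ 2 := by gcongr
      calc ‖P z‖ * ((z.re - a + 1) ^ 2 + z.im ^ 2)
          ≤ M * ((b - a + 1) ^ 2 * Real.exp |z.im| + 2 * Real.exp |z.im|) := by
            gcongr
            · exact hM z hz1.le hz2.le
            · nlinarith [sq_nonneg (b - a + 1)]
        _ = M * ((b - a + 1) ^ 2 + 2) * Real.exp |z.im| := by ring
        _ ≤ _ := by gcongr
  · intro z hz
    rw [norm_mul, hnsq, hz]
    have := ha z hz
    have h3 : 1 ≤ (b - a + 1) ^ 2 := by nlinarith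
    calc ‖P z‖ * ((a - a + 1) ^ 2 + z.im ^ 2) = ‖P z‖ * (1 + z.im ^ 2) := by ring
      _ ≤ K := this
      _ ≤ _ := by nlinarith
  · intro z hz
    rw [norm_mul, hnsq, hz]
    have := hb z hz
    have h3 : 1 ≤ (b - a + 1) ^ 2 := by nlinarith
    calc ‖P z‖ * ((b - a + 1) ^ 2 + z.im ^ 2)
        ≤ ‖P z‖ * ((1 + z.im ^ 2) * (b - a + 1) ^ 2) := by
          gcongr
          nlinarith [sq_nonneg z.im]
      _ = ‖P z‖ * (1 + z.im ^ 2) * (b - a + 1) ^ 2 := by ring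
      _ ≤ _ := by gcongr

theorem integrable_vertical {Q : ℂ → ℂ} (hQ : Continuous Q) {a K : ℝ}
    (ha : ∀ s : ℂ, s.re = a → ‖Q s‖ * (1 + s.im ^ 2) ≤ K) :
    Integrable (fun y : ℝ => Q (a + y * I)) := by
  refine Integrable.mono' (integrable_inv_one_add_sq.const_mul K)
    (by fun_prop) (Filter.Eventually.of_forall fun y => ?_)
  have := ha (a + y * I) (by simp)
  simp at this
  rw [← div_eq_mul_inv, le_div_iff₀ (by positivity)]
  exact this

theorem vertical_shift {Q : ℂ → ℂ} (hQ : Differentiable ℂ Q) {a b K : ℝ} (hab : a < b)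
    (hK : ∀ s : ℂ, a ≤ s.re → s.re ≤ b → ‖Q s‖ * (1 + s.im ^ 2) ≤ K) :
    ∫ y : ℝ, Q (a + y * I) = ∫ y : ℝ, Q (b + y * I) := by
  have hia := integrable_vertical hQ.continuous (a := a) (K := K)
    (fun s hs => hK s hs.ge (hs.le.trans hab.le))
  have hib := integrable_vertical hQ.continuous (a := b) (K := K)
    (fun s hs => hK s (hab.le.trans hs.ge) hs.le)
  have ta := intervalIntegral_tendsto_integral hia Filter.tendsto_neg_atTop_atBot
    Filter.tendsto_id
  have tb := intervalIntegral_tendsto_integral hib Filter.tendsto_neg_atTop_atBot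
    Filter.tendsto_id
  have rect : ∀ T : ℝ, (∫ y in (-T)..T, Q (b + y * I)) - (∫ y in (-T)..T, Q (a + y * I)) =
      I * ((∫ x : ℝ in a..b, Q (x + (-T : ℝ) * I)) - (∫ x : ℝ in a..b, Q (x + T * I))) := by
    intro T
    have := Complex.integral_boundary_rect_eq_zero_of_differentiableOn Q
      (a + (-T : ℝ) * I) (b + T * I) hQ.differentiableOn
    simp only [add_re, ofReal_re, mul_re, I_re, mul_zero, ofReal_im, I_im, mul_one, sub_self,
      add_zero, add_im, mul_im, zero_add, smul_eq_mul] at this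
    have h2 : I * I = -1 := I_mul_I
    linear_combination (-I) * this + ((∫ y in (-T)..T, Q (b + y * I)) - (∫ y in (-T)..T, Q (a + y * I))) * h2
  have hbd : ∀ T : ℝ, ‖∫ x : ℝ in a..b, Q (x + T * I)‖ ≤ K * (b - a) * (1 + T ^ 2)⁻¹ := by
    intro T
    have := intervalIntegral.norm_integral_le_of_norm_le_const (a := a) (b := b)
      (f := fun x : ℝ => Q (x + T * I)) (C := K * (1 + T ^ 2)⁻¹) ?_
    · rw [abs_of_pos (sub_pos.2 hab)] at this
      linarith
    · intro x hx
      rw [Set.uIoc_of_le hab.le] at hx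
      have := hK (x + T * I) (by simpa using hx.1.le) (by simpa using hx.2)
      simp at this
      rw [← div_eq_mul_inv, le_div_iff₀ (by positivity)]
      exact this
  have hlim0 : Filter.Tendsto (fun T : ℝ => K * (b - a) * (1 + T ^ 2)⁻¹) Filter.atTop (nhds 0) := by
    have h1 : Filter.Tendsto (fun T : ℝ => 1 + T ^ 2) Filter.atTop Filter.atTop :=
      Filter.tendsto_atTop_add_const_left _ _ (Filter.tendsto_pow_atTop (by norm_num))
    simpa using (h1.inv_tendsto_atTop).const_mul (K * (b - a))
  have t1 : Filter.Tendsto (fun T : ℝ => ∫ x : ℝ in a..b, Q (x + T * I)) Filter.atTop (nhds 0) :=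
    squeeze_zero_norm hbd hlim0
  have t2 : Filter.Tendsto (fun T : ℝ => ∫ x : ℝ in a..b, Q (x + (-T : ℝ) * I))
      Filter.atTop (nhds 0) :=
    squeeze_zero_norm (fun T => by simpa using hbd (-T)) hlim0
  have t3 := tb.sub ta
  have t4 : Filter.Tendsto (fun T : ℝ => (∫ y in (-T)..T, Q (b + y * I)) -
      (∫ y in (-T)..T, Q (a + y * I))) Filter.atTop (nhds 0) := by
    simp_rw [rect]
    simpa using (t2.sub t1).const_mul I
  have := tendsto_nhds_unique t3 t4
  exact (sub_eq_zero.1 this).symm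

theorem laplace_inversion {d : ℝ → ℂ} (hd : Continuous d) {P : ℂ → ℂ} (hP : Continuous P)
    {a K : ℝ} (hK : ∀ s : ℂ, s.re = a → ‖P s‖ * (1 + s.im ^ 2) ≤ K)
    (hIntg : Integrable (fun x : ℝ => d x * cexp (a * x)))
    (hL : ∀ s : ℂ, s.re = a → ∫ x : ℝ, d x * cexp (s * x) = P s) (x : ℝ) :
    d x = ((2 * π)⁻¹ : ℝ) * ∫ y : ℝ, P (a + y * I) * cexp (-(a + y * I) * x) := by
  have hF : ∀ w : ℝ, FourierTransform.fourier (fun x : ℝ => d x * cexp (a * x)) w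
      = P (a + (-(2 * π) * w : ℝ) * I) := by
    intro w
    rw [← hL (a + (-(2 * π) * w : ℝ) * I) (by simp), Real.fourier_real_eq_integral_exp_smul]
    congr 1
    ext v
    rw [smul_eq_mul, mul_comm, mul_assoc, ← Complex.exp_add]
    congr 2
    push_cast; ring
  have hiv := integrable_vertical hP hK
  have hne : -(2 * π) ≠ 0 := by simp [Real.pi_ne_zero]
  have hFi : Integrable (FourierTransform.fourier (fun x : ℝ => d x * cexp (a * x))) := by
    have := hiv.comp_mul_left' hne
    exact this.congr (Filter.Eventually.of_forall fun w => (hF w).symm)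
  have inv := congrFun (Continuous.fourierInv_fourier_eq (by fun_prop) hIntg hFi) x
  have e := Measure.integral_comp_mul_left (fun y : ℝ => P (a + y * I) * cexp (-(y * I) * x))
    (-(2 * π))
  rw [Real.fourierInv_eq', ] at inv
  have e2 : ∫ v : ℝ, cexp (↑(2 * π * inner ℝ v x) * I) •
      FourierTransform.fourier (fun x : ℝ => d x * cexp (a * x)) v =
      ((2 * π)⁻¹ : ℝ) * ∫ y : ℝ, P (a + y * I) * cexp (-(y * I) * x) := by
    rw [abs_inv, abs_neg, abs_of_pos (by positivity : 0 < 2 * π)] at e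
    rw [← Complex.real_smul, ← e]
    congr 1
    ext v
    rw [hF, smul_eq_mul, mul_comm]
    congr 2
    simp; ring
  rw [e2] at inv
  have hexp : cexp (a * x) ≠ 0 := Complex.exp_ne_zero _
  apply mul_right_cancel₀ hexp
  rw [← inv, mul_assoc, ← integral_mul_const]
  congr 2
  ext y
  rw [mul_assoc, ← Complex.exp_add]
  congr 2
  ring

theorem laplace_unique {c d : ℝ → ℂ} (hc : Continuous c) (hd : Continuous d) {P : ℂ → ℂ}
    (hP : Differentiable ℂ P) {a b : ℝ} (hab : a < b) {M K : ℝ}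
    (hM : ∀ s : ℂ, a ≤ s.re → s.re ≤ b → ‖P s‖ ≤ M)
    (hKa : ∀ s : ℂ, s.re = a → ‖P s‖ * (1 + s.im ^ 2) ≤ K)
    (hKb : ∀ s : ℂ, s.re = b → ‖P s‖ * (1 + s.im ^ 2) ≤ K)
    (hci : Integrable (fun x : ℝ => c x * cexp (a * x)))
    (hdi : Integrable (fun x : ℝ => d x * cexp (b * x)))
    (hcL : ∀ s : ℂ, s.re = a → ∫ x : ℝ, c x * cexp (s * x) = P s)
    (hdL : ∀ s : ℂ, s.re = b → ∫ x : ℝ, d x * cexp (s * x) = P s) : c = d := by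
  ext x
  rw [laplace_inversion hc hP.continuous hKa hci hcL, laplace_inversion hd hP.continuous hKb hdi hdL]
  congr 1
  refine vertical_shift (Q := fun s => P s * cexp (-s * x)) (by fun_prop) hab
    (K := K * (b - a + 1) ^ 2 * (Real.exp (-a * x) + Real.exp (-b * x))) ?_
  intro s h1 h2
  have h3 := pl_decay hP hab hM hKa hKb s h1 h2
  rw [norm_mul, Complex.norm_exp]
  have h4 : Real.exp ((-s * x).re) ≤ Real.exp (-a * x) + Real.exp (-b * x) := by
    simp only [mul_re, neg_re, ofReal_re, neg_im, ofReal_im, mul_zero, sub_zero]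
    rcases le_total 0 x with hx | hx
    · refine le_add_of_le_of_nonneg (Real.exp_le_exp.2 ?_) (Real.exp_pos _).le
      nlinarith
    · refine le_add_of_nonneg_of_le (Real.exp_pos _).le (Real.exp_le_exp.2 ?_)
      nlinarith
  calc _ = (‖P s‖ * (1 + s.im ^ 2)) * Real.exp ((-s * x).re) := by ring
    _ ≤ _ := by gcongr; exact le_trans (by positivity) h3

/-! ### Unfolding over the lattice of units -/

/-- The half-open unit cube. -/
def ucube (n : ℕ) : Set (Fin n → ℝ) := {u | ∀ i, u i ∈ Set.Ioc (0 : ℝ) (0 + 1)}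

/-- An integral vector seen in `ℝ × ℝⁿ`. -/
def zvec {n : ℕ} (N : Fin n → ℤ) : ℝ × (Fin n → ℝ) := (0, fun i => (N i : ℝ))

theorem measurableSet_ucube (n : ℕ) : MeasurableSet (ucube n) :=
  MeasurableSet.univ_pi' (fun _ => measurableSet_Ioc)

/-- The strip over the unit cube. -/
def ustrip (n : ℕ) : Set (ℝ × (Fin n → ℝ)) := Set.univ ×ˢ ucube n

theorem measurableSet_ustrip (n : ℕ) : MeasurableSet (ustrip n) :=
  MeasurableSet.univ.prod (measurableSet_ucube n)

instance instHaarProdPi (n : ℕ) :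
    (volume : Measure (ℝ × (Fin n → ℝ))).IsAddHaarMeasure :=
  Measure.prod.instIsAddHaarMeasure _ _

theorem unfold_hasSum {n : ℕ} {E : Type*} [NormedAddCommGroup E] [NormedSpace ℝ E]
    {g : ℝ × (Fin n → ℝ) → E} (hg : Integrable g) :
    HasSum (fun N : Fin n → ℤ => ∫ w in ustrip n, g (w + zvec N)) (∫ w, g w) := by
  let S : (Fin n → ℤ) → Set (ℝ × (Fin n → ℝ)) := fun N => (fun w => w - zvec N) ⁻¹' ustrip n
  have hS : ∀ N w, w ∈ S N ↔ ∀ i, (N i : ℝ) < w.2 i ∧ w.2 i ≤ N i + 1 := by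
    intro N w
    simp only [S, ustrip, ucube, zvec, Set.mem_preimage, Set.mem_prod, Set.mem_univ, true_and,
      Set.mem_ofPred_eq, Set.mem_Ioc, Prod.snd_sub, Pi.sub_apply, zero_add, sub_pos,
      tsub_le_iff_right]
    simp only [add_comm]
  have hmeas : ∀ N, MeasurableSet (S N) := fun N =>
    (measurableSet_ustrip n).preimage (by fun_prop)
  have hdisj : Pairwise (Function.onFun Disjoint S) := by
    intro N N' hne
    rw [Function.onFun, Set.disjoint_left]
    intro w h1 h2
    apply hne
    rw [hS] at h1 h2
    ext i
    have a1 := h1 i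
    have a2 := h2 i
    have b1 : (N i : ℝ) < N' i + 1 := by linarith
    have b2 : (N' i : ℝ) < N i + 1 := by linarith
    norm_cast at b1 b2
    omega
  have hU : ⋃ N, S N = Set.univ := by
    rw [Set.eq_univ_iff_forall]
    intro w
    rw [Set.mem_iUnion]
    refine ⟨fun i => ⌈w.2 i⌉ - 1, ?_⟩
    rw [hS]
    intro i
    push_cast
    exact ⟨by linarith [Int.ceil_lt_add_one (w.2 i)], by linarith [Int.le_ceil (w.2 i)]⟩
  have key := hasSum_integral_iUnion hmeas hdisj (f := g) (μ := volume) hg.integrableOn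
  rw [hU, setIntegral_univ] at key
  convert key using 2 with N
  have mp := measurePreserving_add_right (volume : Measure (ℝ × (Fin n → ℝ))) (zvec N)
  have := mp.setIntegral_preimage_emb (measurableEmbedding_addRight _) g (S N)
  rw [← this]
  congr 2
  ext w
  simp [S]

theorem integrable_of_hasSum {X ι : Type*} [MeasurableSpace X] [Countable ι] {μ : Measure X}
    {F : ι → X → ℂ} {G : X → ℂ} (hG : AEStronglyMeasurable G μ) (hF : ∀ i, Integrable (F i) μ)
    (hs : Summable fun i => ∫ x, ‖F i x‖ ∂μ) (h : ∀ x, HasSum (fun i => F i x) (G x)) :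
    Integrable G μ := by
  refine ⟨hG, ?_⟩
  have h1 : ∀ x, ‖G x‖ₑ ≤ ∑' i, ‖F i x‖ₑ := by
    intro x
    rw [← (h x).tsum_eq]
    exact enorm_tsum_le_tsum_enorm
  calc ∫⁻ x, ‖G x‖ₑ ∂μ ≤ ∫⁻ x, ∑' i, ‖F i x‖ₑ ∂μ := lintegral_mono h1
    _ = ∑' i, ∫⁻ x, ‖F i x‖ₑ ∂μ := lintegral_tsum (fun i => (hF i).1.enorm)
    _ = ∑' i, ENNReal.ofReal (∫ x, ‖F i x‖ ∂μ) := by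
        congr 1; ext i
        rw [ofReal_integral_norm_eq_lintegral_enorm (hF i)]
    _ < ⊤ := by
        rw [← ENNReal.ofReal_tsum_of_nonneg (fun i => integral_nonneg fun _ => norm_nonneg _) hs]
        exact ENNReal.ofReal_lt_top

theorem unfold_main {n : ℕ} {ι : Type*} [Countable ι] {α : ι → ℂ} {b : ι → ℝ × (Fin n → ℝ)}
    {φ χ G : ℝ × (Fin n → ℝ) → ℂ} (hG : Continuous G) (hχ : Continuous χ)
    (hχadd : ∀ v w, χ (v + w) = χ v * χ w) (hχz : ∀ N, χ (zvec N) = 1)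
    (hIntg : Integrable (fun w => φ w * χ w))
    (hsum : Summable fun a => ‖α a‖ * ‖χ (-b a)‖)
    (hGs : ∀ w, HasSum (fun p : ι × (Fin n → ℤ) => α p.1 * φ (w + b p.1 + zvec p.2)) (G w)) :
    IntegrableOn (fun w => G w * χ w) (ustrip n) ∧
    ∫ w in ustrip n, G w * χ w = (∑' a, α a * χ (-b a)) * ∫ w, φ w * χ w := by
  set g := fun w => φ w * χ w with hg
  have hF : ∀ (p : ι × (Fin n → ℤ)) w, α p.1 * φ (w + b p.1 + zvec p.2) * χ w =
      α p.1 * χ (-b p.1) * g (w + zvec p.2 + b p.1) := by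
    intro p w
    have h1 : χ (w + zvec p.2 + b p.1) = χ w * χ (b p.1) := by
      rw [hχadd, hχadd, hχz, mul_one]
    have h0 : χ 0 = 1 := by
      have := hχz 0
      convert this using 2
      ext i <;> simp [zvec]
    have h2 : χ (-b p.1) * χ (b p.1) = 1 := by
      rw [← hχadd, neg_add_cancel, h0]
    simp only [hg]
    rw [h1, show w + zvec p.2 + b p.1 = w + b p.1 + zvec p.2 by abel]
    linear_combination (-α p.1 * φ (w + b p.1 + zvec p.2) * χ w) * h2
  have hga : ∀ a, Integrable (fun w => g (w + b a)) := fun a => hIntg.comp_add_right (b a)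
  have hFint : ∀ p : ι × (Fin n → ℤ), Integrable
      (fun w => α p.1 * φ (w + b p.1 + zvec p.2) * χ w) (volume.restrict (ustrip n)) := by
    intro p
    simp_rw [hF]
    exact (((hga p.1).comp_add_right (zvec p.2)).const_mul _).integrableOn
  have hnorm : ∀ a, HasSum (fun N : Fin n → ℤ => ∫ w in ustrip n,
      ‖α a * φ (w + b a + zvec N) * χ w‖) (‖α a‖ * ‖χ (-b a)‖ * ∫ w, ‖g w‖) := by
    intro a
    have h1 := (unfold_hasSum (hga a).norm).mul_left (‖α a‖ * ‖χ (-b a)‖)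
    rw [integral_add_right_eq_self (fun w => ‖g w‖) (b a)] at h1
    refine (congrArg (fun f => HasSum f _) (funext fun N => ?_)).mpr h1
    rw [← integral_const_mul]
    congr 1
    ext w
    rw [hF (a, N), norm_mul, norm_mul]
  have hcplx : ∀ a, HasSum (fun N : Fin n → ℤ => ∫ w in ustrip n,
      α a * φ (w + b a + zvec N) * χ w) (α a * χ (-b a) * ∫ w, g w) := by
    intro a
    have h1 := (unfold_hasSum (hga a)).mul_left (α a * χ (-b a))
    rw [integral_add_right_eq_self (fun w => g w) (b a)] at h1
    refine (congrArg (fun f => HasSum f _) (funext fun N => ?_)).mpr h1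
    rw [← integral_const_mul]
    congr 1
    ext w
    rw [hF (a, N)]
  have hs : Summable fun p : ι × (Fin n → ℤ) =>
      ∫ w in ustrip n, ‖α p.1 * φ (w + b p.1 + zvec p.2) * χ w‖ := by
    rw [summable_prod_of_nonneg (fun p => integral_nonneg fun _ => norm_nonneg _)]
    refine ⟨fun a => (hnorm a).summable, ?_⟩
    simp_rw [fun a => (hnorm a).tsum_eq]
    exact hsum.mul_right _
  have hGs' : ∀ w, HasSum (fun p : ι × (Fin n → ℤ) => α p.1 * φ (w + b p.1 + zvec p.2) * χ w)
      (G w * χ w) := fun w => (hGs w).mul_right _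
  refine ⟨integrable_of_hasSum (by fun_prop) hFint hs hGs', ?_⟩
  have h2 := hasSum_integral_of_summable_integral_norm hFint hs
  simp_rw [fun w => (hGs' w).tsum_eq] at h2
  have h3 := h2.prod_fiberwise hcplx
  rw [← h3.tsum_eq, tsum_mul_right]

/-- Character of the unit cube. -/
def echar {n : ℕ} (m : Fin n → ℤ) (u : Fin n → ℝ) : ℂ :=
  cexp (2 * π * I * ∑ l, (m l : ℂ) * (u l : ℂ))

/-- Fourier coefficient along the unit directions. -/
def ucoef {n : ℕ} (G : ℝ × (Fin n → ℝ) → ℂ) (m : Fin n → ℤ) (τ : ℝ) : ℂ :=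
  ∫ u in ucube n, G (τ, u) * echar m u

theorem continuous_echar {n : ℕ} (m : Fin n → ℤ) : Continuous (echar m) := by
  unfold echar; fun_prop

theorem continuous_ucoef {n : ℕ} {G : ℝ × (Fin n → ℝ) → ℂ} (hG : Continuous G)
    (m : Fin n → ℤ) : Continuous (ucoef G m) := by
  have h : ucube n =ᵐ[volume] Set.Icc (fun _ : Fin n => (0 : ℝ)) (fun _ => 1) := by
    have := Measure.univ_pi_Ioc_ae_eq_Icc (μ := fun _ : Fin n => (volume : Measure ℝ))
      (f := fun _ : Fin n => (0 : ℝ)) (g := fun _ => (1 : ℝ))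
    have e : ucube n = Set.univ.pi fun _ => Set.Ioc (0 : ℝ) 1 := by
      ext u; simp [ucube, Set.mem_pi]
    rw [e]; exact this
  have e : ucoef G m = fun τ => ∫ u in Set.Icc (fun _ : Fin n => (0 : ℝ)) (fun _ => 1),
      G (τ, u) * echar m u := by
    ext τ
    exact setIntegral_congr_set h
  rw [e]
  have he := continuous_echar m
  exact continuous_parametric_integral_of_continuous
    (by unfold Function.uncurry; fun_prop) isCompact_Icc

theorem unfold_laplace {n : ℕ} {ι : Type*} [Countable ι] {α : ι → ℂ} {b : ι → ℝ × (Fin n → ℝ)}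
    {φ G : ℝ × (Fin n → ℝ) → ℂ} (hG : Continuous G) (m : Fin n → ℤ) (s : ℂ)
    (hIntg : Integrable (fun w : ℝ × (Fin n → ℝ) => φ w * (cexp (s * w.1) * echar m w.2)))
    (hsum : Summable fun a => ‖α a‖ * Real.exp (-s.re * (b a).1))
    (hGs : ∀ w, HasSum (fun p : ι × (Fin n → ℤ) => α p.1 * φ (w + b p.1 + zvec p.2)) (G w)) :
    Integrable (fun τ : ℝ => ucoef G m τ * cexp (s * τ)) ∧
    ∫ τ : ℝ, ucoef G m τ * cexp (s * τ) =
      (∑' a, α a * (cexp (-s * (b a).1) * echar m (-(b a).2))) *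
        ∫ w : ℝ × (Fin n → ℝ), φ w * (cexp (s * w.1) * echar m w.2) := by
  have he := continuous_echar m
  have hen : ∀ u, ‖echar m u‖ = 1 := by
    intro u
    rw [echar, show 2 * π * I * ∑ l, (m l : ℂ) * (u l : ℂ) =
      ((2 * π * ∑ l, (m l : ℝ) * u l : ℝ) : ℂ) * I by push_cast; ring, norm_exp_ofReal_mul_I]
  obtain ⟨h1, h2⟩ := unfold_main (χ := fun w => cexp (s * w.1) * echar m w.2) hG (by fun_prop)
    (by
      intro v w
      simp only [echar, Prod.fst_add, Prod.snd_add, Pi.add_apply]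
      simp only [← Complex.exp_add]
      congr 1
      simp only [ofReal_add, mul_add, Finset.sum_add_distrib]
      ring)
    (by
      intro N
      simp only [zvec, echar, ofReal_zero, mul_zero, Complex.exp_zero, one_mul]
      rw [Complex.exp_eq_one_iff]
      refine ⟨∑ l, m l * N l, ?_⟩
      push_cast; ring)
    hIntg
    (by
      convert hsum using 2 with a
      rw [norm_mul, hen, mul_one, Complex.norm_exp]
      simp)
    hGs
  have hvol : (volume : Measure (ℝ × (Fin n → ℝ))).restrict (ustrip n) =
      (volume : Measure ℝ).prod ((volume : Measure (Fin n → ℝ)).restrict (ucube n)) := by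
    rw [ustrip, Measure.volume_eq_prod, ← Measure.prod_restrict, Measure.restrict_univ]
  rw [IntegrableOn, hvol] at h1
  rw [hvol] at h2
  have hin : ∀ τ : ℝ, ∫ u in ucube n, G (τ, u) * (cexp (s * τ) * echar m u) =
      ucoef G m τ * cexp (s * τ) := by
    intro τ
    rw [ucoef, ← integral_mul_const]
    congr 1; ext u; ring
  refine ⟨?_, ?_⟩
  · have := h1.integral_prod_left
    simpa only [hin] using this
  · rw [integral_prod _ h1] at h2
    simp only [hin] at h2
    rw [h2]
    simp

/-! ### Uniqueness of Fourier coefficients along the unit directions -/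

theorem torus_unique {n : ℕ} {D : (Fin n → ℝ) → ℂ} (hD : Continuous D)
    (hper : ∀ u (N : Fin n → ℤ), D (u + fun i => (N i : ℝ)) = D u)
    (h : ∀ m : Fin n → ℤ, ∫ u in ucube n, D u * echar m u = 0) : D = 0 := by
  have hq : IsOpenQuotientMap (Pi.map (fun (_ : Fin n) (x : ℝ) => (x : UnitAddCircle))) :=
    IsOpenQuotientMap.piMap (fun _ => QuotientAddGroup.isOpenQuotientMap_mk)
  let q : C(Fin n → ℝ, UnitAddTorus (Fin n)) := ⟨_, hq.continuous⟩
  have hq' : Topology.IsQuotientMap q := hq.isQuotientMap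
  have hfac : Function.FactorsThrough (⟨D, hD⟩ : C(Fin n → ℝ, ℂ)) q := by
    intro u v huv
    have h1 : ∀ i, ∃ N : ℤ, v i = u i + N := by
      intro i
      have h2 : ((u i : ℝ) : UnitAddCircle) = (v i : ℝ) := congrFun huv i
      have h3 : ((v i - u i : ℝ) : UnitAddCircle) = 0 := by
        rw [AddCircle.coe_sub, h2, sub_self]
      obtain ⟨N, hN⟩ := AddCircle.coe_eq_zero_iff (1 : ℝ) |>.1 h3
      refine ⟨N, ?_⟩
      simp at hN
      linarith
    choose N hN using h1
    have : v = u + fun i => (N i : ℝ) := funext hN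
    simp [this, hper]
  let f : C(UnitAddTorus (Fin n), ℂ) := hq'.lift ⟨D, hD⟩ hfac
  have hf : ∀ u : Fin n → ℝ, f (fun i => (u i : UnitAddCircle)) = D u := by
    intro u
    exact DFunLike.congr_fun (hq'.lift_comp ⟨D, hD⟩ hfac) u
  have hcoef : ∀ m, UnitAddTorus.mFourierCoeff f m = 0 := by
    intro m
    rw [UnitAddTorus.mFourierCoeff_eq_integral _ _ (fun _ => 0), ← h (-m)]
    refine congrArg _ (funext fun u => ?_)
    rw [hf, smul_eq_mul, mul_comm]
    congr 1
    rw [echar, UnitAddTorus.mFourier]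
    simp only [ContinuousMap.coe_mk, fourier_coe_apply]
    rw [← Complex.exp_sum, Finset.mul_sum]
    congr 1
    refine Finset.sum_congr rfl fun l _ => ?_
    simp; ring
  have hsum : Summable (UnitAddTorus.mFourierCoeff f) := by
    rw [show UnitAddTorus.mFourierCoeff f = 0 from funext hcoef]; exact summable_zero
  ext u
  have := UnitAddTorus.hasSum_mFourier_series_apply_of_summable hsum (fun i => (u i : UnitAddCircle))
  simp only [hcoef, zero_smul] at this
  rw [← hf u]
  exact this.unique hasSum_zero

theorem ucoef_unique {n : ℕ} {G H : ℝ × (Fin n → ℝ) → ℂ} (hG : Continuous G) (hH : Continuous H)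
    (hGp : ∀ w N, G (w + zvec N) = G w) (hHp : ∀ w N, H (w + zvec N) = H w)
    (h : ∀ m, ucoef G m = ucoef H m) : G = H := by
  ext ⟨τ, u⟩
  have := torus_unique (D := fun u => G (τ, u) - H (τ, u)) (by fun_prop) ?_ ?_
  · exact sub_eq_zero.1 (congrFun this u)
  · intro u N
    have h1 := hGp (τ, u) N
    have h2 := hHp (τ, u) N
    simp only [zvec, Prod.mk_add_mk, add_zero] at h1 h2
    simp only [h1, h2]
  · intro m
    have h1 := congrFun (h m) τ
    unfold ucoef at h1
    have he := continuous_echar m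
    have hfin : volume (ucube n) < ⊤ := by
      refine lt_of_le_of_lt (measure_mono (t := Set.Icc (fun _ => (0 : ℝ)) (fun _ => 1)) ?_)
        isCompact_Icc.measure_lt_top
      intro u hu
      exact ⟨fun i => (hu i).1.le, fun i => by simpa using (hu i).2⟩
    have hI : ∀ K : (Fin n → ℝ) → ℂ, Continuous K → IntegrableOn K (ucube n) := by
      intro K hK
      refine IntegrableOn.mono_set (t := Set.Icc (fun _ => (0 : ℝ)) (fun _ => 1))
        (hK.continuousOn.integrableOn_compact isCompact_Icc) ?_
      intro u hu
      exact ⟨fun i => (hu i).1.le, fun i => by simpa using (hu i).2⟩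
    simp only [sub_mul]
    rw [integral_sub (hI _ (by fun_prop)) (hI _ (by fun_prop)), h1, sub_self]

/-! ### Gamma integrals -/

theorem gamma_exp_integral {a : ℂ} (ha : 0 < a.re) :
    Integrable (fun x : ℝ => cexp (a * x) * cexp (-(2 * π * Real.exp x : ℝ))) ∧
    ∫ x : ℝ, cexp (a * x) * cexp (-(2 * π * Real.exp x : ℝ)) =
      cexp (-a * Real.log (2 * π)) * Complex.Gamma a := by
  have h2pi : 0 < 2 * π := by positivity
  have h := Complex.integral_cpow_mul_exp_neg_mul_Ioi ha h2pi
  have e1 : ∫ x : ℝ, cexp (a * x) * cexp (-(2 * π * Real.exp x : ℝ)) =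
      ∫ t : ℝ in Set.Ioi 0, (t : ℂ) ^ (a - 1) * cexp (-((2 * π : ℝ) * t)) := by
    have := integral_image_eq_integral_abs_deriv_smul (f := Real.exp) (s := Set.univ)
      MeasurableSet.univ (fun x _ => (Real.hasDerivAt_exp x).hasDerivWithinAt)
      Real.exp_injective.injOn (fun t : ℝ => (t : ℂ) ^ (a - 1) * cexp (-((2 * π : ℝ) * t)))
    rw [Set.image_univ, Real.range_exp, setIntegral_univ] at this
    rw [this]
    congr 1
    ext x
    rw [abs_of_pos (Real.exp_pos x), Complex.real_smul, ← mul_assoc]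
    congr 1
    · rw [Complex.cpow_def_of_ne_zero (by simp [Complex.exp_ne_zero]), ← Complex.ofReal_log (Real.exp_pos x).le,
        Real.log_exp, Complex.ofReal_exp, ← Complex.exp_add]
      congr 1; ring
    · congr 1; push_cast; ring
  have e2 : (1 / ((2 * π : ℝ) : ℂ)) ^ a = cexp (-a * Real.log (2 * π)) := by
    rw [one_div, Complex.cpow_def_of_ne_zero (by simp [Real.pi_ne_zero]), ← Complex.ofReal_inv,
      ← Complex.ofReal_log (by positivity), Real.log_inv]
    congr 1; push_cast; ring
  rw [e2] at h
  have e3 := e1.trans h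
  refine ⟨?_, e3⟩
  by_contra hn
  rw [integral_undef hn] at e3
  exact mul_ne_zero (Complex.exp_ne_zero _) (Complex.Gamma_ne_zero_of_re_pos ha) e3.symm

theorem gamma_line_bound {x : ℝ} (hx : 0 < x) : ∃ K, 0 ≤ K ∧ ∀ a : ℂ, a.re = x → ‖Complex.Gamma a‖ ≤ K := by
  refine ⟨∫ t : ℝ in Set.Ioi 0, Real.exp (-t) * t ^ (x - 1), ?_, ?_⟩
  · exact setIntegral_nonneg measurableSet_Ioi (fun t ht => by
      have : 0 < t := ht
      positivity)
  intro a ha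
  rw [Complex.Gamma_eq_integral (ha ▸ hx), Complex.GammaIntegral]
  refine (norm_integral_le_integral_norm _).trans (le_of_eq ?_)
  refine setIntegral_congr_fun measurableSet_Ioi fun t ht => ?_
  simp only [norm_mul]
  rw [Complex.norm_cpow_eq_rpow_re_of_pos ht, norm_real, Real.norm_of_nonneg (Real.exp_pos _).le]
  simp [ha]

theorem gamma_line_decay {x : ℝ} (hx : 1 ≤ x) : ∃ K, 0 ≤ K ∧ ∀ a : ℂ, a.re = x →
    ‖Complex.Gamma a‖ * (1 + a.im ^ 2) ≤ K := by
  obtain ⟨K, hK0, hK⟩ := gamma_line_bound (x := x + 2) (by linarith)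
  refine ⟨K, hK0, fun a ha => ?_⟩
  have h0 : a ≠ 0 := by rintro rfl; simp at ha; linarith
  have h1 : a + 1 ≠ 0 := by
    intro h
    have := congrArg Complex.re h
    simp [ha] at this; linarith
  have e1 := Complex.Gamma_add_one a h0
  have e2 := Complex.Gamma_add_one (a + 1) h1
  have e3 := hK (a + 1 + 1) (by simp [ha]; ring)
  rw [e2, e1, norm_mul, norm_mul] at e3
  have n1 : ‖a‖ ^ 2 = x ^ 2 + a.im ^ 2 := by
    rw [← Complex.normSq_eq_norm_sq, Complex.normSq_apply, ha]; ring
  have n2 : ‖a + 1‖ ^ 2 = (x + 1) ^ 2 + a.im ^ 2 := by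
    rw [← Complex.normSq_eq_norm_sq, Complex.normSq_apply]; simp [ha]; ring
  have n3 : ‖a‖ ≤ ‖a + 1‖ := by
    apply le_of_sq_le_sq _ (norm_nonneg _)
    rw [n1, n2]; nlinarith
  have n4 : 1 + a.im ^ 2 ≤ ‖a + 1‖ * ‖a‖ := by
    have := mul_le_mul_of_nonneg_right n3 (norm_nonneg a)
    nlinarith
  calc ‖Complex.Gamma a‖ * (1 + a.im ^ 2) ≤ ‖Complex.Gamma a‖ * (‖a + 1‖ * ‖a‖) := by gcongr
    _ = ‖a + 1‖ * (‖a‖ * ‖Complex.Gamma a‖) := by ring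
    _ ≤ K := e3

theorem gamma_prod_decay {r : ℕ} (j0 : Fin r) (κ : Fin r → ℕ) (ν : Fin r → ℂ)
    (hν : ∀ j, (ν j).re = 0) {x : ℝ} (hx : ∀ j, (κ j : ℝ) + 1 ≤ x) :
    ∃ K, 0 ≤ K ∧ ∀ s : ℂ, s.re = x →
      ‖∏ j, Complex.Gamma (s - (κ j : ℂ) + ν j)‖ * (1 + s.im ^ 2) ≤ K := by
  have h1 : ∀ j, ∃ K, 0 ≤ K ∧ ∀ a : ℂ, a.re = x - κ j → ‖Complex.Gamma a‖ ≤ K := fun j =>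
    gamma_line_bound (by linarith [hx j])
  choose K hK0 hK using h1
  obtain ⟨K', hK'0, hK'⟩ := gamma_line_decay (x := x - κ j0) (by linarith [hx j0])
  have hre : ∀ (s : ℂ) j, s.re = x → (s - (κ j : ℂ) + ν j).re = x - κ j := by
    intro s j hs
    simp [hs, hν]
  refine ⟨(∏ j ∈ Finset.univ.erase j0, K j) * (K' * (2 * (1 + (ν j0).im ^ 2))), ?_, ?_⟩
  · have := Finset.prod_nonneg (s := Finset.univ.erase j0) (fun j _ => hK0 j)
    positivity
  intro s hs
  rw [norm_prod, ← Finset.prod_erase_mul _ _ (Finset.mem_univ j0), mul_assoc]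
  have a1 : ∏ j ∈ Finset.univ.erase j0, ‖Complex.Gamma (s - (κ j : ℂ) + ν j)‖ ≤
      ∏ j ∈ Finset.univ.erase j0, K j :=
    Finset.prod_le_prod (fun _ _ => norm_nonneg _) (fun j _ => hK j _ (hre s j hs))
  have a2 := hK' _ (hre s j0 hs)
  have him : (s - (κ j0 : ℂ) + ν j0).im = s.im + (ν j0).im := by simp
  rw [him] at a2
  refine mul_le_mul a1 ?_ (by positivity) (Finset.prod_nonneg (fun j _ => hK0 j))
  calc ‖Complex.Gamma (s - (κ j0 : ℂ) + ν j0)‖ * (1 + s.im ^ 2)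
      ≤ ‖Complex.Gamma (s - (κ j0 : ℂ) + ν j0)‖ *
        ((1 + (s.im + (ν j0).im) ^ 2) * (2 * (1 + (ν j0).im ^ 2))) := by
        gcongr
        nlinarith [sq_nonneg (s.im + 2 * (ν j0).im),
          mul_nonneg (sq_nonneg (s.im + (ν j0).im)) (sq_nonneg (ν j0).im)]
    _ = (‖Complex.Gamma (s - (κ j0 : ℂ) + ν j0)‖ *
        (1 + (s.im + (ν j0).im) ^ 2)) * (2 * (1 + (ν j0).im ^ 2)) := by ring
    _ ≤ _ := by gcongr

/-- The archimedean kernel in logarithmic coordinates. -/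
def aphi {r : ℕ} (κ : Fin r → ℕ) (x : Fin r → ℝ) : ℂ :=
  ∏ j, (cexp (-(κ j : ℂ) * x j) * cexp (-(2 * π * Real.exp (x j) : ℝ)))

theorem aphi_integral {r : ℕ} (κ : Fin r → ℕ) (ν : Fin r → ℂ)
    (hν : ∀ j, (ν j).re = 0) {s : ℂ} (hs : ∀ j, (κ j : ℝ) < s.re) :
    Integrable (fun x : Fin r → ℝ => aphi κ x * cexp (∑ j, (s + ν j) * x j)) ∧
    ∫ x : Fin r → ℝ, aphi κ x * cexp (∑ j, (s + ν j) * x j) =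
      ∏ j, (cexp (-(s - (κ j : ℂ) + ν j) * Real.log (2 * π)) *
        Complex.Gamma (s - (κ j : ℂ) + ν j)) := by
  have h1 : ∀ j, 0 < (s - (κ j : ℂ) + ν j).re := by
    intro j; simp [hν]; exact hs j
  have e : (fun x : Fin r → ℝ => aphi κ x * cexp (∑ j, (s + ν j) * x j)) =
      fun x => ∏ j, (cexp ((s - (κ j : ℂ) + ν j) * x j) *
        cexp (-(2 * π * Real.exp (x j) : ℝ))) := by
    ext x
    rw [aphi, Complex.exp_sum, ← Finset.prod_mul_distrib]
    refine Finset.prod_congr rfl fun j _ => ?_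
    rw [mul_right_comm, ← Complex.exp_add]
    congr 2; ring
  rw [e]
  refine ⟨Integrable.fintype_prod (f := fun j (y : ℝ) => cexp ((s - (κ j : ℂ) + ν j) * y) *
        cexp (-(2 * π * Real.exp y : ℝ))) fun j => (gamma_exp_integral (h1 j)).1, ?_⟩
  rw [integral_fintype_prod_volume_eq_prod (fun j (y : ℝ) => cexp ((s - (κ j : ℂ) + ν j) * y) *
        cexp (-(2 * π * Real.exp y : ℝ)))]
  exact Finset.prod_congr rfl fun j _ => (gamma_exp_integral (h1 j)).2

theorem haar_transfer {n r : ℕ} (L : (ℝ × (Fin n → ℝ)) ≃L[ℝ] (Fin r → ℝ)) :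
    ∃ K : ℂ, ∀ g : (Fin r → ℝ) → ℂ, (Integrable g → Integrable (fun w => g (L w))) ∧
      ∫ w, g (L w) = K * ∫ x, g x := by
  have hhaar : (Measure.map L (volume : Measure (ℝ × (Fin n → ℝ)))).IsAddHaarMeasure :=
    L.isAddHaarMeasure_map _
  have hc := Measure.isAddLeftInvariant_eq_smul
    (Measure.map L (volume : Measure (ℝ × (Fin n → ℝ)))) (volume : Measure (Fin r → ℝ))
  set c := Measure.addHaarScalarFactor
    (Measure.map L (volume : Measure (ℝ × (Fin n → ℝ)))) (volume : Measure (Fin r → ℝ))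
  have hme : MeasurableEmbedding L := L.toHomeomorph.measurableEmbedding
  refine ⟨((c : ℝ) : ℂ), fun g => ⟨fun hg => ?_, ?_⟩⟩
  · have : Integrable g (Measure.map L (volume : Measure (ℝ × (Fin n → ℝ)))) := by
      rw [hc]; exact hg.smul_measure_nnreal
    exact (hme.integrable_map_iff).1 this
  · rw [← hme.integral_map, hc, integral_smul_nnreal_measure, NNReal.smul_def, Complex.real_smul]

/-- The arithmetic data: real embeddings and totally positive fundamental units. -/
structure Dat (F : Type*) [Field F] [NumberField F] (r : ℕ) where
  hr : 1 < r
  hrank : Module.finrank ℚ F = r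
  σ : Fin r → (F →+* ℝ)
  hσ : Function.Injective σ
  ε : Fin (r - 1) → (𝓞 F)ˣ
  hεpos : ∀ l j, 0 < σ j (algebraMap (𝓞 F) F (ε l))
  hεbasis : ∀ v : (𝓞 F)ˣ, (∀ j, 0 < σ j (algebraMap (𝓞 F) F v)) →
      ∃! n : Fin (r - 1) → ℤ, v = ∏ l, ε l ^ n l

theorem Dat.prod_sigma {F : Type*} [Field F] [NumberField F] {r : ℕ} (D : Dat F r) (x : F) :
    ∏ j, D.σ j x = ((Algebra.norm ℚ x : ℚ) : ℝ) := by
  let e : Fin r → (F →ₐ[ℚ] ℂ) := fun j => (Complex.ofRealHom.comp (D.σ j)).toRatAlgHom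
  have he : Function.Injective e := by
    intro i j h
    apply D.hσ
    ext y
    have := DFunLike.congr_fun h y
    simpa [e] using this
  have hb : Function.Bijective e := by
    rw [Fintype.bijective_iff_injective_and_card]
    refine ⟨he, ?_⟩
    rw [AlgHom.card ℚ F ℂ, D.hrank, Fintype.card_fin]
  have h1 := Algebra.norm_eq_prod_embeddings ℚ ℂ x
  rw [← hb.prod_comp (fun f : F →ₐ[ℚ] ℂ => f x)] at h1
  have h2 : ((∏ j, D.σ j x : ℝ) : ℂ) = (((Algebra.norm ℚ x : ℚ) : ℝ) : ℂ) := by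
    push_cast
    simpa [e] using h1.symm
  exact_mod_cast h2

theorem Dat.absNorm_span {F : Type*} [Field F] [NumberField F] {r : ℕ} (D : Dat F r) {x : F}
    (hx : ∀ j, 0 < D.σ j x) :
    ((absNorm (spanSingleton (𝓞 F)⁰ x) : ℚ) : ℝ) = ∏ j, D.σ j x := by
  rw [D.prod_sigma, FractionalIdeal.absNorm_span_singleton, Rat.cast_abs, abs_of_nonneg]
  rw [← D.prod_sigma]
  exact Finset.prod_nonneg fun j _ => (hx j).le

theorem Dat.norm_lower {F : Type*} [Field F] [NumberField F] {r : ℕ} (D : Dat F r)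
    (I : FractionalIdeal (𝓞 F)⁰ F) (hI : I ≠ 0) :
    ∃ c : ℝ, 0 < c ∧ ∀ x ∈ I, x ≠ 0 → c ≤ ∏ j, |D.σ j x| := by
  refine ⟨((absNorm I : ℚ) : ℝ), ?_, ?_⟩
  · have : absNorm I ≠ 0 := by
      rwa [Ne, FractionalIdeal.absNorm_eq_zero_iff]
    exact_mod_cast lt_of_le_of_ne (FractionalIdeal.absNorm_nonneg I) (Ne.symm this)
  · intro x hx hx0
    have h1 : spanSingleton (𝓞 F)⁰ x ≤ I := by
      rwa [FractionalIdeal.spanSingleton_le_iff_mem]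
    have h3 : ∃ J : Ideal (𝓞 F), spanSingleton (𝓞 F)⁰ x = I * (J : FractionalIdeal (𝓞 F)⁰ F) := by
      have : spanSingleton (𝓞 F)⁰ x * I⁻¹ ≤ 1 := by
        calc _ ≤ I * I⁻¹ := by gcongr
          _ = 1 := mul_inv_cancel₀ hI
      obtain ⟨J, hJ⟩ := FractionalIdeal.le_one_iff_exists_coeIdeal.mp this
      refine ⟨J, ?_⟩
      rw [hJ, mul_comm, mul_assoc, inv_mul_cancel₀ hI, mul_one]
    obtain ⟨J, hJ⟩ := h3
    have hs : spanSingleton (𝓞 F)⁰ x ≠ 0 := by rwa [Ne, FractionalIdeal.spanSingleton_eq_zero_iff]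
    have hJ0 : J ≠ ⊥ := by
      rintro rfl
      apply hs
      rw [hJ]; simp
    have h4 : absNorm (spanSingleton (𝓞 F)⁰ x) = absNorm I * Ideal.absNorm J := by
      rw [hJ, map_mul, FractionalIdeal.coeIdeal_absNorm]
    have h5 : absNorm I ≤ absNorm (spanSingleton (𝓞 F)⁰ x) := by
      rw [h4]
      have : (1:ℚ) ≤ Ideal.absNorm J := by
        exact_mod_cast Nat.one_le_iff_ne_zero.mpr (by rwa [Ne, Ideal.absNorm_eq_zero_iff])
      nlinarith [FractionalIdeal.absNorm_nonneg I]
    rw [← Finset.abs_prod, D.prod_sigma, ← Rat.cast_abs, ← FractionalIdeal.absNorm_span_singleton (R := 𝓞 F)]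
    exact_mod_cast h5

/-- Trace of an element. -/
def Dat.T {F : Type*} [Field F] [NumberField F] {r : ℕ} (D : Dat F r) (x : F) : ℝ := ∑ j, D.σ j x

/-- Totally positive elements of a fractional ideal. -/
abbrev Dat.S {F : Type*} [Field F] [NumberField F] {r : ℕ} (D : Dat F r)
    (I : FractionalIdeal (𝓞 F)⁰ F) : Type _ := {x : F // x ∈ I ∧ ∀ j, 0 < D.σ j x}

theorem Dat.exists_summable {F : Type*} [Field F] [NumberField F] {r : ℕ} (D : Dat F r)
    (I : FractionalIdeal (𝓞 F)⁰ F) (hI : I ≠ 0) :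
    ∃ p : ℕ, Summable fun x : D.S I => (D.T x.1)⁻¹ ^ p := by
  obtain ⟨c, hc, hcI⟩ := D.norm_lower I hI
  have hr0 : 0 < r := by have := D.hr; omega
  let f : F →ₗ[ℤ] (Fin r → ℝ) := (AddMonoidHom.mk' (fun x j => D.σ j x) (by
    intro a b; ext j; simp)).toIntLinearMap
  have hf : ∀ x j, f x j = D.σ j x := fun x j => rfl
  let Ls : Submodule ℤ (Fin r → ℝ) := (((I : Submodule (𝓞 F) F).restrictScalars ℤ).map f)
  have hdisc : DiscreteTopology Ls := by
    apply discreteTopology_of_isOpen_singleton_zero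
    rw [Metric.isOpen_singleton_iff]
    refine ⟨min 1 c, by positivity, ?_⟩
    rintro ⟨y, hy⟩ hd
    obtain ⟨x, hx, rfl⟩ := Submodule.mem_map.mp hy
    have hxI : x ∈ I := hx
    have hn : ‖f x‖ < min 1 c := by simpa [dist_eq_norm] using hd
    by_contra hne
    have hx0 : x ≠ 0 := by
      rintro rfl
      apply hne
      ext1; simp
    have h1 := hcI x hxI hx0
    have hle : ∀ j, |D.σ j x| ≤ ‖f x‖ := fun j => norm_le_pi_norm (f x) j
    have h2 : ∏ j, |D.σ j x| ≤ ‖f x‖ := by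
      calc ∏ j, |D.σ j x| ≤ ∏ j : Fin r, ‖f x‖ :=
            Finset.prod_le_prod (fun j _ => abs_nonneg _) (fun j _ => hle j)
        _ = ‖f x‖ ^ r := by simp
        _ ≤ ‖f x‖ ^ 1 := pow_le_pow_of_le_one (norm_nonneg _) (hn.le.trans (min_le_left _ _)) hr0
        _ = _ := pow_one _
    have := hn.trans_le (min_le_right _ _)
    linarith
  refine ⟨Module.finrank ℤ Ls + 1, ?_⟩
  have hs := ZLattice.summable_norm_pow_inv Ls (Module.finrank ℤ Ls + 1) (Nat.lt_succ_self _)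
  let g : D.S I → Ls := fun x => ⟨f x.1, Submodule.mem_map_of_mem (by exact x.2.1)⟩
  have hg : Function.Injective g := by
    intro x y h
    have : D.σ ⟨0, hr0⟩ x.1 = D.σ ⟨0, hr0⟩ y.1 := congrFun (congrArg Subtype.val h) ⟨0, hr0⟩
    exact Subtype.ext ((D.σ ⟨0, hr0⟩).injective this)
  refine Summable.of_nonneg_of_le ?_ ?_ (hs.comp_injective hg)
  · intro x
    have : 0 ≤ D.T x.1 := Finset.sum_nonneg fun j _ => (x.2.2 j).le
    positivity
  · intro x
    have hpos : 0 < ‖g x‖ := by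
      have : 0 < D.σ ⟨0, hr0⟩ x.1 := x.2.2 _
      refine this.trans_le ?_
      refine (le_abs_self _).trans (norm_le_pi_norm (f x.1) ⟨0, hr0⟩)
    have hle : ‖g x‖ ≤ D.T x.1 := by
      refine (pi_norm_le_iff_of_nonneg (Finset.sum_nonneg fun j _ => (x.2.2 j).le)).mpr fun j => ?_
      change ‖D.σ j x.1‖ ≤ _
      rw [Real.norm_of_nonneg (x.2.2 j).le]
      exact Finset.single_le_sum (f := fun j => D.σ j x.1) (fun j _ => (x.2.2 j).le) (Finset.mem_univ j)
    simp only [Function.comp]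
    have h0 := hpos.trans_le hle
    gcongr

section DatB2
variable {F : Type*} [Field F] [NumberField F] {r : ℕ} (D : Dat F r)

theorem Dat.T_pos {x : F} (hx : ∀ j, 0 < D.σ j x) : 0 < D.T x := by
  have : 0 < r := by have := D.hr; omega
  exact Finset.sum_pos (fun j _ => hx j) ⟨⟨0, this⟩, Finset.mem_univ _⟩

theorem Dat.le_T {x : F} (hx : ∀ j, 0 < D.σ j x) (j : Fin r) : D.σ j x ≤ D.T x :=
  Finset.single_le_sum (f := fun j => D.σ j x) (fun j _ => (hx j).le) (Finset.mem_univ j)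

theorem Dat.exp_summable (I : FractionalIdeal (𝓞 F)⁰ F) (hI : I ≠ 0) (p : ℕ) {δ : ℝ} (hδ : 0 < δ) :
    Summable fun x : D.S I => (D.T x.1) ^ p * Real.exp (-(δ * D.T x.1)) := by
  obtain ⟨p0, hp0⟩ := D.exists_summable I hI
  refine Summable.of_nonneg_of_le (fun x => ?_) (fun x => ?_)
    (hp0.mul_left (((p + p0).factorial : ℝ) / δ ^ (p + p0)))
  · have := D.T_pos x.2.2
    positivity
  · have hT := D.T_pos x.2.2
    set T := D.T x.1
    have h := Real.pow_div_factorial_le_exp (δ * T) (by positivity) (p + p0)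
    rw [Real.exp_neg, inv_pow, ← div_eq_mul_inv, ← div_eq_mul_inv, div_div, div_le_div_iff₀ (by positivity) (by positivity)]
    rw [div_le_iff₀ (by positivity), mul_pow] at h
    calc T ^ p * (δ ^ (p + p0) * T ^ p0) = δ ^ (p + p0) * T ^ (p + p0) := by ring
      _ ≤ _ := h
      _ = _ := by ring

theorem Dat.prod_inv_bound (I : FractionalIdeal (𝓞 F)⁰ F) (hI : I ≠ 0) (κ : Fin r → ℕ) :
    ∃ (C : ℝ) (p : ℕ), 0 ≤ C ∧ ∀ x : D.S I, ‖∏ j, ((D.σ j x.1 : ℝ) : ℂ) ^ (-(κ j : ℤ))‖ ≤ C * D.T x.1 ^ p := by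
  obtain ⟨c, hc, hcI⟩ := D.norm_lower I hI
  have hr0 : 0 < r := by have := D.hr; omega
  refine ⟨∏ j, c⁻¹ ^ κ j, ∑ j, (r - 1) * κ j, by positivity, fun x => ?_⟩
  have hT := D.T_pos x.2.2
  have hx0 : x.1 ≠ 0 := by
    intro h
    have := x.2.2 ⟨0, hr0⟩
    rw [h] at this; simp at this
  have hj : ∀ j, (D.σ j x.1)⁻¹ ≤ c⁻¹ * D.T x.1 ^ (r - 1) := by
    intro j
    have h1 := hcI x.1 x.2.1 hx0
    have hp := x.2.2 j
    rw [← Finset.mul_prod_erase _ _ (Finset.mem_univ j)] at h1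
    have h2 : ∏ i ∈ Finset.univ.erase j, |D.σ i x.1| ≤ D.T x.1 ^ (r - 1) := by
      calc _ ≤ ∏ i ∈ Finset.univ.erase j, D.T x.1 := by
            refine Finset.prod_le_prod (fun _ _ => abs_nonneg _) fun i _ => ?_
            rw [abs_of_pos (x.2.2 i)]; exact D.le_T x.2.2 i
        _ = _ := by simp
    rw [abs_of_pos hp] at h1
    have h3 : c ≤ D.σ j x.1 * D.T x.1 ^ (r - 1) := h1.trans (by gcongr)
    rw [inv_le_iff_one_le_mul₀ hp, mul_comm, mul_left_comm, ← div_eq_inv_mul, one_le_div hc]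
    exact h3
  rw [norm_prod, ← Finset.prod_pow_eq_pow_sum, ← Finset.prod_mul_distrib]
  refine Finset.prod_le_prod (fun _ _ => norm_nonneg _) fun j _ => ?_
  rw [zpow_neg, zpow_natCast, norm_inv, norm_pow, Complex.norm_real, Real.norm_of_nonneg (x.2.2 j).le, ← inv_pow,
    pow_mul, ← mul_pow]
  have := x.2.2 j
  gcongr
  exact hj j

theorem Aext_coe (A : Ideal (𝓞 F) → ℂ) (a : Ideal (𝓞 F)) :
    Aext F A (a : FractionalIdeal (𝓞 F)⁰ F) = A a := by
  unfold Aext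
  have h : ∃ J : Ideal (𝓞 F), (J : FractionalIdeal (𝓞 F)⁰ F) = a := ⟨a, rfl⟩
  rw [dif_pos h]
  congr 1
  exact FractionalIdeal.coeIdeal_injective h.choose_spec

/-- Polynomial growth hypothesis with natural exponent. -/
def PolyGrowth (A : Ideal (𝓞 F) → ℂ) (c : ℕ) (M : ℝ) : Prop :=
  0 ≤ M ∧ ∀ a : Ideal (𝓞 F), a ≠ 0 → ‖A a‖ ≤ M * (Ideal.absNorm a : ℝ) ^ c

theorem span_ne {x : F} (hx : x ≠ 0) : spanSingleton (𝓞 F)⁰ x ≠ 0 := by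
  rwa [Ne, FractionalIdeal.spanSingleton_eq_zero_iff]

theorem Dat.ne_zero {x : F} (hx : ∀ j, 0 < D.σ j x) : x ≠ 0 := by
  have hr0 : 0 < r := by have := D.hr; omega
  intro h
  have := hx ⟨0, hr0⟩
  rw [h] at this; simp at this

theorem Dat.Aext_bound {A : Ideal (𝓞 F) → ℂ} {c : ℕ} {M : ℝ} (hA : PolyGrowth A c M)
    (J : FractionalIdeal (𝓞 F)⁰ F) (hJ : J ≠ 0) {x : F} (hx : ∀ j, 0 < D.σ j x) :
    ‖Aext F A (spanSingleton (𝓞 F)⁰ x * J)‖ ≤ (M * ((absNorm J : ℚ) : ℝ) ^ c) * D.T x ^ (r * c) := by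
  have hT := D.T_pos hx
  have hM := hA.1
  have hJ1 : (0:ℝ) ≤ ((absNorm J : ℚ) : ℝ) := by exact_mod_cast FractionalIdeal.absNorm_nonneg J
  by_cases h : ∃ a : Ideal (𝓞 F), (a : FractionalIdeal (𝓞 F)⁰ F) = spanSingleton (𝓞 F)⁰ x * J
  · obtain ⟨a, ha⟩ := h
    have hne : (a : FractionalIdeal (𝓞 F)⁰ F) ≠ 0 := by
      rw [ha]; exact mul_ne_zero (span_ne (D.ne_zero hx)) hJ
    have ha0 : a ≠ 0 := by
      rintro rfl; simp at hne
    rw [← ha, Aext_coe]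
    have hn : (Ideal.absNorm a : ℝ) = (∏ j, D.σ j x) * ((absNorm J : ℚ) : ℝ) := by
      rw [← D.absNorm_span hx, ← Rat.cast_mul, ← map_mul, ← ha, FractionalIdeal.coeIdeal_absNorm]
      simp
    refine (hA.2 a ha0).trans ?_
    rw [hn, mul_pow, mul_comm _ (_ ^ c), ← mul_assoc, pow_mul]
    have : ∏ j, D.σ j x ≤ D.T x ^ r := by
      calc _ ≤ ∏ j : Fin r, D.T x := Finset.prod_le_prod (fun j _ => (hx j).le) (fun j _ => D.le_T hx j)
        _ = _ := by simp
    have h0 : 0 ≤ ∏ j, D.σ j x := Finset.prod_nonneg (fun j _ => (hx j).le)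
    gcongr
  · unfold Aext
    rw [dif_neg h]
    simp only [norm_zero]
    positivity

/-- The different as a fractional ideal. -/
abbrev dd (F : Type*) [Field F] [NumberField F] : FractionalIdeal (𝓞 F)⁰ F :=
  (differentIdeal ℤ (𝓞 F) : FractionalIdeal (𝓞 F)⁰ F)

theorem dd_ne : dd F ≠ 0 := by
  rw [Ne, FractionalIdeal.coeIdeal_eq_zero]
  exact differentIdeal_ne_bot

/-- coefficient of the Fourier expansion -/
def Dat.coef (κ : Fin r → ℕ) (A : Ideal (𝓞 F) → ℂ) (t : Ideal (𝓞 F)) (x : F) : ℂ :=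
  Aext F A (spanSingleton (𝓞 F)⁰ x * ((t : FractionalIdeal (𝓞 F)⁰ F))⁻¹ * dd F) *
    (∏ j, ((D.σ j x : ℝ) : ℂ) ^ (-(κ j : ℤ)))

/-- index set of the Fourier expansion -/
abbrev Dat.St (t : Ideal (𝓞 F)) : Type _ := D.S ((t : FractionalIdeal (𝓞 F)⁰ F) * (dd F)⁻¹)

theorem Dat.coef_bound {A : Ideal (𝓞 F) → ℂ} {c : ℕ} {M : ℝ} (hA : PolyGrowth A c M)
    (κ : Fin r → ℕ) {t : Ideal (𝓞 F)} (ht : t ≠ 0) :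
    ∃ (C : ℝ) (p : ℕ), 0 ≤ C ∧ ∀ x : D.St t, ‖D.coef κ A t x.1‖ ≤ C * D.T x.1 ^ p := by
  have ht' : (t : FractionalIdeal (𝓞 F)⁰ F) ≠ 0 := by rwa [Ne, FractionalIdeal.coeIdeal_eq_zero]
  have hI : (t : FractionalIdeal (𝓞 F)⁰ F) * (dd F)⁻¹ ≠ 0 := mul_ne_zero ht' (inv_ne_zero dd_ne)
  obtain ⟨C, p, hC, h⟩ := D.prod_inv_bound _ hI κ
  have hJ : ((t : FractionalIdeal (𝓞 F)⁰ F))⁻¹ * dd F ≠ 0 := mul_ne_zero (inv_ne_zero ht') dd_ne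
  have hM := hA.1
  have hJ1 : (0:ℝ) ≤ ((absNorm (((t : FractionalIdeal (𝓞 F)⁰ F))⁻¹ * dd F) : ℚ) : ℝ) := by
    exact_mod_cast FractionalIdeal.absNorm_nonneg _
  refine ⟨(M * ((absNorm (((t : FractionalIdeal (𝓞 F)⁰ F))⁻¹ * dd F) : ℚ) : ℝ) ^ c) * C, r * c + p, by positivity, fun x => ?_⟩
  unfold Dat.coef
  rw [norm_mul, mul_assoc (spanSingleton _ _)]
  calc _ ≤ ((M * ((absNorm (((t : FractionalIdeal (𝓞 F)⁰ F))⁻¹ * dd F) : ℚ) : ℝ) ^ c) * D.T x.1 ^ (r * c)) * (C * D.T x.1 ^ p) := by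
        have hT := D.T_pos x.2.2
        gcongr
        · exact D.Aext_bound hA _ hJ x.2.2
        · exact h x
    _ = _ := by ring

/-- Fourier term. -/
def Dat.fterm (κ : Fin r → ℕ) (A : Ideal (𝓞 F) → ℂ) (t : Ideal (𝓞 F)) (x : F) (z : Fin r → ℂ) : ℂ :=
  D.coef κ A t x * cexp (2 * π * I * ∑ j, ((D.σ j x : ℝ) : ℂ) * z j)

theorem Dat.fterm_bound {A : Ideal (𝓞 F) → ℂ} {c : ℕ} {M : ℝ} (hA : PolyGrowth A c M)
    (κ : Fin r → ℕ) {t : Ideal (𝓞 F)} (ht : t ≠ 0) {δ : ℝ} (hδ : 0 < δ) :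
    ∃ u : D.St t → ℝ, Summable u ∧ ∀ x : D.St t, ∀ z : Fin r → ℂ, (∀ j, δ ≤ (z j).im) →
      ‖D.fterm κ A t x.1 z‖ ≤ u x := by
  have ht' : (t : FractionalIdeal (𝓞 F)⁰ F) ≠ 0 := by rwa [Ne, FractionalIdeal.coeIdeal_eq_zero]
  have hI : (t : FractionalIdeal (𝓞 F)⁰ F) * (dd F)⁻¹ ≠ 0 := mul_ne_zero ht' (inv_ne_zero dd_ne)
  obtain ⟨C, p, hC, h⟩ := D.coef_bound hA κ ht
  refine ⟨fun x => C * ((D.T x.1) ^ p * Real.exp (-((2 * π * δ) * D.T x.1))),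
    (D.exp_summable _ hI p (by positivity)).mul_left _, fun x z hz => ?_⟩
  unfold Dat.fterm
  beta_reduce
  rw [norm_mul, Complex.norm_exp, ← mul_assoc]
  have hT := D.T_pos x.2.2
  gcongr
  · exact h x
  · have : (2 * π * I * ∑ j, ((D.σ j x.1 : ℝ) : ℂ) * z j).re = -(2 * π * ∑ j, D.σ j x.1 * (z j).im) := by
      have h1 : (2 * π * I * ∑ j, ((D.σ j x.1 : ℝ) : ℂ) * z j) = ((2 * π : ℝ) : ℂ) * (I * ∑ j, ((D.σ j x.1 : ℝ) : ℂ) * z j) := by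
        push_cast; ring
      rw [h1, Complex.re_ofReal_mul, Complex.I_mul_re, Complex.im_sum]
      simp
    rw [this]
    have h2 : δ * D.T x.1 ≤ ∑ j, D.σ j x.1 * (z j).im := by
      unfold Dat.T
      rw [Finset.mul_sum]
      refine Finset.sum_le_sum fun j _ => ?_
      rw [mul_comm]
      have := x.2.2 j
      gcongr
      exact hz j
    have := mul_le_mul_of_nonneg_left h2 (show 0 ≤ 2 * π by positivity)
    linarith

theorem exists_delta {r : ℕ} (z : Fin r → ℂ) (hz : ∀ j, 0 < (z j).im) :
    ∃ δ : ℝ, 0 < δ ∧ ∀ j, δ < (z j).im := by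
  rcases isEmpty_or_nonempty (Fin r) with h | h
  · exact ⟨1, one_pos, fun j => h.elim j⟩
  · obtain ⟨j0, hj0⟩ := Finite.exists_min (fun j => (z j).im)
    exact ⟨(z j0).im / 2, half_pos (hz j0), fun j => (half_lt_self (hz j0)).trans_le (hj0 j)⟩

/-- Fourier series. -/
def Dat.fsum (κ : Fin r → ℕ) (A : Ideal (𝓞 F) → ℂ) (t : Ideal (𝓞 F)) (z : Fin r → ℂ) : ℂ :=
  ∑' x : D.St t, D.fterm κ A t x.1 z

theorem Dat.fterm_summable {A : Ideal (𝓞 F) → ℂ} {c : ℕ} {M : ℝ} (hA : PolyGrowth A c M)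
    (κ : Fin r → ℕ) {t : Ideal (𝓞 F)} (ht : t ≠ 0) (z : Fin r → ℂ) (hz : ∀ j, 0 < (z j).im) :
    Summable fun x : D.St t => D.fterm κ A t x.1 z := by
  obtain ⟨δ, hδ, h⟩ := exists_delta z hz
  obtain ⟨u, hu, hb⟩ := D.fterm_bound hA κ ht hδ
  exact Summable.of_norm_bounded hu fun x => hb x z fun j => (h j).le

theorem Dat.fsum_continuousAt {A : Ideal (𝓞 F) → ℂ} {c : ℕ} {M : ℝ} (hA : PolyGrowth A c M)
    (κ : Fin r → ℕ) {t : Ideal (𝓞 F)} (ht : t ≠ 0) (z : Fin r → ℂ) (hz : ∀ j, 0 < (z j).im) :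
    ContinuousAt (D.fsum κ A t) z := by
  obtain ⟨δ, hδ, h⟩ := exists_delta z hz
  obtain ⟨u, hu, hb⟩ := D.fterm_bound hA κ ht hδ
  have hc : ContinuousOn (D.fsum κ A t) {z | ∀ j, δ ≤ (z j).im} := by
    refine continuousOn_tsum (fun x => ?_) hu (fun x z hz => hb x z hz)
    unfold Dat.fterm
    fun_prop
  refine hc.continuousAt ?_
  have hopen : IsOpen {z : Fin r → ℂ | ∀ j, δ < (z j).im} := by
    have h2 : {z : Fin r → ℂ | ∀ j, δ < (z j).im} = ⋂ j, {z : Fin r → ℂ | δ < (z j).im} := by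
      ext; simp
    rw [h2]
    exact isOpen_iInter_of_finite fun j => isOpen_lt continuous_const (by fun_prop)
  exact Filter.mem_of_superset (hopen.mem_nhds h) fun z hz j => (hz j).le

theorem Dat.fsum_differentiableAt {A : Ideal (𝓞 F) → ℂ} {c : ℕ} {M : ℝ} (hA : PolyGrowth A c M)
    (κ : Fin r → ℕ) {t : Ideal (𝓞 F)} (ht : t ≠ 0) (z : Fin r → ℂ) (hz : ∀ j, 0 < (z j).im)
    (i : Fin r) (w : ℂ) (hw : 0 < w.im) :
    DifferentiableAt ℂ (fun w => D.fsum κ A t (Function.update z i w)) w := by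
  have hz' : ∀ j, 0 < (Function.update z i w j).im := by
    intro j
    by_cases hj : j = i
    · subst hj; simpa using hw
    · simpa [hj] using hz j
  obtain ⟨δ, hδ, h⟩ := exists_delta _ hz'
  obtain ⟨u, hu, hb⟩ := D.fterm_bound hA κ ht hδ
  have hopen : IsOpen {w : ℂ | δ < w.im} := isOpen_lt continuous_const Complex.continuous_im
  have hd : DifferentiableOn ℂ (fun w => D.fsum κ A t (Function.update z i w)) {w : ℂ | δ < w.im} := by
    refine differentiableOn_tsum_of_summable_norm hu (fun x => ?_) hopen (fun x v hv => hb x _ fun j => ?_)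
    · unfold Dat.fterm
      refine (DifferentiableOn.cexp ?_).const_mul _
      refine DifferentiableOn.const_mul ?_ _
      refine DifferentiableOn.fun_sum fun j _ => ?_
      by_cases hj : j = i
      · subst hj; simp only [Function.update_self]; fun_prop
      · simp only [Function.update_of_ne hj]; fun_prop
    · by_cases hj : j = i
      · subst hj; simpa using le_of_lt hv
      · have := h j
        simp only [Function.update_of_ne hj] at this ⊢
        exact this.le
  refine hd.differentiableAt (hopen.mem_nhds ?_)
  have := h i
  simpa using this

theorem Dat.hilbertF_eq (k : Fin r → ℕ) (k0 : ℕ) (A : Ideal (𝓞 F) → ℂ) (t : Ideal (𝓞 F)) (z : Fin r → ℂ) :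
    hilbertF F r D.σ k k0 A t z = (Ideal.absNorm t : ℂ) ^ (k0 / 2) * D.fsum (fun j => (k0 - k j) / 2) A t z := by
  unfold hilbertF Dat.fsum
  rw [← tsum_mul_left]
  congr 1
  ext x
  unfold Dat.fterm Dat.coef
  simp only [mul_assoc]

end DatB2

section DatB3
variable {F : Type*} [Field F] [NumberField F] {r : ℕ} (D : Dat F r)

/-- product of powers of the fundamental units, in the field -/
def Dat.up (N : Fin (r - 1) → ℤ) : F := algebraMap (𝓞 F) F ((∏ l, D.ε l ^ N l : (𝓞 F)ˣ) : 𝓞 F)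

/-- logarithms of the fundamental units -/
def Dat.lam (l : Fin (r - 1)) (j : Fin r) : ℝ := Real.log (D.σ j (algebraMap (𝓞 F) F (D.ε l)))

theorem span_unit (v : (𝓞 F)ˣ) : spanSingleton (𝓞 F)⁰ (algebraMap (𝓞 F) F (v : 𝓞 F)) = 1 := by
  rw [← FractionalIdeal.coeIdeal_span_singleton, Ideal.span_singleton_eq_top.mpr v.isUnit]
  simp

theorem Dat.up_eq (N : Fin (r - 1) → ℤ) : D.up N = ∏ l, (algebraMap (𝓞 F) F (D.ε l : 𝓞 F)) ^ N l := by
  unfold Dat.up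
  let g : (𝓞 F)ˣ →* Fˣ := Units.map (algebraMap (𝓞 F) F : 𝓞 F →* F)
  have : algebraMap (𝓞 F) F ((∏ l, D.ε l ^ N l : (𝓞 F)ˣ) : 𝓞 F) = ((g (∏ l, D.ε l ^ N l) : Fˣ) : F) := rfl
  rw [this, map_prod]
  simp [g]

theorem Dat.up_pos (N : Fin (r - 1) → ℤ) (j : Fin r) : 0 < D.σ j (D.up N) := by
  rw [D.up_eq, map_prod]
  refine Finset.prod_pos fun l _ => ?_
  rw [map_zpow₀]
  exact zpow_pos (D.hεpos l j) _

theorem Dat.log_up (N : Fin (r - 1) → ℤ) (j : Fin r) :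
    Real.log (D.σ j (D.up N)) = ∑ l, (N l : ℝ) * D.lam l j := by
  rw [D.up_eq, map_prod, Real.log_prod]
  · refine Finset.sum_congr rfl fun l _ => ?_
    rw [map_zpow₀, Real.log_zpow]; rfl
  · intro l _
    rw [map_zpow₀]
    exact (zpow_pos (D.hεpos l j) _).ne'

theorem Dat.lam_sum (l : Fin (r - 1)) : ∑ j, D.lam l j = 0 := by
  unfold Dat.lam
  rw [← Real.log_prod (fun j _ => (D.hεpos l j).ne'), ← D.absNorm_span (D.hεpos l), span_unit]
  simp

/-- The narrow ideal class index set. -/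
abbrev Dat.Cl (J : FractionalIdeal (𝓞 F)⁰ F) : Type _ :=
  {a : Ideal (𝓞 F) // a ≠ 0 ∧ InNarrowClass F r D.σ J a}

/-- property of a good representative -/
def Dat.IsRep (J : FractionalIdeal (𝓞 F)⁰ F) (a : Ideal (𝓞 F)) (ξ : F) : Prop :=
  (∀ j, 0 < D.σ j ξ) ∧ (a : FractionalIdeal (𝓞 F)⁰ F) = spanSingleton (𝓞 F)⁰ ξ * J ∧
    ∃ (τ : ℝ) (u : Fin (r - 1) → ℝ), (∀ l, 0 ≤ u l ∧ u l ≤ 1) ∧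
      ∀ j, Real.log (D.σ j ξ) = τ / r + ∑ l, u l * D.lam l j

theorem Dat.up_span (N : Fin (r - 1) → ℤ) : spanSingleton (𝓞 F)⁰ (D.up N) = 1 := span_unit _

theorem Dat.exists_rep
    (hL : ∀ x : Fin r → ℝ, ∃ (τ : ℝ) (u : Fin (r - 1) → ℝ), ∀ j, x j = τ / r + ∑ l, u l * D.lam l j)
    (J : FractionalIdeal (𝓞 F)⁰ F) (a : D.Cl J) : ∃ ξ, D.IsRep J a.1 ξ := by
  obtain ⟨ξ, hξ, ha⟩ := a.2.2
  obtain ⟨τ, u, hu⟩ := hL (fun j => Real.log (D.σ j ξ))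
  refine ⟨ξ * D.up (fun l => -⌊u l⌋), fun j => ?_, ?_, τ, fun l => Int.fract (u l), fun l => ?_, fun j => ?_⟩
  · rw [map_mul]; exact mul_pos (hξ j) (D.up_pos _ _)
  · rw [← FractionalIdeal.spanSingleton_mul_spanSingleton, D.up_span, mul_one]; exact ha
  · exact ⟨Int.fract_nonneg _, (Int.fract_lt_one _).le⟩
  · rw [map_mul, Real.log_mul (hξ j).ne' (D.up_pos _ _).ne', D.log_up, hu j, add_assoc, ← Finset.sum_add_distrib]
    congr 1
    refine Finset.sum_congr rfl fun l _ => ?_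
    unfold Int.fract
    push_cast
    ring

theorem exists_unit_of_span_eq_one {y : F} (hy : spanSingleton (𝓞 F)⁰ y = 1) :
    ∃ v : (𝓞 F)ˣ, algebraMap (𝓞 F) F (v : 𝓞 F) = y := by
  have hy' : spanSingleton (𝓞 F)⁰ y⁻¹ = 1 := by
    rw [← FractionalIdeal.spanSingleton_inv, hy, inv_one]
  have h1 : y ∈ (1 : FractionalIdeal (𝓞 F)⁰ F) := hy ▸ FractionalIdeal.mem_spanSingleton_self _ y
  have h2 : y⁻¹ ∈ (1 : FractionalIdeal (𝓞 F)⁰ F) := hy' ▸ FractionalIdeal.mem_spanSingleton_self _ y⁻¹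
  have hy0 : y ≠ 0 := by
    rintro rfl; simp at hy
  rw [FractionalIdeal.mem_one_iff] at h1 h2
  obtain ⟨z, hz⟩ := h1
  obtain ⟨z', hz'⟩ := h2
  have h3 : z * z' = 1 := by
    apply FaithfulSMul.algebraMap_injective (𝓞 F) F
    rw [map_mul, hz, hz', map_one, mul_inv_cancel₀ hy0]
  exact ⟨⟨z, z', h3, by rw [mul_comm]; exact h3⟩, hz⟩

theorem Dat.reindex {J : FractionalIdeal (𝓞 F)⁰ F} (hJ : J ≠ 0) {I : FractionalIdeal (𝓞 F)⁰ F}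
    (hIJ : I = J⁻¹) (ρ : D.Cl J → F) (hρ : ∀ a, D.IsRep J a.1 (ρ a)) :
    ∃ e : D.Cl J × (Fin (r - 1) → ℤ) ≃ D.S I, ∀ p, (e p).1 = ρ p.1 * D.up p.2 := by
  have hsp : ∀ (a : D.Cl J) N, spanSingleton (𝓞 F)⁰ (ρ a * D.up N) * J = (a.1 : FractionalIdeal (𝓞 F)⁰ F) := by
    intro a N
    rw [← FractionalIdeal.spanSingleton_mul_spanSingleton, D.up_span, mul_one, (hρ a).2.1]
  have hmem : ∀ p : D.Cl J × (Fin (r - 1) → ℤ), ρ p.1 * D.up p.2 ∈ I ∧ ∀ j, 0 < D.σ j (ρ p.1 * D.up p.2) := by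
    rintro ⟨a, N⟩
    refine ⟨?_, fun j => ?_⟩
    · rw [← FractionalIdeal.spanSingleton_le_iff_mem, hIJ]
      calc spanSingleton (𝓞 F)⁰ (ρ a * D.up N) = spanSingleton (𝓞 F)⁰ (ρ a * D.up N) * J * J⁻¹ := by
            rw [mul_assoc, mul_inv_cancel₀ hJ, mul_one]
        _ = a.1 * J⁻¹ := by rw [hsp]
        _ ≤ 1 * J⁻¹ := by gcongr; exact FractionalIdeal.coeIdeal_le_one
        _ = J⁻¹ := one_mul _
    · rw [map_mul]; exact mul_pos ((hρ a).1 j) (D.up_pos _ _)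
  let f : D.Cl J × (Fin (r - 1) → ℤ) → D.S I := fun p => ⟨ρ p.1 * D.up p.2, hmem p⟩
  have hf : Function.Bijective f := by
    constructor
    · rintro ⟨a, N⟩ ⟨b, N'⟩ h
      have h1 : ρ a * D.up N = ρ b * D.up N' := congrArg Subtype.val h
      have hab : a = b := by
        apply Subtype.ext
        apply FractionalIdeal.coeIdeal_injective (K := F)
        change (a.1 : FractionalIdeal (𝓞 F)⁰ F) = (b.1 : FractionalIdeal (𝓞 F)⁰ F)
        rw [← hsp a N, ← hsp b N', h1]
      subst hab
      have h2 : D.up N = D.up N' := mul_left_cancel₀ (D.ne_zero (hρ a).1) h1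
      have h3 : (∏ l, D.ε l ^ N l : (𝓞 F)ˣ) = ∏ l, D.ε l ^ N' l :=
        Units.ext (FaithfulSMul.algebraMap_injective (𝓞 F) F h2)
      have h4 := (D.hεbasis (∏ l, D.ε l ^ N l) (D.up_pos N)).unique rfl h3
      rw [h4]
    · rintro ⟨x, hx, hpos⟩
      have hx1 : spanSingleton (𝓞 F)⁰ x * J ≤ 1 := by
        rw [← FractionalIdeal.spanSingleton_le_iff_mem] at hx
        calc _ ≤ I * J := by gcongr
          _ = 1 := by rw [hIJ, inv_mul_cancel₀ hJ]
      obtain ⟨a, ha⟩ := FractionalIdeal.le_one_iff_exists_coeIdeal.mp hx1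
      have hx0 := D.ne_zero hpos
      have ha0 : a ≠ 0 := by
        rintro rfl
        have := mul_ne_zero (span_ne hx0) hJ
        rw [← ha] at this
        simp at this
      let a' : D.Cl J := ⟨a, ha0, x, hpos, ha⟩
      have hρ0 := D.ne_zero (hρ a').1
      have h1 : spanSingleton (𝓞 F)⁰ (x / ρ a') = 1 := by
        have h2 : spanSingleton (𝓞 F)⁰ x = spanSingleton (𝓞 F)⁰ (ρ a') := by
          apply mul_right_cancel₀ hJ
          rw [← ha, ← (hρ a').2.1]
        rw [div_eq_mul_inv, ← FractionalIdeal.spanSingleton_mul_spanSingleton,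
          ← FractionalIdeal.spanSingleton_inv, h2, mul_inv_cancel₀ (span_ne hρ0)]
      obtain ⟨v, hv⟩ := exists_unit_of_span_eq_one h1
      have hvpos : ∀ j, 0 < D.σ j (algebraMap (𝓞 F) F (v : 𝓞 F)) := by
        intro j
        rw [hv, map_div₀]; exact div_pos (hpos j) ((hρ a').1 j)
      obtain ⟨N, hN, -⟩ := D.hεbasis v hvpos
      refine ⟨(a', N), Subtype.ext ?_⟩
      change ρ a' * D.up N = x
      unfold Dat.up
      rw [← hN, hv, mul_div_cancel₀ _ hρ0]
  exact ⟨Equiv.ofBijective f hf, fun p => rfl⟩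

theorem Dat.exists_L (ν : (Fin (r - 1) → ℤ) → Fin r → ℂ)
    (hνlog : ∀ m l, ∑ j, ν m j * (Real.log (D.σ j (algebraMap (𝓞 F) F (D.ε l))) : ℂ) =
      2 * Real.pi * Complex.I * (m l : ℂ)) :
    ∃ L : (ℝ × (Fin (r - 1) → ℝ)) ≃L[ℝ] (Fin r → ℝ), ∀ w j, L w j = w.1 / r + ∑ l, w.2 l * D.lam l j := by
  have hr1 := D.hr
  have hr0 : (r:ℝ) ≠ 0 := by
    have : 0 < r := by omega
    positivity
  let f : (ℝ × (Fin (r - 1) → ℝ)) →ₗ[ℝ] (Fin r → ℝ) :=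
    { toFun := fun w j => w.1 / r + ∑ l, w.2 l * D.lam l j
      map_add' := by
        intro x y; ext j
        simp only [Prod.fst_add, Prod.snd_add, Pi.add_apply, add_mul, Finset.sum_add_distrib, add_div]; ring
      map_smul' := by
        intro c x; ext j
        simp only [Prod.smul_fst, Prod.smul_snd, Pi.smul_apply, smul_eq_mul, RingHom.id_apply, mul_add, Finset.mul_sum]
        congr 1
        · ring
        · exact Finset.sum_congr rfl fun l _ => by ring }
  have hf : ∀ w j, f w j = w.1 / r + ∑ l, w.2 l * D.lam l j := fun w j => rfl
  have hinj : Function.Injective f := by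
    rw [← LinearMap.ker_eq_bot, LinearMap.ker_eq_bot']
    intro w hw
    have h1 : ∀ j, w.1 / r + ∑ l, w.2 l * D.lam l j = 0 := fun j => congrFun hw j
    have h2 : w.1 = 0 := by
      have : ∑ j, (w.1 / r + ∑ l, w.2 l * D.lam l j) = 0 := Finset.sum_eq_zero fun j _ => h1 j
      rw [Finset.sum_add_distrib, Finset.sum_comm] at this
      simp only [← Finset.mul_sum, D.lam_sum] at this
      simp at this
      rcases this with h | h
      · omega
      · exact h.resolve_right (by omega)
    have h3 : ∀ l, w.2 l = 0 := by
      intro l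
      have h4 : ∑ j, ν (Pi.single l 1) j * ((∑ l', w.2 l' * D.lam l' j : ℝ) : ℂ) = 0 := by
        refine Finset.sum_eq_zero fun j _ => ?_
        have := h1 j
        rw [h2, zero_div, zero_add] at this
        rw [this]; simp
      push_cast at h4
      simp only [Finset.mul_sum] at h4
      rw [Finset.sum_comm] at h4
      have h5 : ∀ l', ∑ j, ν (Pi.single l 1) j * ((w.2 l' : ℂ) * (D.lam l' j : ℂ)) =
          w.2 l' * (2 * Real.pi * Complex.I * ((Pi.single l 1 : Fin (r-1) → ℤ) l' : ℂ)) := by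
        intro l'
        rw [← hνlog, Finset.mul_sum]
        refine Finset.sum_congr rfl fun j _ => ?_
        unfold Dat.lam; ring
      simp only [h5] at h4
      rw [Finset.sum_eq_single l] at h4
      · simpa [Real.pi_ne_zero] using h4
      · intro l' _ hl'
        simp [Pi.single_eq_of_ne hl']
      · simp
    exact Prod.ext h2 (funext h3)
  have hdim : Module.finrank ℝ (ℝ × (Fin (r - 1) → ℝ)) = Module.finrank ℝ (Fin r → ℝ) := by
    simp; omega
  exact ⟨(LinearEquiv.ofInjectiveOfFinrankEq f hinj hdim).toContinuousLinearEquiv, fun w j => rfl⟩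

end DatB3

section DatB4
variable {F : Type*} [Field F] [NumberField F] {r : ℕ} (D : Dat F r)

theorem Dat.norm_rep {J : FractionalIdeal (𝓞 F)⁰ F} {a : Ideal (𝓞 F)} {ξ : F} (h : D.IsRep J a ξ) :
    (Ideal.absNorm a : ℝ) = (∏ j, D.σ j ξ) * ((absNorm J : ℚ) : ℝ) := by
  rw [← D.absNorm_span h.1, ← Rat.cast_mul, ← map_mul, ← h.2.1, FractionalIdeal.coeIdeal_absNorm]
  simp

theorem absNorm_pos_real {J : FractionalIdeal (𝓞 F)⁰ F} (hJ : J ≠ 0) : 0 < ((absNorm J : ℚ) : ℝ) := by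
  have : absNorm J ≠ 0 := by
    rwa [Ne, FractionalIdeal.absNorm_eq_zero_iff]
  exact_mod_cast lt_of_le_of_ne (FractionalIdeal.absNorm_nonneg J) (Ne.symm this)

theorem one_le_absNorm {a : Ideal (𝓞 F)} (ha : a ≠ 0) : (1:ℝ) ≤ (Ideal.absNorm a : ℝ) := by
  exact_mod_cast Nat.one_le_iff_ne_zero.mpr (by rwa [Ne, Ideal.absNorm_eq_zero_iff])

theorem Dat.T_rep_le {J : FractionalIdeal (𝓞 F)⁰ F} (hJ : J ≠ 0) :
    ∃ C : ℝ, 0 < C ∧ ∀ (a : Ideal (𝓞 F)) (ξ : F), a ≠ 0 → D.IsRep J a ξ → D.T ξ ≤ C * (Ideal.absNorm a : ℝ) := by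
  have hr1 := D.hr
  have hr0 : (r:ℝ) ≠ 0 := by
    have : 0 < r := by omega
    positivity
  have hJ1 := absNorm_pos_real hJ
  set B : ℝ := ∑ j, ∑ l, |D.lam l j| with hB
  set K : ℝ := r * Real.exp B with hK
  have hKpos : 0 < K := by positivity
  refine ⟨1 + K ^ r * ((absNorm J : ℚ) : ℝ)⁻¹, by positivity, fun a ξ ha h => ?_⟩
  have hN := D.norm_rep h
  have h1 := one_le_absNorm ha
  obtain ⟨hpos, hspan, τ, u, hu, hlog⟩ := h
  have hT := D.T_pos hpos
  have hτ : ∏ j, D.σ j ξ = Real.exp τ := by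
    have : ∑ j, Real.log (D.σ j ξ) = τ := by
      simp only [hlog, Finset.sum_add_distrib]
      rw [Finset.sum_comm]
      simp only [← Finset.mul_sum, D.lam_sum]
      simp
      field_simp
    rw [← this, Real.exp_sum]
    exact Finset.prod_congr rfl fun j _ => (Real.exp_log (hpos j)).symm
  have hle : ∀ j, D.σ j ξ ≤ Real.exp (τ / r) * Real.exp B := by
    intro j
    rw [← Real.exp_log (hpos j), ← Real.exp_add, hlog j]
    gcongr
    calc ∑ l, u l * D.lam l j ≤ ∑ l, |D.lam l j| := by
          refine Finset.sum_le_sum fun l _ => ?_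
          calc u l * D.lam l j ≤ |u l * D.lam l j| := le_abs_self _
            _ = u l * |D.lam l j| := by rw [abs_mul, abs_of_nonneg (hu l).1]
            _ ≤ 1 * |D.lam l j| := by gcongr; exact (hu l).2
            _ = _ := one_mul _
      _ ≤ B := Finset.single_le_sum (f := fun j => ∑ l, |D.lam l j|)
          (fun j _ => Finset.sum_nonneg fun l _ => abs_nonneg _) (Finset.mem_univ j)
  have hTle : D.T ξ ≤ K * Real.exp (τ / r) := by
    calc D.T ξ ≤ ∑ j : Fin r, Real.exp (τ / r) * Real.exp B := Finset.sum_le_sum fun j _ => hle j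
      _ = _ := by simp [hK]; ring
  have hTr : D.T ξ ^ r ≤ K ^ r * (Ideal.absNorm a * ((absNorm J : ℚ) : ℝ)⁻¹) := by
    calc D.T ξ ^ r ≤ (K * Real.exp (τ / r)) ^ r := by gcongr
      _ = K ^ r * Real.exp τ := by
          rw [mul_pow, ← Real.exp_nat_mul]; congr 2; field_simp
      _ = _ := by rw [hN, hτ, mul_assoc, mul_inv_cancel₀ hJ1.ne', mul_one]
  have h2 : D.T ξ ≤ 1 + D.T ξ ^ r := by
    rcases le_total (D.T ξ) 1 with h | h
    · have : 0 ≤ D.T ξ ^ r := by positivity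
      linarith
    · have : D.T ξ ≤ D.T ξ ^ r := le_self_pow₀ h (by omega)
      linarith
  calc D.T ξ ≤ 1 + D.T ξ ^ r := h2
    _ ≤ (Ideal.absNorm a : ℝ) + K ^ r * (Ideal.absNorm a * ((absNorm J : ℚ) : ℝ)⁻¹) := by gcongr
    _ = _ := by ring

theorem Dat.cl_summable {J : FractionalIdeal (𝓞 F)⁰ F} (hJ : J ≠ 0)
    (ρ : D.Cl J → F) (hρ : ∀ a, D.IsRep J a.1 (ρ a)) :
    ∃ p : ℕ, Summable fun a : D.Cl J => (Ideal.absNorm a.1 : ℝ)⁻¹ ^ p := by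
  obtain ⟨e, he⟩ := D.reindex hJ (I := J⁻¹) rfl ρ hρ
  obtain ⟨p, hp⟩ := D.exists_summable J⁻¹ (inv_ne_zero hJ)
  obtain ⟨C, hC, hT⟩ := D.T_rep_le hJ
  refine ⟨p, ?_⟩
  have hinj : Function.Injective (fun a : D.Cl J => e (a, 0)) := by
    intro a b h
    simpa using h
  have hs := (hp.comp_injective hinj).mul_left (C ^ p)
  refine Summable.of_nonneg_of_le (fun a => by positivity) (fun a => ?_) hs
  have h0 : (e (a, 0)).1 = ρ a := by
    rw [he]; simp [Dat.up]
  simp only [Function.comp]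
  rw [h0, ← mul_pow]
  have h1 := one_le_absNorm a.2.1
  have h2 := hT a.1 (ρ a) a.2.1 (hρ a)
  have h3 := D.T_pos (hρ a).1
  gcongr
  rw [← div_eq_mul_inv, le_div_iff₀ h3, inv_mul_le_iff₀ (by positivity), mul_comm]
  exact h2

theorem Dat.dirichlet_summable {J : FractionalIdeal (𝓞 F)⁰ F} (hJ : J ≠ 0)
    (ρ : D.Cl J → F) (hρ : ∀ a, D.IsRep J a.1 (ρ a))
    {A : Ideal (𝓞 F) → ℂ} {c : ℕ} {M : ℝ} (hA : PolyGrowth A c M) :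
    ∃ x0 : ℝ, ∀ x, x0 ≤ x → Summable fun a : D.Cl J => ‖A a.1‖ * (Ideal.absNorm a.1 : ℝ) ^ (-x) := by
  obtain ⟨p, hp⟩ := D.cl_summable hJ ρ hρ
  refine ⟨p + c, fun x hx => ?_⟩
  refine Summable.of_nonneg_of_le (fun a => by positivity) (fun a => ?_) (hp.mul_left M)
  have h1 := one_le_absNorm a.2.1
  have hM := hA.1
  calc ‖A a.1‖ * (Ideal.absNorm a.1 : ℝ) ^ (-x) ≤ (M * (Ideal.absNorm a.1 : ℝ) ^ c) * (Ideal.absNorm a.1 : ℝ) ^ (-((p:ℝ) + c)) := by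
        gcongr
        · exact hA.2 _ a.2.1
    _ = M * ((Ideal.absNorm a.1 : ℝ) ^ (c:ℝ) * (Ideal.absNorm a.1 : ℝ) ^ (-((p:ℝ) + c))) := by
        rw [Real.rpow_natCast]; ring
    _ = M * (Ideal.absNorm a.1 : ℝ)⁻¹ ^ p := by
        rw [← Real.rpow_add (by positivity), show (c:ℝ) + -((p:ℝ) + c) = -(p:ℝ) by ring, Real.rpow_neg (by positivity),
          Real.rpow_natCast, inv_pow]

theorem psi_norm (D : Dat F r) (ψ : FractionalIdeal (𝓞 F)⁰ F → ℂ) (ν : Fin r → ℂ) (hν : ∀ j, (ν j).re = 0)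
    (hψmul : ∀ (I J : FractionalIdeal (𝓞 F)⁰ F), I ≠ 0 → J ≠ 0 → ψ (I * J) = ψ I * ψ J)
    (hψne : ∀ (I : FractionalIdeal (𝓞 F)⁰ F), I ≠ 0 → ψ I ≠ 0)
    (hψpos : ∀ (ξ : F), (∀ j, 0 < D.σ j ξ) →
      ψ (spanSingleton (𝓞 F)⁰ ξ) = ∏ j, ((D.σ j ξ : ℝ) : ℂ) ^ (-(ν j)))
    (I : FractionalIdeal (𝓞 F)⁰ F) (hI : I ≠ 0) : ‖ψ I‖ = 1 := by
  have hone : ψ 1 = 1 := by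
    have h := hψmul 1 1 one_ne_zero one_ne_zero
    rw [mul_one] at h
    exact (mul_eq_left₀ (hψne 1 one_ne_zero)).mp h.symm
  have hpow : ∀ n : ℕ, ψ (I ^ n) = ψ I ^ n := by
    intro n
    induction n with
    | zero => simpa using hone
    | succ n ih => rw [pow_succ, hψmul _ _ (pow_ne_zero _ hI) hI, ih, pow_succ]
  let U : (FractionalIdeal (𝓞 F)⁰ F)ˣ := Units.mk0 I hI
  have hcard : (ClassGroup.mk F U) ^ (Fintype.card (ClassGroup (𝓞 F))) = 1 := pow_card_eq_one
  set h := Fintype.card (ClassGroup (𝓞 F)) with hh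
  have hpos : 0 < h := Fintype.card_pos
  rw [← map_pow, ClassGroup.mk_eq_one_iff] at hcard
  have hc2 : ((U ^ h : (FractionalIdeal (𝓞 F)⁰ F)ˣ) : FractionalIdeal (𝓞 F)⁰ F) = I ^ h := by
    simp [U]
  rw [hc2] at hcard
  obtain ⟨α, hα⟩ := hcard.principal
  have hα2 : I ^ h = spanSingleton (𝓞 F)⁰ α := by
    apply FractionalIdeal.coeToSubmodule_injective
    beta_reduce
    rw [FractionalIdeal.coe_spanSingleton]
    exact hα
  have hα0 : α ≠ 0 := by
    rintro rfl
    have := pow_ne_zero h hI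
    rw [hα2] at this
    simp at this
  have hsq : ∀ j, 0 < D.σ j (α ^ 2) := by
    intro j
    rw [map_pow]
    have : D.σ j α ≠ 0 := by simpa using hα0
    positivity
  have h2 : ψ I ^ (h * 2) = ∏ j, ((D.σ j (α ^ 2) : ℝ) : ℂ) ^ (-(ν j)) := by
    rw [← hψpos _ hsq, ← hpow, pow_mul, hα2, FractionalIdeal.spanSingleton_pow]
  have h3 : ‖ψ I‖ ^ (h * 2) = 1 := by
    rw [← norm_pow, h2, norm_prod]
    refine Finset.prod_eq_one fun j _ => ?_
    rw [Complex.norm_cpow_eq_rpow_re_of_pos (hsq j)]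
    simp [hν j]
  exact (pow_eq_one_iff_of_nonneg (norm_nonneg _) (by omega)).mp h3

end DatB4

section DatB5
variable {F : Type*} [Field F] [NumberField F] {r : ℕ} (D : Dat F r)

/-- logarithmic embedding -/
def Dat.lg (x : F) : Fin r → ℝ := fun j => Real.log (D.σ j x)

/-- The compatibility of the coordinates. -/
def Dat.IsL (L : (ℝ × (Fin (r - 1) → ℝ)) ≃L[ℝ] (Fin r → ℝ)) : Prop :=
  ∀ w j, L w j = w.1 / r + ∑ l, w.2 l * D.lam l j

/-- The defining property of `ν_m`. -/
structure Dat.IsNu (m : Fin (r - 1) → ℤ) (ν : Fin r → ℂ) : Prop where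
  im : ∀ j, (ν j).re = 0
  sum : ∑ j, ν j = 0
  log : ∀ l, ∑ j, ν j * (D.lam l j : ℂ) = 2 * π * I * (m l : ℂ)

variable {D}

theorem Dat.IsL.sum {L : (ℝ × (Fin (r - 1) → ℝ)) ≃L[ℝ] (Fin r → ℝ)} (hL : D.IsL L)
    (w : ℝ × (Fin (r - 1) → ℝ)) : ∑ j, L w j = w.1 := by
  have hr1 := D.hr
  have hr0 : (r:ℝ) ≠ 0 := by
    have : 0 < r := by omega
    positivity
  simp only [hL w, Finset.sum_add_distrib]
  rw [Finset.sum_comm]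
  simp only [← Finset.mul_sum, D.lam_sum]
  simp
  field_simp

theorem Dat.IsL.chi {L : (ℝ × (Fin (r - 1) → ℝ)) ≃L[ℝ] (Fin r → ℝ)} (hL : D.IsL L)
    {m : Fin (r - 1) → ℤ} {ν : Fin r → ℂ} (hν : D.IsNu m ν) (s : ℂ) (w : ℝ × (Fin (r - 1) → ℝ)) :
    cexp (s * w.1) * echar m w.2 = cexp (∑ j, (s + ν j) * (L w j : ℂ)) := by
  unfold echar
  rw [← Complex.exp_add]
  congr 1
  simp only [add_mul, Finset.sum_add_distrib, ← Finset.mul_sum]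
  congr 1
  · rw [← hL.sum w]; push_cast; rfl
  · simp only [hL w]
    push_cast
    simp only [mul_add, Finset.sum_add_distrib, ← Finset.sum_mul, hν.sum, zero_mul, zero_add, Finset.mul_sum]
    rw [Finset.sum_comm]
    refine Finset.sum_congr rfl fun l _ => ?_
    have := hν.log l
    calc 2 * π * I * ((m l : ℂ) * (w.2 l : ℂ)) = (w.2 l : ℂ) * (2 * π * I * (m l : ℂ)) := by ring
      _ = (w.2 l : ℂ) * ∑ j, ν j * (D.lam l j : ℂ) := by rw [this]
      _ = _ := by rw [Finset.mul_sum]; exact Finset.sum_congr rfl fun j _ => by ring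

theorem Dat.IsL.zvec {L : (ℝ × (Fin (r - 1) → ℝ)) ≃L[ℝ] (Fin r → ℝ)} (hL : D.IsL L) (N : Fin (r - 1) → ℤ) :
    L (zvec N) = D.lg (D.up N) := by
  ext j
  rw [hL]
  unfold Dat.lg
  rw [D.log_up]
  simp [_root_.zvec]

variable (D)

/-- The theta-like function on logarithmic space. -/
def Dat.G (κ : Fin r → ℕ) (A : Ideal (𝓞 F) → ℂ) (t : Ideal (𝓞 F)) (x : Fin r → ℝ) : ℂ :=
  cexp (-∑ j, (κ j : ℂ) * x j) * D.fsum κ A t (fun j => I * (Real.exp (x j) : ℝ))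

theorem Dat.G_continuous {A : Ideal (𝓞 F) → ℂ} {c : ℕ} {M : ℝ} (hA : PolyGrowth A c M)
    (κ : Fin r → ℕ) {t : Ideal (𝓞 F)} (ht : t ≠ 0) : Continuous (D.G κ A t) := by
  unfold Dat.G
  refine Continuous.mul (by fun_prop) ?_
  rw [continuous_iff_continuousAt]
  intro x
  have h1 := D.fsum_continuousAt hA κ ht (fun j => I * (Real.exp (x j) : ℝ)) (fun j => by
    simp [-ofReal_exp]; exact Real.exp_pos _)
  have h2 : Continuous (fun x : Fin r → ℝ => (fun j => I * (Real.exp (x j) : ℝ) : Fin r → ℂ)) := by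
    fun_prop
  exact ContinuousAt.comp (f := fun x : Fin r → ℝ => (fun j => I * (Real.exp (x j) : ℝ) : Fin r → ℂ)) h1 h2.continuousAt

theorem Dat.fterm_eq (κ : Fin r → ℕ) (A : Ideal (𝓞 F) → ℂ) (t : Ideal (𝓞 F)) (ξ : F) (hξ : ∀ j, 0 < D.σ j ξ)
    (x : Fin r → ℝ) :
    cexp (-∑ j, (κ j : ℂ) * x j) * D.fterm κ A t ξ (fun j => I * (Real.exp (x j) : ℝ)) =
      Aext F A (spanSingleton (𝓞 F)⁰ ξ * (((t : FractionalIdeal (𝓞 F)⁰ F))⁻¹ * dd F)) * aphi κ (x + D.lg ξ) := by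
  unfold Dat.fterm Dat.coef aphi
  rw [mul_assoc (spanSingleton _ _)]
  have h1 : 2 * π * I * ∑ j, ((D.σ j ξ : ℝ) : ℂ) * (I * (Real.exp (x j) : ℝ)) =
      ∑ j, (-(2 * π * Real.exp ((x + D.lg ξ) j) : ℝ) : ℂ) := by
    rw [Finset.mul_sum]
    refine Finset.sum_congr rfl fun j _ => ?_
    have : Real.exp ((x + D.lg ξ) j) = Real.exp (x j) * D.σ j ξ := by
      simp only [Pi.add_apply, Dat.lg]
      rw [Real.exp_add, Real.exp_log (hξ j)]
    rw [this]
    push_cast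
    linear_combination (2 * π * (D.σ j ξ : ℂ) * cexp (x j)) * Complex.I_sq
  rw [h1, Complex.exp_sum, ← Finset.sum_neg_distrib, Complex.exp_sum, Finset.prod_mul_distrib]
  have h2 : ∀ j, cexp (-(κ j : ℂ) * ((x + D.lg ξ) j : ℝ)) = cexp (-((κ j : ℂ) * x j)) * ((D.σ j ξ : ℝ) : ℂ) ^ (-(κ j : ℤ)) := by
    intro j
    have h3 : ((D.σ j ξ : ℝ) : ℂ) = cexp (D.lg ξ j) := by
      rw [← Complex.ofReal_exp]; unfold Dat.lg; rw [Real.exp_log (hξ j)]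
    rw [h3, ← Complex.exp_int_mul, ← Complex.exp_add]
    congr 1
    simp only [Pi.add_apply]
    push_cast; ring
  simp only [h2, Finset.prod_mul_distrib]
  ring

theorem Dat.G_hasSum {A : Ideal (𝓞 F) → ℂ} {c : ℕ} {M : ℝ} (hA : PolyGrowth A c M)
    (κ : Fin r → ℕ) {t : Ideal (𝓞 F)} (ht : t ≠ 0)
    (ρ : D.Cl (((t : FractionalIdeal (𝓞 F)⁰ F))⁻¹ * dd F) → F) (hρ : ∀ a, D.IsRep (((t : FractionalIdeal (𝓞 F)⁰ F))⁻¹ * dd F) a.1 (ρ a))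
    {L : (ℝ × (Fin (r - 1) → ℝ)) ≃L[ℝ] (Fin r → ℝ)} (hL : D.IsL L) (x : Fin r → ℝ) :
    HasSum (fun p : D.Cl (((t : FractionalIdeal (𝓞 F)⁰ F))⁻¹ * dd F) × (Fin (r - 1) → ℤ) =>
      A p.1.1 * aphi κ (x + D.lg (ρ p.1) + L (zvec p.2))) (D.G κ A t x) := by
  have ht' : (t : FractionalIdeal (𝓞 F)⁰ F) ≠ 0 := by rwa [Ne, FractionalIdeal.coeIdeal_eq_zero]
  have hJ : ((t : FractionalIdeal (𝓞 F)⁰ F))⁻¹ * dd F ≠ 0 := mul_ne_zero (inv_ne_zero ht') dd_ne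
  obtain ⟨e, he⟩ := D.reindex hJ (I := (t : FractionalIdeal (𝓞 F)⁰ F) * (dd F)⁻¹)
    (by rw [mul_inv, inv_inv]) ρ hρ
  have hs := (D.fterm_summable hA κ ht (fun j => I * (Real.exp (x j) : ℝ)) (fun j => by
    simp [-ofReal_exp]; exact Real.exp_pos _)).hasSum
  have hs2 := hs.mul_left (cexp (-∑ j, (κ j : ℂ) * x j))
  rw [← e.hasSum_iff] at hs2
  have hG : D.G κ A t x = cexp (-∑ j, (κ j : ℂ) * x j) * ∑' b : D.St t, D.fterm κ A t b.1 (fun j => I * (Real.exp (x j) : ℝ)) := rfl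
  rw [hG]
  refine Eq.mp (congrArg (fun f => HasSum f _) (funext fun p => ?_)) hs2
  symm
  simp only [Function.comp]
  rw [D.fterm_eq κ A t _ (e p).2.2, he]
  congr 1
  · rw [← FractionalIdeal.spanSingleton_mul_spanSingleton, D.up_span, mul_one, ← (hρ p.1).2.1, Aext_coe]
  · rw [hL.zvec, add_assoc]
    congr 2
    ext j
    simp only [Pi.add_apply, Dat.lg]
    rw [map_mul, Real.log_mul ((hρ p.1).1 j).ne' (D.up_pos _ _).ne']

/-- Dirichlet series attached to representatives. -/
def Dat.dser (J : FractionalIdeal (𝓞 F)⁰ F) (ρ : D.Cl J → F) (A : Ideal (𝓞 F) → ℂ) (ν : Fin r → ℂ) (s : ℂ) : ℂ :=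
  ∑' a : D.Cl J, A a.1 * cexp (-∑ j, (s + ν j) * (D.lg (ρ a) j : ℂ))

/-- Gamma factor. -/
def gam {r : ℕ} (κ : Fin r → ℕ) (ν : Fin r → ℂ) (s : ℂ) : ℂ :=
  ∏ j, (cexp (-(s - κ j + ν j) * Real.log (2 * π)) * Complex.Gamma (s - κ j + ν j))

theorem Dat.cl_countable {J : FractionalIdeal (𝓞 F)⁰ F} (hJ : J ≠ 0)
    (ρ : D.Cl J → F) (hρ : ∀ a, D.IsRep J a.1 (ρ a)) : Countable (D.Cl J) := by
  obtain ⟨p, hp⟩ := D.cl_summable hJ ρ hρ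
  have h := hp.countable_support
  have h2 : Function.support (fun a : D.Cl J => (Ideal.absNorm a.1 : ℝ)⁻¹ ^ p) = Set.univ := by
    ext a
    have := one_le_absNorm a.2.1
    simp only [Function.mem_support, Set.mem_univ, iff_true]
    positivity
  rw [h2] at h
  exact Set.countable_univ_iff.mp h

theorem Dat.sum_lg {J : FractionalIdeal (𝓞 F)⁰ F} (hJ : J ≠ 0) {a : Ideal (𝓞 F)} {ξ : F} (h : D.IsRep J a ξ) :
    ∑ j, D.lg ξ j = Real.log (Ideal.absNorm a : ℝ) - Real.log ((absNorm J : ℚ) : ℝ) := by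
  have hN := D.norm_rep h
  have hJ1 := absNorm_pos_real hJ
  have hp : 0 < ∏ j, D.σ j ξ := Finset.prod_pos fun j _ => h.1 j
  unfold Dat.lg
  rw [← Real.log_prod (fun j _ => (h.1 j).ne'), hN, Real.log_mul hp.ne' hJ1.ne']
  ring

/-- summability in the form required for unfolding -/
theorem Dat.dser_summable {J : FractionalIdeal (𝓞 F)⁰ F} (hJ : J ≠ 0)
    (ρ : D.Cl J → F) (hρ : ∀ a, D.IsRep J a.1 (ρ a))
    {A : Ideal (𝓞 F) → ℂ} {c : ℕ} {M : ℝ} (hA : PolyGrowth A c M) :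
    ∃ x0 : ℝ, ∀ x, x0 ≤ x → Summable fun a : D.Cl J => ‖A a.1‖ * Real.exp (-x * ∑ j, D.lg (ρ a) j) := by
  obtain ⟨x0, h⟩ := D.dirichlet_summable hJ ρ hρ hA
  refine ⟨x0, fun x hx => ?_⟩
  refine ((h x hx).mul_left (Real.exp (x * Real.log ((absNorm J : ℚ) : ℝ)))).congr fun a => ?_
  rw [D.sum_lg hJ (hρ a)]
  have h1 := one_le_absNorm a.2.1
  rw [Real.rpow_def_of_pos (by linarith), mul_left_comm, ← Real.exp_add]
  congr 2
  ring

theorem dser_term_norm {ν : Fin r → ℂ} (hν : ∀ j, (ν j).re = 0) (s : ℂ) (x : Fin r → ℝ) :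
    ‖cexp (-∑ j, (s + ν j) * (x j : ℂ))‖ = Real.exp (-s.re * ∑ j, x j) := by
  rw [Complex.norm_exp]
  congr 1
  rw [Complex.neg_re, Complex.re_sum, neg_mul, Finset.mul_sum]
  congr 1
  refine Finset.sum_congr rfl fun j _ => ?_
  simp [hν j]

theorem Dat.E_bound {J : FractionalIdeal (𝓞 F)⁰ F} (ρ : D.Cl J → F) {A : Ideal (𝓞 F) → ℂ}
    (κ : Fin r → ℕ) {ν : Fin r → ℂ} (hν : ∀ j, (ν j).re = 0) {x : ℝ} (hx : ∀ j, (κ j : ℝ) + 1 ≤ x)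
    (hs : Summable fun a : D.Cl J => ‖A a.1‖ * Real.exp (-x * ∑ j, D.lg (ρ a) j)) :
    ∃ K : ℝ, 0 ≤ K ∧ ∀ s : ℂ, s.re = x → ‖D.dser J ρ A ν s * gam κ ν s‖ * (1 + s.im ^ 2) ≤ K := by
  have hr0 : 0 < r := by have := D.hr; omega
  obtain ⟨K, hK, hg⟩ := gamma_prod_decay ⟨0, hr0⟩ κ ν hν hx
  set B := ∑' a : D.Cl J, ‖A a.1‖ * Real.exp (-x * ∑ j, D.lg (ρ a) j) with hB
  have hB0 : 0 ≤ B := tsum_nonneg fun a => by positivity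
  set R := ∏ j, Real.exp (-(x - κ j) * Real.log (2 * π)) with hR
  have hR0 : 0 ≤ R := by positivity
  refine ⟨B * (R * K), by positivity, fun s hsx => ?_⟩
  have h1 : ‖D.dser J ρ A ν s‖ ≤ B := by
    refine tsum_of_norm_bounded hs.hasSum fun a => ?_
    rw [norm_mul, dser_term_norm hν, hsx]
  have h2 : ‖gam κ ν s‖ = R * ‖∏ j, Complex.Gamma (s - (κ j : ℂ) + ν j)‖ := by
    unfold gam
    rw [Finset.prod_mul_distrib, norm_mul, norm_prod]
    congr 1
    refine Finset.prod_congr rfl fun j _ => ?_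
    rw [Complex.norm_exp, Complex.re_mul_ofReal]
    simp [hν j, hsx]
  rw [norm_mul, h2]
  calc _ = ‖D.dser J ρ A ν s‖ * (R * (‖∏ j, Complex.Gamma (s - (κ j : ℂ) + ν j)‖ * (1 + s.im ^ 2))) := by ring
    _ ≤ _ := by
      gcongr
      exact hg s hsx

end DatB5

section DatB6
variable {F : Type*} [Field F] [NumberField F] {r : ℕ} (D : Dat F r)

/-- the transfer constant property -/
def IsHaarConst {n r : ℕ} (L : (ℝ × (Fin n → ℝ)) ≃L[ℝ] (Fin r → ℝ)) (K : ℂ) : Prop :=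
  ∀ g : (Fin r → ℝ) → ℂ, (Integrable g → Integrable (fun w => g (L w))) ∧ ∫ w, g (L w) = K * ∫ x, g x

theorem echar_neg_neg {n : ℕ} (m : Fin n → ℤ) (u : Fin n → ℝ) : echar (-m) (-u) = echar m u := by
  unfold echar
  simp

theorem echar_neg {n : ℕ} (m : Fin n → ℤ) (u : Fin n → ℝ) : echar (-m) u = echar m (-u) := by
  unfold echar
  simp

theorem Dat.IsL.symm_lg {L : (ℝ × (Fin (r - 1) → ℝ)) ≃L[ℝ] (Fin r → ℝ)} {D : Dat F r} (hL : D.IsL L) (x : Fin r → ℝ) :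
    (L.symm x).1 = ∑ j, x j := by
  rw [← hL.sum (L.symm x), L.apply_symm_apply]

theorem Dat.IsL.chi_symm {L : (ℝ × (Fin (r - 1) → ℝ)) ≃L[ℝ] (Fin r → ℝ)} {D : Dat F r} (hL : D.IsL L)
    {m : Fin (r - 1) → ℤ} {ν : Fin r → ℂ} (hν : D.IsNu m ν) (s : ℂ) (x : Fin r → ℝ) :
    cexp (s * (L.symm x).1) * echar m (L.symm x).2 = cexp (∑ j, (s + ν j) * (x j : ℂ)) := by
  rw [hL.chi hν, L.apply_symm_apply]

theorem Dat.IsL.chi_symm_neg {L : (ℝ × (Fin (r - 1) → ℝ)) ≃L[ℝ] (Fin r → ℝ)} {D : Dat F r} (hL : D.IsL L)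
    {m : Fin (r - 1) → ℤ} {ν : Fin r → ℂ} (hν : D.IsNu m ν) (s : ℂ) (x : Fin r → ℝ) :
    cexp (-s * (L.symm x).1) * echar m (-(L.symm x).2) = cexp (-∑ j, (s + ν j) * (x j : ℂ)) := by
  have := hL.chi_symm hν s (-x)
  rw [map_neg] at this
  simp only [Prod.fst_neg, Prod.snd_neg, Pi.neg_apply, ofReal_neg, mul_neg, Finset.sum_neg_distrib] at this
  rw [neg_mul]
  exact this

theorem Dat.phi_int {L : (ℝ × (Fin (r - 1) → ℝ)) ≃L[ℝ] (Fin r → ℝ)} (hL : D.IsL L)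
    {K : ℂ} (hK : IsHaarConst L K) (κ : Fin r → ℕ) {m : Fin (r - 1) → ℤ} {ν : Fin r → ℂ} (hν : D.IsNu m ν) {s : ℂ}
    (hs : ∀ j, (κ j : ℝ) < s.re) :
    Integrable (fun w : ℝ × (Fin (r - 1) → ℝ) => aphi κ (L w) * (cexp (s * w.1) * echar m w.2)) ∧
    ∫ w : ℝ × (Fin (r - 1) → ℝ), aphi κ (L w) * (cexp (s * w.1) * echar m w.2) = K * gam κ ν s := by
  obtain ⟨h1, h2⟩ := aphi_integral κ ν hν.im hs
  obtain ⟨h3, h4⟩ := hK (fun x => aphi κ x * cexp (∑ j, (s + ν j) * x j))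
  simp only [hL.chi hν]
  refine ⟨h3 h1, ?_⟩
  rw [h4, h2]; rfl

theorem Dat.trans1 {A : Ideal (𝓞 F) → ℂ} {c : ℕ} {M : ℝ} (hA : PolyGrowth A c M)
    (κ : Fin r → ℕ) {t : Ideal (𝓞 F)} (ht : t ≠ 0)
    (ρ : D.Cl (((t : FractionalIdeal (𝓞 F)⁰ F))⁻¹ * dd F) → F)
    (hρ : ∀ a, D.IsRep (((t : FractionalIdeal (𝓞 F)⁰ F))⁻¹ * dd F) a.1 (ρ a))
    {L : (ℝ × (Fin (r - 1) → ℝ)) ≃L[ℝ] (Fin r → ℝ)} (hL : D.IsL L)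
    {K : ℂ} (hK : IsHaarConst L K) {m : Fin (r - 1) → ℤ} {ν : Fin r → ℂ} (hν : D.IsNu m ν) {s : ℂ}
    (hs : ∀ j, (κ j : ℝ) < s.re)
    (hsum : Summable fun a => ‖A a.1‖ * Real.exp (-s.re * ∑ j, D.lg (ρ a) j)) :
    Integrable (fun τ : ℝ => ucoef (fun w => D.G κ A t (L w)) m τ * cexp (s * τ)) ∧
    ∫ τ : ℝ, ucoef (fun w => D.G κ A t (L w)) m τ * cexp (s * τ) = K * (D.dser _ ρ A ν s * gam κ ν s) := by
  have ht' : (t : FractionalIdeal (𝓞 F)⁰ F) ≠ 0 := by rwa [Ne, FractionalIdeal.coeIdeal_eq_zero]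
  have hJ : ((t : FractionalIdeal (𝓞 F)⁰ F))⁻¹ * dd F ≠ 0 := mul_ne_zero (inv_ne_zero ht') dd_ne
  have := D.cl_countable hJ ρ hρ
  obtain ⟨h1, h2⟩ := D.phi_int hL hK κ hν hs
  have hmain := unfold_laplace (α := fun a => A a.1) (b := fun a => L.symm (D.lg (ρ a)))
    (φ := fun w => aphi κ (L w)) (G := fun w => D.G κ A t (L w))
    ((D.G_continuous hA κ ht).comp L.continuous) m s h1
    (by simpa only [hL.symm_lg] using hsum)
    (fun w => by
      have := D.G_hasSum hA κ ht ρ hρ hL (L w)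
      simpa only [map_add, L.apply_symm_apply] using this)
  refine ⟨hmain.1, ?_⟩
  rw [hmain.2, h2]
  unfold Dat.dser
  simp only [hL.chi_symm_neg hν]
  ring

/-- The function compared with `G` for the dual ideal. -/
def Dat.Hf (κ : Fin r → ℕ) (k0 : ℕ) (A : Ideal (𝓞 F) → ℂ) (t : Ideal (𝓞 F)) (C : ℂ) (lq : Fin r → ℝ) (x : Fin r → ℝ) : ℂ :=
  C * cexp (-(k0 : ℂ) * ∑ j, (x j : ℂ)) * D.G κ A t (-lq - x)

theorem Dat.Hf_continuous {A : Ideal (𝓞 F) → ℂ} {c : ℕ} {M : ℝ} (hA : PolyGrowth A c M)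
    (κ : Fin r → ℕ) (k0 : ℕ) {t : Ideal (𝓞 F)} (ht : t ≠ 0) (C : ℂ) (lq : Fin r → ℝ) :
    Continuous (D.Hf κ k0 A t C lq) := by
  unfold Dat.Hf
  refine Continuous.mul (by fun_prop) ((D.G_continuous hA κ ht).comp (by fun_prop))

theorem Dat.trans2 {A : Ideal (𝓞 F) → ℂ} {c : ℕ} {M : ℝ} (hA : PolyGrowth A c M)
    (κ : Fin r → ℕ) (k0 : ℕ) {t : Ideal (𝓞 F)} (ht : t ≠ 0)
    (ρ : D.Cl (((t : FractionalIdeal (𝓞 F)⁰ F))⁻¹ * dd F) → F)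
    (hρ : ∀ a, D.IsRep (((t : FractionalIdeal (𝓞 F)⁰ F))⁻¹ * dd F) a.1 (ρ a))
    {L : (ℝ × (Fin (r - 1) → ℝ)) ≃L[ℝ] (Fin r → ℝ)} (hL : D.IsL L)
    {K : ℂ} (hK : IsHaarConst L K) {m : Fin (r - 1) → ℤ} {ν : Fin r → ℂ} (hν : D.IsNu m ν) {s : ℂ}
    (hs : ∀ j, (κ j : ℝ) < k0 - s.re)
    (hsum : Summable fun a => ‖A a.1‖ * Real.exp (-(k0 - s.re) * ∑ j, D.lg (ρ a) j))
    (C : ℂ) (lq : Fin r → ℝ) :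
    Integrable (fun τ : ℝ => ucoef (fun w => D.Hf κ k0 A t C lq (L w)) (-m) τ * cexp (s * τ)) ∧
    ∫ τ : ℝ, ucoef (fun w => D.Hf κ k0 A t C lq (L w)) (-m) τ * cexp (s * τ) =
      C * cexp (∑ j, (k0 - s + ν j) * (lq j : ℂ)) * (K * (D.dser _ ρ A ν (k0 - s) * gam κ ν (k0 - s))) := by
  have ht' : (t : FractionalIdeal (𝓞 F)⁰ F) ≠ 0 := by rwa [Ne, FractionalIdeal.coeIdeal_eq_zero]
  have hJ : ((t : FractionalIdeal (𝓞 F)⁰ F))⁻¹ * dd F ≠ 0 := mul_ne_zero (inv_ne_zero ht') dd_ne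
  have := D.cl_countable hJ ρ hρ
  have hs' : ∀ j, (κ j : ℝ) < ((k0 : ℂ) - s).re := by simpa using hs
  obtain ⟨h1, h2⟩ := D.phi_int hL hK κ hν hs'
  let φ' : ℝ × (Fin (r - 1) → ℝ) → ℂ := fun w => cexp (-(k0 : ℂ) * w.1) * aphi κ (-(L w))
  have hφ : ∀ w : ℝ × (Fin (r - 1) → ℝ), φ' w * (cexp (s * w.1) * echar (-m) w.2) =
      (fun w : ℝ × (Fin (r - 1) → ℝ) => aphi κ (L w) * (cexp ((k0 - s) * w.1) * echar m w.2)) (-w) := by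
    intro w
    simp only [φ', echar_neg, map_neg, Prod.fst_neg, Prod.snd_neg, ofReal_neg]
    rw [show ((k0 : ℂ) - s) * -(w.1 : ℂ) = -(k0 : ℂ) * w.1 + s * w.1 by ring, Complex.exp_add]
    ring
  have h1' : Integrable (fun w : ℝ × (Fin (r - 1) → ℝ) => φ' w * (cexp (s * w.1) * echar (-m) w.2)) := by
    simp only [hφ]
    exact h1.comp_neg
  have h2' : ∫ w : ℝ × (Fin (r - 1) → ℝ), φ' w * (cexp (s * w.1) * echar (-m) w.2) = K * gam κ ν (k0 - s) := by
    simp only [hφ]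
    rw [integral_neg_eq_self (fun w : ℝ × (Fin (r - 1) → ℝ) => aphi κ (L w) * (cexp ((k0 - s) * w.1) * echar m w.2)), h2]
  let b : D.Cl (((t : FractionalIdeal (𝓞 F)⁰ F))⁻¹ * dd F) → ℝ × (Fin (r - 1) → ℝ) := fun a => L.symm (lq - D.lg (ρ a))
  have hb1 : ∀ a, (b a).1 = (∑ j, lq j) - ∑ j, D.lg (ρ a) j := by
    intro a
    simp only [b, hL.symm_lg, Pi.sub_apply, Finset.sum_sub_distrib]
  have hmain := unfold_laplace (α := fun a => C * A a.1 * cexp ((k0 : ℂ) * (b a).1)) (b := b)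
    (φ := φ') (G := fun w => D.Hf κ k0 A t C lq (L w))
    ((D.Hf_continuous hA κ k0 ht C lq).comp L.continuous) (-m) s h1'
    (by
      refine (hsum.mul_left (‖C‖ * Real.exp ((k0 - s.re) * ∑ j, lq j))).congr fun a => ?_
      rw [norm_mul, norm_mul, Complex.norm_exp, ← Complex.ofReal_natCast, ← Complex.ofReal_mul, Complex.ofReal_re, hb1]
      have : Real.exp (k0 * ((∑ j, lq j) - ∑ j, D.lg (ρ a) j)) * Real.exp (-s.re * ((∑ j, lq j) - ∑ j, D.lg (ρ a) j)) =
        Real.exp ((k0 - s.re) * ∑ j, lq j) * Real.exp (-(k0 - s.re) * ∑ j, D.lg (ρ a) j) := by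
        rw [← Real.exp_add, ← Real.exp_add]; congr 1; ring
      linear_combination (-(‖C‖ * ‖A a.1‖)) * this)
    (fun w => by
      have h := (D.G_hasSum hA κ ht ρ hρ hL (-lq - L w)).mul_left (C * cexp (-(k0 : ℂ) * ∑ j, (L w j : ℂ)))
      rw [← ((Equiv.refl _).prodCongr (Equiv.neg (Fin (r - 1) → ℤ))).hasSum_iff] at h
      refine Eq.mp (congrArg (fun f => HasSum f _) (funext fun p => ?_)) h
      obtain ⟨a, N⟩ := p
      have hz : zvec (-N) = -zvec N := by
        ext <;> simp [zvec]
      have hsumL : (∑ j, (L w j : ℂ)) = w.1 := by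
        rw [← hL.sum w]; push_cast; rfl
      have hfst : ((w + b a + zvec N).1 : ℂ) = w.1 + (b a).1 := by
        simp [zvec]
      have harg : -(L (w + b a + zvec N)) = -lq - L w + D.lg (ρ a) + L (zvec (-N)) := by
        rw [hz]
        simp only [map_add, map_neg, b, L.apply_symm_apply]
        abel
      simp only [Function.comp, Equiv.prodCongr_apply, Prod.map, Equiv.refl_apply, Equiv.neg_apply, φ']
      rw [harg, hfst, hsumL, mul_add, Complex.exp_add]
      have : cexp ((k0 : ℂ) * (b a).1) * cexp (-(k0 : ℂ) * (b a).1) = 1 := by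
        rw [← Complex.exp_add]; simp
      linear_combination (-(C * A a.1 * cexp (-(k0 : ℂ) * w.1) * aphi κ (-lq - L w + D.lg (ρ a) + L (zvec (-N))))) * this)
  refine ⟨hmain.1, ?_⟩
  rw [hmain.2, h2']
  have hterm : ∀ a, C * A a.1 * cexp ((k0 : ℂ) * (b a).1) * (cexp (-s * (b a).1) * echar (-m) (-(b a).2)) =
      C * cexp (∑ j, (k0 - s + ν j) * (lq j : ℂ)) * (A a.1 * cexp (-∑ j, (k0 - s + ν j) * (D.lg (ρ a) j : ℂ))) := by
    intro a
    rw [echar_neg_neg]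
    have h3 := hL.chi_symm hν (k0 - s) (lq - D.lg (ρ a))
    have h4 : cexp ((k0 - s) * (b a).1) = cexp ((k0 : ℂ) * (b a).1) * cexp (-s * (b a).1) := by
      rw [← Complex.exp_add]; congr 1; ring
    have h5 : cexp (∑ j, (k0 - s + ν j) * (((lq - D.lg (ρ a)) j : ℝ) : ℂ)) =
        cexp (∑ j, (k0 - s + ν j) * (lq j : ℂ)) * cexp (-∑ j, (k0 - s + ν j) * (D.lg (ρ a) j : ℂ)) := by
      rw [← Complex.exp_add, ← sub_eq_add_neg, ← Finset.sum_sub_distrib]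
      congr 1
      refine Finset.sum_congr rfl fun j _ => ?_
      simp only [Pi.sub_apply]; push_cast; ring
    rw [h5] at h3
    change cexp ((k0 - s) * (b a).1) * echar m (b a).2 = _ at h3
    rw [h4] at h3
    linear_combination (C * A a.1) * h3
  simp only [hterm]
  rw [tsum_mul_left]
  unfold Dat.dser
  ring

end DatB6

section DatB7
variable {F : Type*} [Field F] [NumberField F] {r : ℕ} (D : Dat F r)

theorem psi_span (D : Dat F r) {ψ : FractionalIdeal (𝓞 F)⁰ F → ℂ} {ν : Fin r → ℂ}
    (hψpos : ∀ (ξ : F), (∀ j, 0 < D.σ j ξ) →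
      ψ (spanSingleton (𝓞 F)⁰ ξ) = ∏ j, ((D.σ j ξ : ℝ) : ℂ) ^ (-(ν j))) {ξ : F} (hξ : ∀ j, 0 < D.σ j ξ) :
    ψ (spanSingleton (𝓞 F)⁰ ξ) = cexp (-∑ j, ν j * (D.lg ξ j : ℂ)) := by
  rw [hψpos ξ hξ, ← Finset.sum_neg_distrib, Complex.exp_sum]
  refine Finset.prod_congr rfl fun j _ => ?_
  rw [cpow_def_of_ne_zero (by exact_mod_cast (hξ j).ne'), ← Complex.ofReal_log (hξ j).le]
  unfold Dat.lg
  ring_nf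

theorem natCast_cpow_exp {n : ℕ} (hn : n ≠ 0) (s : ℂ) : (n : ℂ) ^ s = cexp (s * (Real.log n : ℂ)) := by
  rw [cpow_def_of_ne_zero (by exact_mod_cast hn), ← Complex.natCast_log, mul_comm]

theorem Dat.lpartial_eq {J : FractionalIdeal (𝓞 F)⁰ F} (hJ : J ≠ 0) (ρ : D.Cl J → F)
    (hρ : ∀ a, D.IsRep J a.1 (ρ a)) (A : Ideal (𝓞 F) → ℂ)
    {ψ : FractionalIdeal (𝓞 F)⁰ F → ℂ} {ν : Fin r → ℂ}
    (hψmul : ∀ (I J : FractionalIdeal (𝓞 F)⁰ F), I ≠ 0 → J ≠ 0 → ψ (I * J) = ψ I * ψ J)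
    (hψpos : ∀ (ξ : F), (∀ j, 0 < D.σ j ξ) →
      ψ (spanSingleton (𝓞 F)⁰ ξ) = ∏ j, ((D.σ j ξ : ℝ) : ℂ) ^ (-(ν j))) (s : ℂ) :
    Lpartial F r D.σ A ψ J s = ψ J * cexp (-s * (Real.log ((absNorm J : ℚ) : ℝ) : ℂ)) * D.dser J ρ A ν s := by
  unfold Lpartial Dat.dser
  rw [← tsum_mul_left]
  refine tsum_congr fun a => ?_
  have h := hρ a
  rw [h.2.1, hψmul _ _ (span_ne (D.ne_zero h.1)) hJ, psi_span D hψpos h.1,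
    natCast_cpow_exp (by rw [Ne, Ideal.absNorm_eq_zero_iff]; exact a.2.1)]
  have h2 := D.sum_lg hJ h
  have h3 : (Real.log (Ideal.absNorm a.1 : ℝ) : ℂ) = ∑ j, (D.lg (ρ a) j : ℂ) + (Real.log ((absNorm J : ℚ) : ℝ) : ℂ) := by
    rw [← Complex.ofReal_sum, h2]; push_cast; ring
  rw [h3, mul_add, Complex.exp_add]
  simp only [add_mul, Finset.sum_add_distrib, neg_add, Complex.exp_add, ← Finset.mul_sum, neg_mul]
  ring

theorem gam_eq (κ : Fin r → ℕ) {ν : Fin r → ℂ} (hν : ∑ j, ν j = 0) (s : ℂ) :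
    gam κ ν s = cexp ((∑ j, (κ j : ℂ)) * Real.log (2 * π)) * ((2 * Real.pi : ℝ) : ℂ) ^ (-((r : ℂ) * s)) *
      ∏ j, Complex.Gamma (s - (κ j : ℂ) + ν j) := by
  unfold gam
  rw [Finset.prod_mul_distrib, ← Complex.exp_sum, cpow_def_of_ne_zero (by exact_mod_cast (by positivity : (2 * π) ≠ 0)),
    ← Complex.ofReal_log (by positivity), ← Complex.exp_add]
  congr 2
  rw [← Finset.sum_mul, Finset.sum_neg_distrib, Finset.sum_add_distrib, hν, Finset.sum_sub_distrib]
  simp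
  ring

theorem log_absNorm_J {t : Ideal (𝓞 F)} (ht : t ≠ 0) :
    Real.log ((absNorm (((t : FractionalIdeal (𝓞 F)⁰ F))⁻¹ * dd F) : ℚ) : ℝ) =
      Real.log (Ideal.absNorm (differentIdeal ℤ (𝓞 F)) : ℝ) - Real.log (Ideal.absNorm t : ℝ) := by
  have h1 : (Ideal.absNorm t : ℝ) ≠ 0 := by have := one_le_absNorm ht; positivity
  have h2 : (Ideal.absNorm (differentIdeal ℤ (𝓞 F)) : ℝ) ≠ 0 := by
    have h : (differentIdeal ℤ (𝓞 F)) ≠ 0 := by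
      have := dd_ne (F := F)
      rwa [Ne, FractionalIdeal.coeIdeal_eq_zero] at this
    have := one_le_absNorm h
    positivity
  rw [map_mul, map_inv₀, coeIdeal_absNorm, coeIdeal_absNorm]
  push_cast
  rw [Real.log_mul (inv_ne_zero h1) h2, Real.log_inv]
  ring

theorem Dat.lhat_rel {t : Ideal (𝓞 F)} (ht : t ≠ 0) {𝔫 : Ideal (𝓞 F)} (h𝔫 : 𝔫 ≠ 0)
    (ρ : D.Cl (((t : FractionalIdeal (𝓞 F)⁰ F))⁻¹ * dd F) → F)
    (hρ : ∀ a, D.IsRep (((t : FractionalIdeal (𝓞 F)⁰ F))⁻¹ * dd F) a.1 (ρ a)) (A : Ideal (𝓞 F) → ℂ)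
    {ψ : FractionalIdeal (𝓞 F)⁰ F → ℂ} {ν : Fin r → ℂ} (hν : ∑ j, ν j = 0)
    (hψmul : ∀ (I J : FractionalIdeal (𝓞 F)⁰ F), I ≠ 0 → J ≠ 0 → ψ (I * J) = ψ I * ψ J)
    (hψne : ∀ (I : FractionalIdeal (𝓞 F)⁰ F), I ≠ 0 → ψ I ≠ 0)
    (hψpos : ∀ (ξ : F), (∀ j, 0 < D.σ j ξ) →
      ψ (spanSingleton (𝓞 F)⁰ ξ) = ∏ j, ((D.σ j ξ : ℝ) : ℂ) ^ (-(ν j))) (k : Fin r → ℕ) (k0 : ℕ) (s : ℂ) :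
    D.dser _ ρ A ν s * gam (fun j => (k0 - k j) / 2) ν s =
      cexp ((∑ j, (((k0 - k j) / 2 : ℕ) : ℂ)) * Real.log (2 * π)) *
      (ψ (((t : FractionalIdeal (𝓞 F)⁰ F))⁻¹ * dd F))⁻¹ *
      cexp (-s * (Real.log (Ideal.absNorm t) + Real.log (Ideal.absNorm 𝔫) / 2 : ℝ)) *
      LhatPartial F r D.σ k k0 𝔫 A ψ ν (((t : FractionalIdeal (𝓞 F)⁰ F))⁻¹ * dd F) s := by
  have ht' : (t : FractionalIdeal (𝓞 F)⁰ F) ≠ 0 := by rwa [Ne, FractionalIdeal.coeIdeal_eq_zero]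
  have hJ : ((t : FractionalIdeal (𝓞 F)⁰ F))⁻¹ * dd F ≠ 0 := mul_ne_zero (inv_ne_zero ht') dd_ne
  have hd : (differentIdeal ℤ (𝓞 F)) ≠ 0 := by
    have := dd_ne (F := F)
    rwa [Ne, FractionalIdeal.coeIdeal_eq_zero] at this
  unfold LhatPartial
  rw [D.lpartial_eq hJ ρ hρ A hψmul hψpos, gam_eq _ hν, log_absNorm_J ht,
    natCast_cpow_exp (by rw [Ne, Ideal.absNorm_eq_zero_iff]; exact mul_ne_zero h𝔫 (pow_ne_zero _ hd))]
  have h1 : (Ideal.absNorm 𝔫 : ℝ) ≠ 0 := by have := one_le_absNorm h𝔫; positivity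
  have h2 : (Ideal.absNorm (differentIdeal ℤ (𝓞 F)) : ℝ) ≠ 0 := by have := one_le_absNorm hd; positivity
  have h3 : Real.log (Ideal.absNorm (𝔫 * differentIdeal ℤ (𝓞 F) ^ 2) : ℝ) =
      Real.log (Ideal.absNorm 𝔫) + 2 * Real.log (Ideal.absNorm (differentIdeal ℤ (𝓞 F))) := by
    rw [map_mul, map_pow]; push_cast
    rw [Real.log_mul h1 (pow_ne_zero _ h2), Real.log_pow]; norm_num
  rw [h3]
  have hψJ := hψne _ hJ
  set a := Real.log (Ideal.absNorm 𝔫)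
  set b := Real.log (Ideal.absNorm (differentIdeal ℤ (𝓞 F)))
  set c := Real.log (Ideal.absNorm t)
  have h4 : cexp (-s * ((c + a / 2 : ℝ) : ℂ)) * (cexp (s / 2 * ((a + 2 * b : ℝ) : ℂ)) * cexp (-s * ((b - c : ℝ) : ℂ))) = 1 := by
    rw [← Complex.exp_add, ← Complex.exp_add, ← Complex.exp_zero]
    congr 1
    push_cast; ring
  set e1 := cexp (-s * ((c + a / 2 : ℝ) : ℂ))
  set e2 := cexp (s / 2 * ((a + 2 * b : ℝ) : ℂ))
  set e3 := cexp (-s * ((b - c : ℝ) : ℂ))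
  set S := D.dser _ ρ A ν s
  set p := ψ (((t : FractionalIdeal (𝓞 F)⁰ F))⁻¹ * dd F)
  have h5 : p⁻¹ * p = 1 := inv_mul_cancel₀ hψJ
  generalize cexp ((∑ j, (((k0 - k j) / 2 : ℕ) : ℂ)) * Real.log (2 * π)) = X1
  generalize ((2 * Real.pi : ℝ) : ℂ) ^ (-((r : ℂ) * s)) = X2
  generalize (∏ j, Complex.Gamma (s - (((k0 - k j) / 2 : ℕ) : ℂ) + ν j)) = X3
  calc S * (X1 * X2 * X3) = (p⁻¹ * p) * (e1 * (e2 * e3)) * (S * (X1 * X2 * X3)) := by rw [h4, h5]; ring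
    _ = _ := by ring

end DatB7

section DatB8
variable {F : Type*} [Field F] [NumberField F] {r : ℕ} (D : Dat F r)

theorem coe_ne {t : Ideal (𝓞 F)} (ht : t ≠ 0) : (t : FractionalIdeal (𝓞 F)⁰ F) ≠ 0 := by
  rwa [Ne, FractionalIdeal.coeIdeal_eq_zero]

theorem J_ne {t : Ideal (𝓞 F)} (ht : t ≠ 0) : ((t : FractionalIdeal (𝓞 F)⁰ F))⁻¹ * dd F ≠ 0 :=
  mul_ne_zero (inv_ne_zero (coe_ne ht)) dd_ne

theorem psi_J {ψ : FractionalIdeal (𝓞 F)⁰ F → ℂ}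
    (hψmul : ∀ (I J : FractionalIdeal (𝓞 F)⁰ F), I ≠ 0 → J ≠ 0 → ψ (I * J) = ψ I * ψ J)
    {t : Ideal (𝓞 F)} (ht : t ≠ 0) :
    ψ (((t : FractionalIdeal (𝓞 F)⁰ F))⁻¹ * dd F) * ψ t = ψ (dd F) := by
  rw [← hψmul _ _ (J_ne ht) (coe_ne ht)]
  congr 1
  rw [mul_right_comm, inv_mul_cancel₀ (coe_ne ht), one_mul]

theorem Dat.psi_rel {ψ : FractionalIdeal (𝓞 F)⁰ F → ℂ} {ν : Fin r → ℂ}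
    (hψmul : ∀ (I J : FractionalIdeal (𝓞 F)⁰ F), I ≠ 0 → J ≠ 0 → ψ (I * J) = ψ I * ψ J)
    (hψne : ∀ (I : FractionalIdeal (𝓞 F)⁰ F), I ≠ 0 → ψ I ≠ 0)
    (hψpos : ∀ (ξ : F), (∀ j, 0 < D.σ j ξ) →
      ψ (spanSingleton (𝓞 F)⁰ ξ) = ∏ j, ((D.σ j ξ : ℝ) : ℂ) ^ (-(ν j)))
    {𝔫 t t' : Ideal (𝓞 F)} (h𝔫 : 𝔫 ≠ 0) (ht : t ≠ 0) (ht' : t' ≠ 0)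
    {q : 𝓞 F} (hqpos : ∀ j, 0 < D.σ j (algebraMap (𝓞 F) F q))
    (hqgen : Ideal.span {q} = t * t' * 𝔫) :
    cexp (∑ j, ν j * (D.lg (algebraMap (𝓞 F) F q) j : ℂ)) *
      (ψ (((t : FractionalIdeal (𝓞 F)⁰ F))⁻¹ * dd F))⁻¹ *
      ψ ((𝔫 * differentIdeal ℤ (𝓞 F) ^ 2 : Ideal (𝓞 F)) : FractionalIdeal (𝓞 F)⁰ F) =
      ψ (((t' : FractionalIdeal (𝓞 F)⁰ F))⁻¹ * dd F) := by
  have h1 : ψ (spanSingleton (𝓞 F)⁰ (algebraMap (𝓞 F) F q)) = ψ t * ψ t' * ψ 𝔫 := by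
    rw [← FractionalIdeal.coeIdeal_span_singleton, hqgen, FractionalIdeal.coeIdeal_mul,
      FractionalIdeal.coeIdeal_mul, hψmul _ _ (mul_ne_zero (coe_ne ht) (coe_ne ht')) (coe_ne h𝔫),
      hψmul _ _ (coe_ne ht) (coe_ne ht')]
  rw [psi_span D hψpos hqpos] at h1
  have h2 : ψ ((𝔫 * differentIdeal ℤ (𝓞 F) ^ 2 : Ideal (𝓞 F)) : FractionalIdeal (𝓞 F)⁰ F) =
      ψ 𝔫 * (ψ (dd F) * ψ (dd F)) := by
    rw [FractionalIdeal.coeIdeal_mul, pow_two, FractionalIdeal.coeIdeal_mul,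
      hψmul _ _ (coe_ne h𝔫) (mul_ne_zero dd_ne dd_ne), hψmul _ _ dd_ne dd_ne]
  have h3 := psi_J hψmul ht
  have h4 := psi_J hψmul ht'
  have n1 := hψne _ (coe_ne ht)
  have n2 := hψne _ (coe_ne ht')
  have n3 := hψne _ (coe_ne h𝔫)
  have n4 := hψne _ (dd_ne (F := F))
  have n5 := hψne _ (J_ne ht)
  rw [Complex.exp_neg] at h1
  have h5 : cexp (∑ j, ν j * (D.lg (algebraMap (𝓞 F) F q) j : ℂ)) = (ψ t * ψ t' * ψ 𝔫)⁻¹ := by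
    rw [← h1, inv_inv]
  rw [h5, h2, ← mul_left_inj' n2, h4]
  rw [← h3] at n4 ⊢
  field_simp

theorem Dat.sum_lq {𝔫 t t' : Ideal (𝓞 F)} (h𝔫 : 𝔫 ≠ 0) (ht : t ≠ 0) (ht' : t' ≠ 0)
    {q : 𝓞 F} (hqpos : ∀ j, 0 < D.σ j (algebraMap (𝓞 F) F q))
    (hqgen : Ideal.span {q} = t * t' * 𝔫) :
    ∑ j, D.lg (algebraMap (𝓞 F) F q) j = Real.log (Ideal.absNorm t) + Real.log (Ideal.absNorm t')
      + Real.log (Ideal.absNorm 𝔫) := by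
  have h := D.absNorm_span hqpos
  rw [← FractionalIdeal.coeIdeal_span_singleton, hqgen, coeIdeal_absNorm] at h
  unfold Dat.lg
  rw [← Real.log_prod (fun j _ => (hqpos j).ne'), ← h, map_mul, map_mul]
  have h1 := one_le_absNorm h𝔫
  have h2 := one_le_absNorm ht
  have h3 := one_le_absNorm ht'
  push_cast
  rw [Real.log_mul (by positivity) (by positivity), Real.log_mul (by positivity) (by positivity)]

theorem I_pow_sq {k : Fin r → ℕ} (hk : ∀ j, Even (k j)) :
    Complex.I ^ (-(∑ j, (k j : ℤ))) * Complex.I ^ (-(∑ j, (k j : ℤ))) = 1 := by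
  have h : Even (∑ j, (k j : ℤ)) := Finset.even_sum _ fun j _ => by exact_mod_cast hk j
  obtain ⟨n, hn⟩ := h
  rw [← zpow_add₀ Complex.I_ne_zero, hn, show -(n + n) + -(n + n) = 4 * (-n) by ring, zpow_mul]
  have : Complex.I ^ (4 : ℤ) = 1 := by exact_mod_cast Complex.I_pow_four
  rw [this, one_zpow]

end DatB8

section DatB9
variable {F : Type*} [Field F] [NumberField F] {r : ℕ} (D : Dat F r)

/-- The constant in the functional equation of the theta-like functions. -/
def cstC {r : ℕ} (k : Fin r → ℕ) (k0 : ℕ) (eps : ℂ) (t' 𝔫 : Ideal (𝓞 F)) : ℂ :=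
  eps * Complex.I ^ (-(∑ j, (k j : ℤ))) *
    cexp (-(k0 : ℂ) * (Real.log (Ideal.absNorm t') + Real.log (Ideal.absNorm 𝔫) / 2 : ℝ))

theorem Dat.compare {A : Ideal (𝓞 F) → ℂ} {c : ℕ} {M : ℝ} (hA : PolyGrowth A c M)
    {k : Fin r → ℕ} (hk : ∀ j, Even (k j)) (k0 : ℕ) {eps : ℂ} (heps : eps * eps = 1)
    {𝔫 t t' : Ideal (𝓞 F)} (h𝔫 : 𝔫 ≠ 0) (ht : t ≠ 0) (ht' : t' ≠ 0)
    {q : 𝓞 F} (hqpos : ∀ j, 0 < D.σ j (algebraMap (𝓞 F) F q))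
    (hqgen : Ideal.span {q} = t * t' * 𝔫)
    (ρ : D.Cl (((t : FractionalIdeal (𝓞 F)⁰ F))⁻¹ * dd F) → F)
    (hρ : ∀ a, D.IsRep (((t : FractionalIdeal (𝓞 F)⁰ F))⁻¹ * dd F) a.1 (ρ a))
    (ρ' : D.Cl (((t' : FractionalIdeal (𝓞 F)⁰ F))⁻¹ * dd F) → F)
    (hρ' : ∀ a, D.IsRep (((t' : FractionalIdeal (𝓞 F)⁰ F))⁻¹ * dd F) a.1 (ρ' a))
    {L : (ℝ × (Fin (r - 1) → ℝ)) ≃L[ℝ] (Fin r → ℝ)} (hL : D.IsL L)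
    {K : ℂ} (hK : IsHaarConst L K) {m : Fin (r - 1) → ℤ} {ν ν' : Fin r → ℂ}
    (hν : D.IsNu m ν) (hν' : D.IsNu (-m) ν')
    {ψ ψ' : FractionalIdeal (𝓞 F)⁰ F → ℂ}
    (hψmul : ∀ (I J : FractionalIdeal (𝓞 F)⁰ F), I ≠ 0 → J ≠ 0 → ψ (I * J) = ψ I * ψ J)
    (hψne : ∀ (I : FractionalIdeal (𝓞 F)⁰ F), I ≠ 0 → ψ I ≠ 0)
    (hψpos : ∀ (ξ : F), (∀ j, 0 < D.σ j ξ) →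
      ψ (spanSingleton (𝓞 F)⁰ ξ) = ∏ j, ((D.σ j ξ : ℝ) : ℂ) ^ (-(ν j)))
    (hψmul' : ∀ (I J : FractionalIdeal (𝓞 F)⁰ F), I ≠ 0 → J ≠ 0 → ψ' (I * J) = ψ' I * ψ' J)
    (hψne' : ∀ (I : FractionalIdeal (𝓞 F)⁰ F), I ≠ 0 → ψ' I ≠ 0)
    (hψpos' : ∀ (ξ : F), (∀ j, 0 < D.σ j ξ) →
      ψ' (spanSingleton (𝓞 F)⁰ ξ) = ∏ j, ((D.σ j ξ : ℝ) : ℂ) ^ (-(ν' j)))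
    (hψinv : ∀ (I : FractionalIdeal (𝓞 F)⁰ F), I ≠ 0 → (ψ' I)⁻¹ = ψ I)
    {Λ Λ' : ℂ → ℂ} (hΛ'd : Differentiable ℂ Λ')
    (hΛ'b : ∀ a b : ℝ, ∃ M : ℝ, ∀ s : ℂ, a ≤ s.re → s.re ≤ b → ‖Λ' s‖ ≤ M)
    {σ₀ : ℝ}
    (hΛ : ∀ s : ℂ, σ₀ < s.re → Λ s = LhatPartial F r D.σ k k0 𝔫 A ψ ν
          (((t : FractionalIdeal (𝓞 F)⁰ F))⁻¹ * dd F) s)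
    (hΛ' : ∀ s : ℂ, σ₀ < s.re → Λ' s = LhatPartial F r D.σ k k0 𝔫 A ψ' ν'
          (((t' : FractionalIdeal (𝓞 F)⁰ F))⁻¹ * dd F) s)
    (hfe : ∀ s : ℂ, Λ s = eps * Complex.I ^ (-(∑ j, (k j : ℤ))) *
        ψ ((𝔫 * differentIdeal ℤ (𝓞 F) ^ 2 : Ideal (𝓞 F)) : FractionalIdeal (𝓞 F)⁰ F) *
        Λ' ((k0 : ℂ) - s)) :
    ucoef (fun w => D.Hf (fun j => (k0 - k j) / 2) k0 A t (cstC k k0 eps t' 𝔫)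
      (D.lg (algebraMap (𝓞 F) F q)) (L w)) (-m) =
    ucoef (fun w => D.G (fun j => (k0 - k j) / 2) A t' (L w)) (-m) := by
  obtain ⟨x1, hx1⟩ := D.dser_summable (J_ne ht) ρ hρ hA
  obtain ⟨x2, hx2⟩ := D.dser_summable (J_ne ht') ρ' hρ' hA
  set κ : Fin r → ℕ := fun j => (k0 - k j) / 2 with hκ
  have hκk : ∀ j, (κ j : ℝ) ≤ k0 := fun j => by
    have : κ j ≤ k0 := by simp only [hκ]; omega
    exact_mod_cast this
  set b : ℝ := max x1 (max x2 (max σ₀ 0)) + k0 + 1 with hb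
  have hk0 : (0:ℝ) ≤ k0 := by positivity
  have hb1 : x1 ≤ b := by have := le_max_left x1 (max x2 (max σ₀ 0)); linarith
  have hb2 : x2 ≤ b := by
    have := le_max_right x1 (max x2 (max σ₀ 0)); have := le_max_left x2 (max σ₀ 0); linarith
  have hb3 : σ₀ < b := by
    have := le_max_right x1 (max x2 (max σ₀ 0)); have := le_max_right x2 (max σ₀ 0)
    have := le_max_left σ₀ 0; linarith
  have hb4 : (k0:ℝ) + 1 ≤ b := by
    have := le_max_right x1 (max x2 (max σ₀ 0)); have := le_max_right x2 (max σ₀ 0)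
    have := le_max_right σ₀ 0; linarith
  have hs1 := hx1 b hb1
  have hs2 := hx2 b hb2
  have hab : (k0 : ℝ) - b < b := by linarith
  set X : ℂ := cexp ((∑ j, (((k0 - k j) / 2 : ℕ) : ℂ)) * Real.log (2 * π)) with hX
  set e' : ℝ := Real.log (Ideal.absNorm t') + Real.log (Ideal.absNorm 𝔫) / 2 with he'
  set p' := ψ' (((t' : FractionalIdeal (𝓞 F)⁰ F))⁻¹ * dd F) with hp'
  let P : ℂ → ℂ := fun s => K * (X * p'⁻¹ * cexp (-s * (e' : ℂ)) * Λ' s)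
  have hPd : Differentiable ℂ P := by
    have : Differentiable ℂ (fun s : ℂ => cexp (-s * (e' : ℂ))) := by fun_prop
    exact ((this.const_mul _).mul hΛ'd).const_mul _
  set lq := D.lg (algebraMap (𝓞 F) F q) with hlq
  -- the value on the right line
  have hPb : ∀ s : ℂ, s.re = b → P s = K * (D.dser _ ρ' A ν' s * gam κ ν' s) := by
    intro s hs
    simp only [P]
    rw [D.lhat_rel ht' h𝔫 ρ' hρ' A hν'.sum hψmul' hψne' hψpos' k k0 s, hΛ' s (by rw [hs]; exact hb3)]
  have hPa : ∀ s : ℂ, s.re = k0 - b → P s = cstC k k0 eps t' 𝔫 * cexp (∑ j, (k0 - s + ν j) * (lq j : ℂ)) *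
      (K * (D.dser _ ρ A ν (k0 - s) * gam κ ν (k0 - s))) := by
    intro s hs
    have hre : σ₀ < ((k0:ℂ) - s).re := by
      simp [hs]; exact hb3
    rw [D.lhat_rel ht h𝔫 ρ hρ A hν.sum hψmul hψne hψpos k k0, ← hΛ _ hre, hfe, sub_sub_cancel]
    have hpsi := D.psi_rel hψmul hψne hψpos h𝔫 ht ht' hqpos hqgen
    rw [← hψinv _ (J_ne ht'), ← hp', ← hlq] at hpsi
    have hsl := D.sum_lq h𝔫 ht ht' hqpos hqgen
    have hsl' : ∑ j, (lq j : ℂ) = ((Real.log (Ideal.absNorm t) + Real.log (Ideal.absNorm t')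
      + Real.log (Ideal.absNorm 𝔫) : ℝ) : ℂ) := by rw [← hsl, Complex.ofReal_sum]
    have hexp : cexp (∑ j, (k0 - s + ν j) * (lq j : ℂ)) =
        cexp ((k0 - s) * ((Real.log (Ideal.absNorm t) + Real.log (Ideal.absNorm t')
      + Real.log (Ideal.absNorm 𝔫) : ℝ) : ℂ)) * cexp (∑ j, ν j * (lq j : ℂ)) := by
      rw [← Complex.exp_add, ← hsl', Finset.mul_sum, ← Finset.sum_add_distrib]
      simp only [add_mul]
    rw [hexp]
    simp only [P, cstC]
    rw [← hpsi]
    have hI := I_pow_sq hk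
    set i1 := Complex.I ^ (-(∑ j, (k j : ℤ)))
    set E1 := cexp (∑ j, ν j * (lq j : ℂ))
    set E2 := cexp ((k0 - s) * ((Real.log (Ideal.absNorm t) + Real.log (Ideal.absNorm t')
      + Real.log (Ideal.absNorm 𝔫) : ℝ) : ℂ)) with hE2
    have hE : cexp (-s * (e' : ℂ)) = cexp (-(k0 : ℂ) * (e' : ℂ)) * E2 *
        cexp (-(k0 - s) * ((Real.log (Ideal.absNorm t) + Real.log (Ideal.absNorm 𝔫) / 2 : ℝ) : ℂ)) := by
      rw [hE2, ← Complex.exp_add, ← Complex.exp_add]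
      congr 1
      rw [he']; push_cast; ring
    rw [hE]
    linear_combination (-(K * X * (ψ (((t : FractionalIdeal (𝓞 F)⁰ F))⁻¹ * dd F))⁻¹ * E1 *
      ψ ((𝔫 * differentIdeal ℤ (𝓞 F) ^ 2 : Ideal (𝓞 F)) : FractionalIdeal (𝓞 F)⁰ F) * Λ' s *
      (cexp (-(k0 : ℂ) * (e' : ℂ)) * E2 *
        cexp (-(k0 - s) * ((Real.log (Ideal.absNorm t) + Real.log (Ideal.absNorm 𝔫) / 2 : ℝ) : ℂ))))) *
      (heps + eps * eps * hI)
  obtain ⟨K1, hK10, hK1⟩ := D.E_bound ρ (A := A) κ hν.im (x := b) (fun j => by linarith [hκk j]) hs1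
  obtain ⟨K2, hK20, hK2⟩ := D.E_bound ρ' (A := A) κ hν'.im (x := b) (fun j => by linarith [hκk j]) hs2
  obtain ⟨M0, hM0⟩ := hΛ'b (k0 - b) b
  -- bounds
  set Ca : ℝ := ‖cstC k k0 eps t' 𝔫‖ * Real.exp (b * ∑ j, lq j) * ‖K‖ with hCa
  refine laplace_unique (a := k0 - b) (b := b) (P := P)
    (M := ‖K‖ * (‖X * p'⁻¹‖ * Real.exp ((b + k0) * |e'|) * M0))
    (K := max (Ca * K1) (‖K‖ * K2)) ?_ ?_ hPd hab ?_ ?_ ?_ ?_ ?_ ?_ ?_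
  · exact continuous_ucoef ((D.Hf_continuous hA κ k0 ht _ _).comp L.continuous) _
  · exact continuous_ucoef ((D.G_continuous hA κ ht').comp L.continuous) _
  · intro s h1 h2
    simp only [P]
    rw [norm_mul, norm_mul, norm_mul _ (cexp _)]
    have h3 : ‖cexp (-s * (e' : ℂ))‖ ≤ Real.exp ((b + k0) * |e'|) := by
      rw [Complex.norm_exp, Complex.re_mul_ofReal]
      refine Real.exp_le_exp.mpr ?_
      calc (-s).re * e' ≤ |(-s).re * e'| := le_abs_self _
        _ = |(-s).re| * |e'| := abs_mul _ _
        _ ≤ _ := by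
          gcongr
          rw [Complex.neg_re, abs_neg, abs_le]
          constructor <;> linarith
    have h4 := hM0 s h1 h2
    gcongr
  · intro s hs
    rw [hPa s hs]
    have h1 := hK1 (k0 - s) (by simp [hs])
    have him : ((k0:ℂ) - s).im ^ 2 = s.im ^ 2 := by simp
    rw [him] at h1
    have h2 : ‖cexp (∑ j, (k0 - s + ν j) * (lq j : ℂ))‖ = Real.exp (b * ∑ j, lq j) := by
      have := dser_term_norm hν.im (k0 - s) (-lq)
      simp only [Pi.neg_apply, Complex.ofReal_neg, mul_neg, Finset.sum_neg_distrib, neg_neg] at this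
      rw [this]
      simp [hs]
    refine le_trans ?_ (le_max_left _ _)
    rw [norm_mul, norm_mul, norm_mul, h2, hCa]
    calc _ = ‖cstC k k0 eps t' 𝔫‖ * Real.exp (b * ∑ j, lq j) * ‖K‖ *
          (‖D.dser _ ρ A ν (k0 - s) * gam κ ν (k0 - s)‖ * (1 + s.im ^ 2)) := by ring
      _ ≤ _ := by gcongr
  · intro s hs
    rw [hPb s hs]
    refine le_trans ?_ (le_max_right _ _)
    rw [norm_mul, mul_assoc]
    gcongr
    exact hK2 s hs
  · have := (D.trans2 hA κ k0 ht ρ hρ hL hK hν (s := ((k0 - b : ℝ) : ℂ)) (fun j => by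
      rw [Complex.ofReal_re]; linarith [hκk j]) (by rw [Complex.ofReal_re, sub_sub_cancel]; exact hs1)
      (cstC k k0 eps t' 𝔫) lq).1
    exact_mod_cast this
  · have := (D.trans1 hA κ ht' ρ' hρ' hL hK hν' (s := (b : ℂ)) (fun j => by
      rw [Complex.ofReal_re]; linarith [hκk j]) (by rw [Complex.ofReal_re]; exact hs2)).1
    exact_mod_cast this
  · intro s hs
    rw [hPa s hs]
    exact (D.trans2 hA κ k0 ht ρ hρ hL hK hν (s := s) (fun j => by
      rw [hs]; linarith [hκk j]) (by rw [hs, sub_sub_cancel]; exact hs1)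
      (cstC k k0 eps t' 𝔫) lq).2
  · intro s hs
    rw [hPb s hs]
    exact (D.trans1 hA κ ht' ρ' hρ' hL hK hν' (s := s) (fun j => by
      rw [hs]; linarith [hκk j]) (by rw [hs]; exact hs2)).2

end DatB9

section DatB10
variable {F : Type*} [Field F] [NumberField F] {r : ℕ} (D : Dat F r)

theorem zvec_add {n : ℕ} (N N' : Fin n → ℤ) : zvec (N + N') = zvec N + zvec N' := by
  ext <;> simp [zvec]

theorem zvec_neg {n : ℕ} (N : Fin n → ℤ) : zvec (-N) = -zvec N := by
  ext <;> simp [zvec]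

theorem Dat.G_periodic {A : Ideal (𝓞 F) → ℂ} {c : ℕ} {M : ℝ} (hA : PolyGrowth A c M)
    (κ : Fin r → ℕ) {t : Ideal (𝓞 F)} (ht : t ≠ 0)
    (ρ : D.Cl (((t : FractionalIdeal (𝓞 F)⁰ F))⁻¹ * dd F) → F)
    (hρ : ∀ a, D.IsRep (((t : FractionalIdeal (𝓞 F)⁰ F))⁻¹ * dd F) a.1 (ρ a))
    {L : (ℝ × (Fin (r - 1) → ℝ)) ≃L[ℝ] (Fin r → ℝ)} (hL : D.IsL L) (x : Fin r → ℝ)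
    (N : Fin (r - 1) → ℤ) : D.G κ A t (x + L (zvec N)) = D.G κ A t x := by
  have h1 := D.G_hasSum hA κ ht ρ hρ hL (x + L (zvec N))
  have h2 := D.G_hasSum hA κ ht ρ hρ hL x
  rw [← (Equiv.prodCongr (Equiv.refl _) (Equiv.addLeft N)).hasSum_iff] at h2
  refine h1.unique (h2.congr_fun ?_)
  intro p
  simp only [Function.comp_apply, Equiv.prodCongr_apply, Prod.map, Equiv.refl_apply, Equiv.coe_addLeft, zvec_add,
    map_add]
  congr 2
  abel

theorem Dat.Hf_periodic {A : Ideal (𝓞 F) → ℂ} {c : ℕ} {M : ℝ} (hA : PolyGrowth A c M)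
    (κ : Fin r → ℕ) (k0 : ℕ) {t : Ideal (𝓞 F)} (ht : t ≠ 0)
    (ρ : D.Cl (((t : FractionalIdeal (𝓞 F)⁰ F))⁻¹ * dd F) → F)
    (hρ : ∀ a, D.IsRep (((t : FractionalIdeal (𝓞 F)⁰ F))⁻¹ * dd F) a.1 (ρ a))
    {L : (ℝ × (Fin (r - 1) → ℝ)) ≃L[ℝ] (Fin r → ℝ)} (hL : D.IsL L) (C : ℂ) (lq : Fin r → ℝ) (x : Fin r → ℝ)
    (N : Fin (r - 1) → ℤ) : D.Hf κ k0 A t C lq (x + L (zvec N)) = D.Hf κ k0 A t C lq x := by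
  unfold Dat.Hf
  have h1 : -lq - (x + L (zvec N)) = (-lq - x) + L (zvec (-N)) := by
    rw [zvec_neg, map_neg]; abel
  have h2 : ∑ j, ((L (zvec N) j : ℝ) : ℂ) = 0 := by
    rw [← Complex.ofReal_sum, hL.sum]; simp [zvec]
  rw [h1, D.G_periodic hA κ ht ρ hρ hL]
  simp only [Pi.add_apply, Complex.ofReal_add, Finset.sum_add_distrib, h2, add_zero]

theorem polyGrowth_of {A : Ideal (𝓞 F) → ℂ}
    (hA2 : ∃ c : ℝ, 0 < c ∧ ∃ M : ℝ, ∀ a : Ideal (𝓞 F), a ≠ 0 →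
      ‖A a‖ ≤ M * (Ideal.absNorm a : ℝ) ^ c) : ∃ (c : ℕ) (M : ℝ), PolyGrowth A c M := by
  obtain ⟨c, hc, M, h⟩ := hA2
  refine ⟨⌈c⌉₊, max M 0, le_max_right _ _, fun a ha => (h a ha).trans ?_⟩
  have h1 := one_le_absNorm ha
  rw [← Real.rpow_natCast]
  have h2 : (Ideal.absNorm a : ℝ) ^ c ≤ (Ideal.absNorm a : ℝ) ^ ((⌈c⌉₊ : ℕ) : ℝ) :=
    Real.rpow_le_rpow_of_exponent_le h1 (Nat.le_ceil c)
  have h3 : (0:ℝ) ≤ (Ideal.absNorm a : ℝ) ^ c := by positivity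
  calc M * (Ideal.absNorm a : ℝ) ^ c ≤ max M 0 * (Ideal.absNorm a : ℝ) ^ c := by
        gcongr; exact le_max_left _ _
    _ ≤ _ := by gcongr

theorem Dat.theta {A : Ideal (𝓞 F) → ℂ} {c : ℕ} {M : ℝ} (hA : PolyGrowth A c M)
    {k : Fin r → ℕ} (hk : ∀ j, Even (k j)) (k0 : ℕ) {eps : ℂ} (heps : eps * eps = 1)
    {𝔫 t t' : Ideal (𝓞 F)} (h𝔫 : 𝔫 ≠ 0) (ht : t ≠ 0) (ht' : t' ≠ 0)
    {q : 𝓞 F} (hqpos : ∀ j, 0 < D.σ j (algebraMap (𝓞 F) F q))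
    (hqgen : Ideal.span {q} = t * t' * 𝔫)
    (ν : (Fin (r - 1) → ℤ) → Fin r → ℂ)
    (hνim : ∀ m j, (ν m j).re = 0)
    (hνsum : ∀ m, ∑ j, ν m j = 0)
    (hνlog : ∀ m l, ∑ j, ν m j * (Real.log (D.σ j (algebraMap (𝓞 F) F (D.ε l))) : ℂ) =
      2 * Real.pi * Complex.I * (m l : ℂ))
    (ψ : (Fin (r - 1) → ℤ) → FractionalIdeal (𝓞 F)⁰ F → ℂ)
    (hψmul : ∀ m (I J : FractionalIdeal (𝓞 F)⁰ F), I ≠ 0 → J ≠ 0 →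
      ψ m (I * J) = ψ m I * ψ m J)
    (hψne : ∀ m (I : FractionalIdeal (𝓞 F)⁰ F), I ≠ 0 → ψ m I ≠ 0)
    (hψpos : ∀ m (ξ : F), (∀ j, 0 < D.σ j ξ) →
      ψ m (spanSingleton (𝓞 F)⁰ ξ) = ∏ j, ((D.σ j ξ : ℝ) : ℂ) ^ (-(ν m j)))
    (hψconj : ∀ m I, ψ (-m) I = starRingEnd ℂ (ψ m I))
    (hFE : ∀ m : Fin (r - 1) → ℤ, ∃ Λ Λ' : ℂ → ℂ,
      Differentiable ℂ Λ ∧ Differentiable ℂ Λ' ∧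
      (∀ a b : ℝ, ∃ M : ℝ, ∀ s : ℂ, a ≤ s.re → s.re ≤ b → ‖Λ s‖ ≤ M) ∧
      (∀ a b : ℝ, ∃ M : ℝ, ∀ s : ℂ, a ≤ s.re → s.re ≤ b → ‖Λ' s‖ ≤ M) ∧
      (∃ σ₀ : ℝ, ∀ s : ℂ, σ₀ < s.re →
        Λ s = LhatPartial F r D.σ k k0 𝔫 A (ψ m) (ν m)
          (((t : FractionalIdeal (𝓞 F)⁰ F))⁻¹ *
            (differentIdeal ℤ (𝓞 F) : FractionalIdeal (𝓞 F)⁰ F)) s ∧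
        Λ' s = LhatPartial F r D.σ k k0 𝔫 A (ψ (-m)) (ν (-m))
          (((t' : FractionalIdeal (𝓞 F)⁰ F))⁻¹ *
            (differentIdeal ℤ (𝓞 F) : FractionalIdeal (𝓞 F)⁰ F)) s) ∧
      (∀ s : ℂ, Λ s = eps * Complex.I ^ (-(∑ j, (k j : ℤ))) *
        ψ m ((𝔫 * differentIdeal ℤ (𝓞 F) ^ 2 : Ideal (𝓞 F)) : FractionalIdeal (𝓞 F)⁰ F) *
        Λ' ((k0 : ℂ) - s))) (x : Fin r → ℝ) :
    D.Hf (fun j => (k0 - k j) / 2) k0 A t (cstC k k0 eps t' 𝔫) (D.lg (algebraMap (𝓞 F) F q)) x =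
      D.G (fun j => (k0 - k j) / 2) A t' x := by
  obtain ⟨L, hL⟩ := D.exists_L ν hνlog
  have hL' : D.IsL L := hL
  have hsurj : ∀ x : Fin r → ℝ, ∃ (τ : ℝ) (u : Fin (r - 1) → ℝ), ∀ j, x j = τ / r + ∑ l, u l * D.lam l j := by
    intro x
    refine ⟨(L.symm x).1, (L.symm x).2, fun j => ?_⟩
    rw [← hL, L.apply_symm_apply]
  choose ρ hρ using D.exists_rep hsurj (((t : FractionalIdeal (𝓞 F)⁰ F))⁻¹ * dd F)
  choose ρ' hρ' using D.exists_rep hsurj (((t' : FractionalIdeal (𝓞 F)⁰ F))⁻¹ * dd F)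
  obtain ⟨K, hK⟩ := haar_transfer L
  have hnu : ∀ m, D.IsNu m (ν m) := fun m => ⟨hνim m, hνsum m, hνlog m⟩
  have key : (fun w => D.Hf (fun j => (k0 - k j) / 2) k0 A t (cstC k k0 eps t' 𝔫)
      (D.lg (algebraMap (𝓞 F) F q)) (L w)) = fun w => D.G (fun j => (k0 - k j) / 2) A t' (L w) := by
    refine ucoef_unique ((D.Hf_continuous hA _ k0 ht _ _).comp L.continuous)
      ((D.G_continuous hA _ ht').comp L.continuous) (fun w N => ?_) (fun w N => ?_) (fun m => ?_)
    · simp only [map_add]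
      exact D.Hf_periodic hA _ k0 ht ρ hρ hL' _ _ _ _
    · simp only [map_add]
      exact D.G_periodic hA _ ht' ρ' hρ' hL' _ _
    · obtain ⟨Λ, Λ', -, hd, -, hb, ⟨σ₀, hσ₀⟩, hfe⟩ := hFE (-m)
      have := D.compare hA hk k0 heps h𝔫 ht ht' hqpos hqgen ρ hρ ρ' hρ' hL' hK (hnu (-m)) (hnu (- -m))
        (hψmul (-m)) (hψne (-m)) (hψpos (-m)) (hψmul (- -m)) (hψne (- -m)) (hψpos (- -m)) (fun I hI => ?_)
        hd hb (fun s hs => (hσ₀ s hs).1) (fun s hs => (hσ₀ s hs).2) hfe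
      · rwa [neg_neg] at this
      · have h1 := psi_norm D (ψ (-m)) (ν (-m)) (hνim _) (hψmul _) (hψne _) (hψpos _) I hI
        rw [hψconj (-m) I]
        rw [inv_eq_iff_eq_inv]
        rw [Complex.inv_def, Complex.normSq_eq_norm_sq, h1]
        simp
  have := congrFun key (L.symm x)
  simpa using this

end DatB10

section DatB11
variable {F : Type*} [Field F] [NumberField F] {r : ℕ} (D : Dat F r)

theorem uhp_update {r : ℕ} {z : Fin r → ℂ} (hz : ∀ j, 0 < (z j).im) (i : Fin r) {w : ℂ} (hw : 0 < w.im) (j : Fin r) :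
    0 < (Function.update z i w j).im := by
  by_cases hj : j = i
  · subst hj; simpa using hw
  · simpa [hj] using hz j

theorem identity_uhp {f g : ℂ → ℂ} (hf : ∀ w, 0 < w.im → DifferentiableAt ℂ f w)
    (hg : ∀ w, 0 < w.im → DifferentiableAt ℂ g w)
    (h : ∀ y : ℝ, 0 < y → f (Complex.I * y) = g (Complex.I * y)) (w : ℂ) (hw : 0 < w.im) : f w = g w := by
  have hopen : IsOpen {w : ℂ | 0 < w.im} := isOpen_lt continuous_const Complex.continuous_im
  have hconv : Convex ℝ {w : ℂ | 0 < w.im} := convex_halfSpace_im_gt 0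
  have hfa : AnalyticOnNhd ℂ f {w : ℂ | 0 < w.im} :=
    DifferentiableOn.analyticOnNhd (fun w hw => (hf w hw).differentiableWithinAt) hopen
  have hga : AnalyticOnNhd ℂ g {w : ℂ | 0 < w.im} :=
    DifferentiableOn.analyticOnNhd (fun w hw => (hg w hw).differentiableWithinAt) hopen
  refine hfa.eqOn_of_preconnected_of_frequently_eq hga hconv.isPreconnected (z₀ := Complex.I) (by simp) ?_ hw
  have ht : Filter.Tendsto (fun n : ℕ => Complex.I * ((1 + 1 / ((n:ℝ) + 1) : ℝ) : ℂ)) Filter.atTop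
      (nhdsWithin Complex.I {Complex.I}ᶜ) := by
    rw [tendsto_nhdsWithin_iff]
    constructor
    · have h1 : Filter.Tendsto (fun n : ℕ => (1 + 1 / ((n:ℝ) + 1) : ℝ)) Filter.atTop (nhds (1 + 0)) :=
        tendsto_one_div_add_atTop_nhds_zero_nat.const_add 1
      have h2 : Filter.Tendsto (fun x : ℝ => Complex.I * (x : ℂ)) (nhds (1 + 0)) (nhds (Complex.I * ((1 + 0 : ℝ) : ℂ))) :=
        (by fun_prop : Continuous fun x : ℝ => Complex.I * (x : ℂ)).tendsto _
      have h3 := h2.comp h1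
      rw [show Complex.I * ((1 + 0 : ℝ) : ℂ) = Complex.I by simp] at h3
      exact h3
    · refine Filter.Eventually.of_forall fun n => ?_
      simp only [Set.mem_compl_iff, Set.mem_singleton_iff]
      intro h
      have := congrArg Complex.im h
      rw [Complex.I_mul_im, Complex.ofReal_re, Complex.I_im] at this
      have h4 : (0:ℝ) < 1 / ((n:ℝ) + 1) := by positivity
      linarith
  exact ht.frequently (Filter.Frequently.of_forall fun n => h _ (by positivity))

theorem ext_uhp {r : ℕ} {f g : (Fin r → ℂ) → ℂ}
    (hf : ∀ z, (∀ j, 0 < (z j).im) → ∀ i w, 0 < w.im → DifferentiableAt ℂ (fun w => f (Function.update z i w)) w)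
    (hg : ∀ z, (∀ j, 0 < (z j).im) → ∀ i w, 0 < w.im → DifferentiableAt ℂ (fun w => g (Function.update z i w)) w)
    (h : ∀ y : Fin r → ℝ, (∀ j, 0 < y j) → f (fun j => Complex.I * y j) = g (fun j => Complex.I * y j))
    (z : Fin r → ℂ) (hz : ∀ j, 0 < (z j).im) : f z = g z := by
  have main : ∀ S : Finset (Fin r), ∀ z : Fin r → ℂ, (∀ j, 0 < (z j).im) → (∀ j, j ∉ S → (z j).re = 0) → f z = g z := by
    intro S
    induction S using Finset.induction_on with
    | empty =>
      intro z hz h0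
      have : z = fun j => Complex.I * ((z j).im : ℂ) := by
        ext j
        apply Complex.ext <;> simp [h0 j (by simp)]
      rw [this]
      exact h _ hz
    | insert i S hi ih =>
      intro z hz h0
      have := identity_uhp (f := fun w => f (Function.update z i w)) (g := fun w => g (Function.update z i w))
        (fun w hw => hf z hz i w hw) (fun w hw => hg z hz i w hw) (fun y hy => ?_) (z i) (hz i)
      · simpa using this
      · refine ih _ (uhp_update hz i (by simpa using hy)) fun j hj => ?_
        by_cases hji : j = i
        · subst hji; simp
        · rw [Function.update_of_ne hji]
          exact h0 j (by simp [hji, hj])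
  exact main Finset.univ z hz (by simp)

theorem slash_W (σ : Fin r → (F →+* ℝ)) (k : Fin r → ℕ) (q : F) (g : (Fin r → ℂ) → ℂ) (z : Fin r → ℂ) :
    slash F r σ k !![0, -1; q, 0] g z =
      (∏ j, ((σ j q : ℝ) : ℂ) ^ (k j / 2) * (((σ j q : ℝ) : ℂ) * z j) ^ (-(k j : ℤ))) *
      g (fun j => -1 / (((σ j q : ℝ) : ℂ) * z j)) := by
  unfold slash
  simp [Matrix.det_fin_two]

theorem qw_im {a : ℝ} (ha : 0 < a) {w : ℂ} (hw : 0 < w.im) : 0 < ((a : ℂ) * w).im := by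
  rw [Complex.im_ofReal_mul]; positivity

theorem ne_of_im {w : ℂ} (hw : 0 < w.im) : w ≠ 0 := by
  rintro rfl; simp at hw

theorem neg_inv_im {a : ℝ} (ha : 0 < a) {w : ℂ} (hw : 0 < w.im) : 0 < (-1 / ((a : ℂ) * w)).im := by
  have h1 := qw_im ha hw
  have h2 := Complex.normSq_pos.mpr (ne_of_im h1)
  rw [neg_div, one_div, Complex.neg_im, Complex.inv_im, neg_div, neg_neg]
  positivity

theorem Dat.hilbertF_diff {A : Ideal (𝓞 F) → ℂ} {c : ℕ} {M : ℝ} (hA : PolyGrowth A c M)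
    (k : Fin r → ℕ) (k0 : ℕ) {t : Ideal (𝓞 F)} (ht : t ≠ 0) (z : Fin r → ℂ) (hz : ∀ j, 0 < (z j).im)
    (i : Fin r) (w : ℂ) (hw : 0 < w.im) :
    DifferentiableAt ℂ (fun w => hilbertF F r D.σ k k0 A t (Function.update z i w)) w := by
  simp only [D.hilbertF_eq]
  exact (D.fsum_differentiableAt hA _ ht z hz i w hw).const_mul _

theorem Dat.slash_diff {A : Ideal (𝓞 F) → ℂ} {c : ℕ} {M : ℝ} (hA : PolyGrowth A c M)
    (k : Fin r → ℕ) (k0 : ℕ) {t : Ideal (𝓞 F)} (ht : t ≠ 0) {q : F} (hq : ∀ j, 0 < D.σ j q)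
    (z : Fin r → ℂ) (hz : ∀ j, 0 < (z j).im)
    (i : Fin r) (w : ℂ) (hw : 0 < w.im) :
    DifferentiableAt ℂ (fun w => slash F r D.σ k !![0, -1; q, 0] (hilbertF F r D.σ k k0 A t)
      (Function.update z i w)) w := by
  simp only [slash_W]
  refine DifferentiableAt.mul ?_ ?_
  · refine DifferentiableAt.fun_finsetProd fun j _ => ?_
    refine DifferentiableAt.const_mul ?_ _
    by_cases hj : j = i
    · subst hj
      simp only [Function.update_self]
      refine DifferentiableAt.zpow (by fun_prop) (Or.inl (ne_of_im (qw_im (hq j) hw)))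
    · simp only [Function.update_of_ne hj]; fun_prop
  · have heq : (fun w => hilbertF F r D.σ k k0 A t (fun j => -1 / (((D.σ j q : ℝ) : ℂ) * Function.update z i w j))) =
        (fun v => hilbertF F r D.σ k k0 A t (Function.update (fun j => -1 / (((D.σ j q : ℝ) : ℂ) * z j)) i v)) ∘
          (fun w => -1 / (((D.σ i q : ℝ) : ℂ) * w)) := by
      ext w
      simp only [Function.comp_apply]
      congr 1
      ext j
      by_cases hj : j = i
      · subst hj; simp
      · simp [hj]
    rw [heq]
    refine DifferentiableAt.comp w (D.hilbertF_diff hA k k0 ht _ (fun j => neg_inv_im (hq j) (hz j)) i _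
      (neg_inv_im (hq i) hw)) ?_
    refine DifferentiableAt.div (by fun_prop) (by fun_prop) (ne_of_im (qw_im (hq i) hw))

theorem Dat.on_imag {A : Ideal (𝓞 F) → ℂ}
    {k : Fin r → ℕ} (hk : ∀ j, Even (k j)) {k0 : ℕ} (hk0 : Even k0) (hkk : ∀ j, k j ≤ k0)
    {eps : ℂ} (heps : eps * eps = 1)
    {𝔫 t t' : Ideal (𝓞 F)} (h𝔫 : 𝔫 ≠ 0) (ht : t ≠ 0) (ht' : t' ≠ 0)
    {q : 𝓞 F} (hqpos : ∀ j, 0 < D.σ j (algebraMap (𝓞 F) F q))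
    (hqgen : Ideal.span {q} = t * t' * 𝔫) (x : Fin r → ℝ)
    (hx : D.Hf (fun j => (k0 - k j) / 2) k0 A t (cstC k k0 eps t' 𝔫) (D.lg (algebraMap (𝓞 F) F q)) x =
      D.G (fun j => (k0 - k j) / 2) A t' x) :
    slash F r D.σ k !![0, -1; algebraMap (𝓞 F) F q, 0] (hilbertF F r D.σ k k0 A t)
        (fun j => Complex.I * (Real.exp (x j) : ℝ)) =
      eps * hilbertF F r D.σ k k0 A t' (fun j => Complex.I * (Real.exp (x j) : ℝ)) := by
  set lq := D.lg (algebraMap (𝓞 F) F q) with hlq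
  have hsl := D.sum_lq h𝔫 ht ht' hqpos hqgen
  rw [← hlq] at hsl
  have hσ : ∀ j, D.σ j (algebraMap (𝓞 F) F q) = Real.exp (lq j) := fun j => by
    rw [hlq]; unfold Dat.lg; rw [Real.exp_log (hqpos j)]
  have hκ1 : ∀ j, (((k0 - k j) / 2 : ℕ) : ℂ) = ((k0 / 2 : ℕ) : ℂ) - ((k j / 2 : ℕ) : ℂ) := by
    intro j
    rw [← Nat.cast_sub (Nat.div_le_div_right (hkk j))]
    congr 1
    obtain ⟨a, ha⟩ := hk j
    obtain ⟨b, hb⟩ := hk0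
    omega
  have hκ2 : ∀ j, ((k j : ℕ) : ℂ) = 2 * ((k j / 2 : ℕ) : ℂ) := by
    intro j
    obtain ⟨a, ha⟩ := hk j
    have : k j = 2 * (k j / 2) := by omega
    exact_mod_cast this
  have hκ3 : ((k0 : ℕ) : ℂ) = 2 * ((k0 / 2 : ℕ) : ℂ) := by
    obtain ⟨a, ha⟩ := hk0
    have : k0 = 2 * (k0 / 2) := by omega
    exact_mod_cast this
  rw [slash_W, D.hilbertF_eq, D.hilbertF_eq]
  have harg : (fun j => -1 / (((D.σ j (algebraMap (𝓞 F) F q) : ℝ) : ℂ) * (Complex.I * (Real.exp (x j) : ℝ)))) =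
      fun j => Complex.I * (Real.exp ((-lq - x) j) : ℝ) := by
    ext j
    rw [hσ, Pi.sub_apply, Pi.neg_apply, Real.exp_sub, Real.exp_neg]
    have h1 := Complex.ofReal_ne_zero.mpr (Real.exp_pos (x j)).ne'
    have h2 := Complex.ofReal_ne_zero.mpr (Real.exp_pos (lq j)).ne'
    have h3 := Complex.I_ne_zero
    rw [Complex.ofReal_div, Complex.ofReal_inv]
    field_simp
    rw [Complex.I_sq]
  rw [harg]
  have hprod : (∏ j, ((D.σ j (algebraMap (𝓞 F) F q) : ℝ) : ℂ) ^ (k j / 2) *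
      (((D.σ j (algebraMap (𝓞 F) F q) : ℝ) : ℂ) * (Complex.I * (Real.exp (x j) : ℝ))) ^ (-(k j : ℤ))) =
      Complex.I ^ (-(∑ j, (k j : ℤ))) *
        cexp (∑ j, (-((k j / 2 : ℕ) : ℂ) * lq j - 2 * ((k j / 2 : ℕ) : ℂ) * x j)) := by
    have hI : Complex.I ^ (-(∑ j, (k j : ℤ))) = ∏ j, Complex.I ^ (-(k j : ℤ)) := by
      rw [zpow_neg, ← Nat.cast_sum, zpow_natCast, ← Finset.prod_pow_eq_pow_sum, ← Finset.prod_inv_distrib]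
      simp
    rw [hI, Complex.exp_sum, ← Finset.prod_mul_distrib]
    refine Finset.prod_congr rfl fun j _ => ?_
    rw [hσ, mul_left_comm, mul_zpow, Complex.ofReal_exp, Complex.ofReal_exp, ← Complex.exp_add,
      ← Complex.exp_int_mul, ← Complex.exp_nat_mul, mul_left_comm, ← Complex.exp_add]
    congr 2
    push_cast
    linear_combination (-((lq j : ℂ) + x j)) * hκ2 j
  rw [hprod]
  unfold Dat.Hf Dat.G at hx
  set f1 := D.fsum (fun j => (k0 - k j) / 2) A t (fun j => Complex.I * (Real.exp ((-lq - x) j) : ℝ))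
  set f2 := D.fsum (fun j => (k0 - k j) / 2) A t' (fun j => Complex.I * (Real.exp (x j) : ℝ))
  have hN : ∀ {a : Ideal (𝓞 F)}, a ≠ 0 → (Ideal.absNorm a : ℂ) ^ (k0 / 2) =
      cexp (((k0 / 2 : ℕ) : ℂ) * (Real.log (Ideal.absNorm a) : ℂ)) := by
    intro a ha
    rw [← Complex.cpow_natCast, natCast_cpow_exp]
    rw [Ne, Ideal.absNorm_eq_zero_iff]; exact ha
  rw [hN ht, hN ht']
  have hf2 : f2 = cexp (∑ j, (((k0 - k j) / 2 : ℕ) : ℂ) * (x j : ℂ)) *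
      (cexp (-∑ j, (((k0 - k j) / 2 : ℕ) : ℂ) * (x j : ℂ)) * f2) := by
    rw [← mul_assoc, ← Complex.exp_add, add_neg_cancel, Complex.exp_zero, one_mul]
  rw [hf2, ← hx]
  unfold cstC
  have hE : cexp (∑ j, (-((k j / 2 : ℕ) : ℂ) * lq j - 2 * ((k j / 2 : ℕ) : ℂ) * x j)) *
      cexp (((k0 / 2 : ℕ) : ℂ) * (Real.log (Ideal.absNorm t) : ℂ)) =
      cexp (((k0 / 2 : ℕ) : ℂ) * (Real.log (Ideal.absNorm t') : ℂ)) *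
      (cexp (∑ j, (((k0 - k j) / 2 : ℕ) : ℂ) * (x j : ℂ)) *
      (cexp (-(k0 : ℂ) * (Real.log (Ideal.absNorm t') + Real.log (Ideal.absNorm 𝔫) / 2 : ℝ)) *
      (cexp (-(k0 : ℂ) * ∑ j, (x j : ℂ)) *
      cexp (-∑ j, (((k0 - k j) / 2 : ℕ) : ℂ) * (((-lq - x) j : ℝ) : ℂ))))) := by
    simp only [← Complex.exp_add]
    congr 1
    have hsl' : ∑ j, (lq j : ℂ) = ((Real.log (Ideal.absNorm t) + Real.log (Ideal.absNorm t')
      + Real.log (Ideal.absNorm 𝔫) : ℝ) : ℂ) := by rw [← hsl, Complex.ofReal_sum]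
    simp only [hκ1, hκ3]
    push_cast at hsl' ⊢
    simp only [Pi.sub_apply, Pi.neg_apply, Complex.ofReal_sub, Complex.ofReal_neg, sub_mul, mul_sub, mul_neg, neg_mul,
      Finset.sum_sub_distrib, Finset.sum_neg_distrib, ← Finset.mul_sum, hsl', mul_assoc]
    ring
  linear_combination (Complex.I ^ (-(∑ j, (k j : ℤ))) * f1) * hE - (Complex.I ^ (-(∑ j, (k j : ℤ))) * f1 *
    (cexp (((k0 / 2 : ℕ) : ℂ) * (Real.log (Ideal.absNorm t') : ℂ)) *
      (cexp (∑ j, (((k0 - k j) / 2 : ℕ) : ℂ) * (x j : ℂ)) *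
      (cexp (-(k0 : ℂ) * (Real.log (Ideal.absNorm t') + Real.log (Ideal.absNorm 𝔫) / 2 : ℝ)) *
      (cexp (-(k0 : ℂ) * ∑ j, (x j : ℂ)) *
      cexp (-∑ j, (((k0 - k j) / 2 : ℕ) : ℂ) * (((-lq - x) j : ℝ) : ℂ))))))) * heps

end DatB11

/-- **Functional equations imply the Fricke relation (Proposition `fqnprop`).**
Suppose that for every `m ∈ ℤ^{r-1}` the completed partial L-series `L̂(s,C,ψ_m)` and
`L̂(s,C̃,ψ_{-m})` (for the narrow classes `C = [t⁻¹𝔡]`, `C̃ = [t̃⁻¹𝔡]`) continue to entire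
functions, bounded in vertical strips, satisfying
`L̂(s,C,ψ_m) = ε i^{-|k|} ψ_m(𝔫𝔡²) L̂(k₀-s,C̃,ψ_{-m})`. Then `f|_k W_q = ε·f̃` for any
totally positive generator `q` of `t·t̃·𝔫`. -/
theorem stmt_0 (F : Type*) [Field F] [NumberField F]
    (r : ℕ) (hr : 1 < r) (hrank : Module.finrank ℚ F = r)
    (σ : Fin r → (F →+* ℝ)) (hσ : Function.Injective σ)
    (k : Fin r → ℕ) (hk : ∀ j, Even (k j) ∧ 0 < k j)
    (k0 : ℕ) (hk0 : k0 = Finset.univ.sup k)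
    (eps : ℂ) (heps : eps = 1 ∨ eps = -1)
    (A : Ideal (𝓞 F) → ℂ) (hA1 : A ⊤ = 1)
    (hA2 : ∃ c : ℝ, 0 < c ∧ ∃ M : ℝ, ∀ a : Ideal (𝓞 F), a ≠ 0 →
      ‖A a‖ ≤ M * (Ideal.absNorm a : ℝ) ^ c)
    (𝔫 t t' : Ideal (𝓞 F)) (h𝔫 : 𝔫 ≠ 0) (ht : t ≠ 0) (ht' : t' ≠ 0)
    (q : 𝓞 F) (hqpos : ∀ j, 0 < σ j (algebraMap (𝓞 F) F q))
    (hqgen : Ideal.span {q} = t * t' * 𝔫)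
    (ε : Fin (r - 1) → (𝓞 F)ˣ)
    (hεpos : ∀ l j, 0 < σ j (algebraMap (𝓞 F) F (ε l)))
    (hεbasis : ∀ v : (𝓞 F)ˣ, (∀ j, 0 < σ j (algebraMap (𝓞 F) F v)) →
      ∃! n : Fin (r - 1) → ℤ, v = ∏ l, ε l ^ n l)
    (ν : (Fin (r - 1) → ℤ) → Fin r → ℂ)
    (hνim : ∀ m j, (ν m j).re = 0)
    (hνsum : ∀ m, ∑ j, ν m j = 0)
    (hνlog : ∀ m l, ∑ j, ν m j * (Real.log (σ j (algebraMap (𝓞 F) F (ε l))) : ℂ) =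
      2 * Real.pi * Complex.I * (m l : ℂ))
    (ψ : (Fin (r - 1) → ℤ) → FractionalIdeal (𝓞 F)⁰ F → ℂ)
    (hψmul : ∀ m (I J : FractionalIdeal (𝓞 F)⁰ F), I ≠ 0 → J ≠ 0 →
      ψ m (I * J) = ψ m I * ψ m J)
    (hψne : ∀ m (I : FractionalIdeal (𝓞 F)⁰ F), I ≠ 0 → ψ m I ≠ 0)
    (hψpos : ∀ m (ξ : F), (∀ j, 0 < σ j ξ) →
      ψ m (spanSingleton (𝓞 F)⁰ ξ) = ∏ j, ((σ j ξ : ℝ) : ℂ) ^ (-(ν m j)))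
    (hψconj : ∀ m I, ψ (-m) I = starRingEnd ℂ (ψ m I))
    (hFE : ∀ m : Fin (r - 1) → ℤ, ∃ Λ Λ' : ℂ → ℂ,
      Differentiable ℂ Λ ∧ Differentiable ℂ Λ' ∧
      (∀ a b : ℝ, ∃ M : ℝ, ∀ s : ℂ, a ≤ s.re → s.re ≤ b → ‖Λ s‖ ≤ M) ∧
      (∀ a b : ℝ, ∃ M : ℝ, ∀ s : ℂ, a ≤ s.re → s.re ≤ b → ‖Λ' s‖ ≤ M) ∧
      (∃ σ₀ : ℝ, ∀ s : ℂ, σ₀ < s.re →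
        Λ s = LhatPartial F r σ k k0 𝔫 A (ψ m) (ν m)
          (((t : FractionalIdeal (𝓞 F)⁰ F))⁻¹ *
            (differentIdeal ℤ (𝓞 F) : FractionalIdeal (𝓞 F)⁰ F)) s ∧
        Λ' s = LhatPartial F r σ k k0 𝔫 A (ψ (-m)) (ν (-m))
          (((t' : FractionalIdeal (𝓞 F)⁰ F))⁻¹ *
            (differentIdeal ℤ (𝓞 F) : FractionalIdeal (𝓞 F)⁰ F)) s) ∧
      (∀ s : ℂ, Λ s = eps * Complex.I ^ (-(∑ j, (k j : ℤ))) *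
        ψ m ((𝔫 * differentIdeal ℤ (𝓞 F) ^ 2 : Ideal (𝓞 F)) : FractionalIdeal (𝓞 F)⁰ F) *
        Λ' ((k0 : ℂ) - s))) :
    ∀ z : Fin r → ℂ, (∀ j, 0 < (z j).im) →
      slash F r σ k !![0, -1; algebraMap (𝓞 F) F q, 0] (hilbertF F r σ k k0 A t) z =
        eps * hilbertF F r σ k k0 A t' z := by
  have hk2 : ∀ j, Even (k j) := fun j => (hk j).1
  have hkk : ∀ j, k j ≤ k0 := fun j => by rw [hk0]; exact Finset.le_sup (Finset.mem_univ j)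
  have hk0e : Even k0 := by
    have : Nonempty (Fin r) := ⟨⟨0, by omega⟩⟩
    obtain ⟨j, -, hj⟩ := Finset.exists_mem_eq_sup Finset.univ Finset.univ_nonempty k
    rw [hk0, hj]; exact hk2 j
  have heps2 : eps * eps = 1 := by rcases heps with h | h <;> rw [h] <;> norm_num
  obtain ⟨c, M, hA⟩ := polyGrowth_of hA2
  let D : Dat F r := ⟨hr, hrank, σ, hσ, ε, hεpos, hεbasis⟩
  refine ext_uhp (fun z hz i w hw => D.slash_diff hA k k0 ht hqpos z hz i w hw)
    (fun z hz i w hw => (D.hilbertF_diff hA k k0 ht' z hz i w hw).const_mul eps) (fun y hy => ?_)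
  have h1 := D.theta hA hk2 k0 heps2 h𝔫 ht ht' hqpos hqgen ν hνim hνsum hνlog ψ hψmul hψne hψpos hψconj hFE
    (fun j => Real.log (y j))
  have h2 := D.on_imag hk2 hk0e hkk heps2 h𝔫 ht ht' hqpos hqgen (fun j => Real.log (y j)) h1
  simp only [Real.exp_log (hy _)] at h2
  exact h2
end
end

section
/- Let u be a positive integer. For each 1≤j≤u let q_j be a rational prime, n_j an integer, and m_j a positive integer such that: (A1) the q_j are pairwise distinct; (A2) q_j ∤ m_j·n_j for all j; (A3) q_j ∤ m_i for all i and j. For each 1≤i≤u and 1≤j≤u let s_{i,j} ⊆ {1,…,q_j−1} be such that: (B1) s_{i,j} ∩ s_{i',j} = ∅ whenever i≠i'; (B2) s_{i,i} ≠ ∅ for all i. Define S_{i,j} = Σ_{a∈s_{i,j}} e^{2πi·n_j·a/(m_j·q_j)}. Then the determinant of the u×u complex matrix (S_{i,j})_{i,j=1}^u is nonzero. -/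
open Complex

open Polynomial IntermediateField in
lemma aux_deg {N q : ℕ} (hN : 0 < N) (hq : q.Prime) (hc : N.Coprime q) {ξ ζ : ℂ}
    (hξ : IsPrimitiveRoot ξ N) (hζ : IsPrimitiveRoot ζ q) :
    q - 1 ≤ (minpoly ℚ⟮ξ⟯ ζ).natDegree := by
  have fin : ∀ {n : ℕ} {μ : ℂ}, 0 < n → IsPrimitiveRoot μ n →
      Module.finrank ℚ ℚ⟮μ⟯ = n.totient := by
    intro n μ hn h
    rw [adjoin.finrank ((h.isIntegral hn).tower_top), ← cyclotomic_eq_minpoly_rat h hn,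
      natDegree_cyclotomic]
  have hη : IsPrimitiveRoot (ξ * ζ) (N * q) := by
    have := (Commute.all ξ ζ).orderOf_mul_eq_mul_orderOf_of_coprime
      (by rw [← hξ.eq_orderOf, ← hζ.eq_orderOf]; exact hc)
    rw [← hξ.eq_orderOf, ← hζ.eq_orderOf] at this
    rw [← this]
    exact IsPrimitiveRoot.orderOf _
  have hint : IsIntegral ℚ⟮ξ⟯ ζ := (hζ.isIntegral hq.pos).tower_top
  have hintξ : IsIntegral ℚ ξ := (hξ.isIntegral hN).tower_top
  have : FiniteDimensional ℚ ℚ⟮ξ⟯ := adjoin.finiteDimensional hintξ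
  have : FiniteDimensional ℚ⟮ξ⟯ ℚ⟮ξ⟯⟮ζ⟯ := adjoin.finiteDimensional hint
  have : FiniteDimensional ℚ ℚ⟮ξ⟯⟮ζ⟯ := FiniteDimensional.trans ℚ ℚ⟮ξ⟯ _
  have h1 : Module.finrank ℚ ℚ⟮ξ⟯ * Module.finrank ℚ⟮ξ⟯ ℚ⟮ξ⟯⟮ζ⟯ = Module.finrank ℚ ℚ⟮ξ⟯⟮ζ⟯ :=
    Module.finrank_mul_finrank _ _ _
  have hle : ℚ⟮ξ * ζ⟯ ≤ (ℚ⟮ξ⟯⟮ζ⟯).restrictScalars ℚ := by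
    rw [adjoin_simple_le_iff, mem_restrictScalars]
    refine mul_mem ?_ (mem_adjoin_simple_self _ _)
    exact _root_.algebraMap_mem (ℚ⟮ξ⟯⟮ζ⟯) (⟨ξ, mem_adjoin_simple_self ℚ ξ⟩ : ℚ⟮ξ⟯)
  have h2 : Module.finrank ℚ ℚ⟮ξ * ζ⟯ ≤ Module.finrank ℚ ℚ⟮ξ⟯⟮ζ⟯ :=
    LinearMap.finrank_le_finrank_of_injective (f := (inclusion hle).toLinearMap)
      (inclusion_injective hle)
  rw [fin (Nat.mul_pos hN hq.pos) hη, ← h1, fin hN hξ, Nat.totient_mul hc,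
    Nat.totient_prime hq, adjoin.finrank hint] at h2
  exact Nat.le_of_mul_le_mul_left h2 (Nat.totient_pos.2 hN)

open Polynomial IntermediateField in
lemma aux_indep {N q : ℕ} (hN : 0 < N) (hq : q.Prime) (hc : N.Coprime q) {ξ ζ : ℂ}
    (hξ : IsPrimitiveRoot ξ N) (hζ : IsPrimitiveRoot ζ q) (c : ℕ → ℂ)
    (hcK : ∀ a, c a ∈ ℚ⟮ξ⟯) (h0 : ∑ a ∈ Finset.Icc 1 (q - 1), c a * ζ ^ a = 0) :
    ∀ a ∈ Finset.Icc 1 (q - 1), c a = 0 := by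
  have hd := aux_deg hN hq hc hξ hζ
  let p : (ℚ⟮ξ⟯)[X] := ∑ k ∈ Finset.range (q - 1), C (⟨c (k + 1), hcK _⟩ : ℚ⟮ξ⟯) * X ^ k
  have hζ0 : ζ ≠ 0 := hζ.ne_zero hq.ne_zero
  have hp : aeval ζ p = 0 := by
    have : ζ * aeval ζ p = 0 := by
      rw [← h0]
      simp only [p, map_sum, Finset.mul_sum, map_mul, aeval_C, map_pow, aeval_X]
      rw [← Finset.Ico_add_one_right_eq_Icc, Finset.sum_Ico_eq_sum_range]
      refine Finset.sum_congr (by simp) fun k _ => ?_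
      rw [add_comm 1 k, pow_succ]
      change ζ * (c (k+1) * ζ ^ k) = _
      ring
    exact (mul_eq_zero.1 this).resolve_left hζ0
  have hdeg : p.degree < (minpoly ℚ⟮ξ⟯ ζ).degree := by
    have hint : IsIntegral ℚ⟮ξ⟯ ζ := (hζ.isIntegral hq.pos).tower_top
    rw [degree_eq_natDegree (minpoly.ne_zero hint)]
    refine lt_of_lt_of_le ?_ (Nat.cast_le.2 hd)
    rw [degree_lt_iff_coeff_zero]
    intro k hk
    simp only [p, finsetSum_coeff, coeff_C_mul_X_pow]
    exact Finset.sum_eq_zero fun x hx => if_neg (by rw [Finset.mem_range] at hx; omega)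
  have hp0 : p = 0 := by
    by_contra h
    exact absurd (minpoly.degree_le_of_ne_zero _ _ h hp) (not_le.2 hdeg)
  intro a ha
  rw [Finset.mem_Icc] at ha
  have : p.coeff (a - 1) = 0 := by rw [hp0, coeff_zero]
  simp only [p, finsetSum_coeff, coeff_C_mul_X_pow] at this
  rw [Finset.sum_ite_eq, if_pos (by rw [Finset.mem_range]; omega)] at this
  have h := congrArg Subtype.val this
  simpa [Nat.sub_add_cancel ha.1] using h

lemma aux_split (m q : ℕ) (n : ℤ) (hq : q.Prime) (hm : 0 < m)
    (h2 : ¬ ((q : ℤ) ∣ (m : ℤ) * n)) :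
    ∃ ω ζ : ℂ, ω ^ m = 1 ∧ IsPrimitiveRoot ζ q ∧ ∀ a : ℕ,
      Complex.exp (2 * Real.pi * Complex.I * (n : ℂ) * (a : ℂ) / ((m : ℂ) * (q : ℂ)))
        = ω ^ a * ζ ^ a := by
  have hqp : Prime (q : ℤ) := Nat.prime_iff_prime_int.1 hq
  have hmq : IsCoprime (q : ℤ) (m : ℤ) :=
    hqp.irreducible.coprime_iff_not_dvd.2 fun h => h2 (h.mul_right _)
  obtain ⟨x, y, hxy⟩ := hmq
  have hm0 : (m : ℂ) ≠ 0 := by exact_mod_cast hm.ne'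
  have hq0 : (q : ℂ) ≠ 0 := by exact_mod_cast hq.ne_zero
  have hny : ¬ (q : ℤ) ∣ n * y := by
    intro h
    rcases hqp.dvd_or_dvd h with h | h
    · exact h2 (h.mul_left _)
    · apply hqp.not_dvd_one
      rw [← hxy]
      exact dvd_add (dvd_mul_left _ _) (h.mul_right _)
  refine ⟨Complex.exp (2 * Real.pi * Complex.I * (n * x / m)),
    Complex.exp (2 * Real.pi * Complex.I * (n * y / q)), ?_, ?_, ?_⟩
  · rw [← Complex.exp_nat_mul, Complex.exp_eq_one_iff]
    refine ⟨n * x, ?_⟩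
    push_cast
    field_simp
  · have := Fact.mk hq
    have := @orderOf_eq_prime ℂ _ (Complex.exp (2 * Real.pi * Complex.I * (n * y / q))) q _ ?_ ?_
    · rw [← this] ; simpa [this] using IsPrimitiveRoot.orderOf (Complex.exp (2 * Real.pi * Complex.I * (n * y / q)))
    · rw [← Complex.exp_nat_mul, Complex.exp_eq_one_iff]
      refine ⟨n * y, ?_⟩
      push_cast
      field_simp
    · intro h
      rw [Complex.exp_eq_one_iff] at h
      obtain ⟨k, hk⟩ := h
      apply hny
      refine ⟨k, ?_⟩
      have h3 : (2 * Real.pi * Complex.I : ℂ) ≠ 0 := Complex.two_pi_I_ne_zero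
      rw [mul_comm (k : ℂ)] at hk
      have := mul_left_cancel₀ h3 hk
      rw [div_eq_iff hq0] at this
      have h4 : ((n * y : ℤ) : ℂ) = ((q * k : ℤ) : ℂ) := by
        push_cast; rw [this]; ring
      exact_mod_cast h4
  · intro a
    have hxy' : (x : ℂ) * q + y * m = 1 := by exact_mod_cast hxy
    rw [← Complex.exp_nat_mul, ← Complex.exp_nat_mul, ← Complex.exp_add]
    congr 1
    field_simp
    linear_combination (-(n * a) : ℂ) * hxy'

open IntermediateField in
lemma aux_main (u : ℕ) : ∀
    (q : Fin u → ℕ) (n : Fin u → ℤ) (m : Fin u → ℕ)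
    (_ : ∀ j, Nat.Prime (q j)) (_ : ∀ j, 0 < m j)
    (_ : Function.Injective q)
    (_ : ∀ j, ¬ ((q j : ℤ) ∣ (m j : ℤ) * n j))
    (_ : ∀ i j, ¬ (q j ∣ m i))
    (s : Fin u → Fin u → Finset ℕ)
    (_ : ∀ i j, s i j ⊆ Finset.Icc 1 (q j - 1))
    (_ : ∀ i i' j, i ≠ i' → Disjoint (s i j) (s i' j))
    (_ : ∀ i, (s i i).Nonempty),
    Matrix.det (Matrix.of fun i j : Fin u => ∑ a ∈ s i j,
      Complex.exp (2 * Real.pi * Complex.I * (n j : ℂ) * (a : ℂ) / ((m j : ℂ) * (q j : ℂ)))) ≠ 0 := by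
  induction u with
  | zero => intros; simp
  | succ u ih =>
    intro q n m hqp hmp hA1 hA2 hA3 s hsub hB1 hB2 hdet
    have IH := ih (fun j => q j.succ) (fun j => n j.succ) (fun j => m j.succ)
      (fun j => hqp _) (fun j => hmp _) (hA1.comp (Fin.succ_injective _))
      (fun j => hA2 _) (fun i j => hA3 _ _) (fun i j => s i.succ j.succ)
      (fun i j => hsub _ _) (fun i i' j h => hB1 _ _ _ (by simpa using h)) (fun i => hB2 _)
    set A := (Matrix.of fun i j : Fin (u+1) => ∑ a ∈ s i j,
      Complex.exp (2 * Real.pi * Complex.I * (n j : ℂ) * (a : ℂ) / ((m j : ℂ) * (q j : ℂ)))) with hA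
    let N : ℕ := (∏ j, m j) * ∏ j : Fin u, q j.succ
    have hN : 0 < N := Nat.mul_pos (Finset.prod_pos fun j _ => hmp j)
      (Finset.prod_pos fun j _ => (hqp _).pos)
    have hc : N.Coprime (q 0) := by
      refine Nat.Coprime.mul_left ?_ ?_
      · exact Nat.Coprime.prod_left fun j _ =>
          ((hqp 0).coprime_iff_not_dvd.2 (hA3 j 0)).symm
      · refine Nat.Coprime.prod_left fun j _ => (Nat.coprime_primes (hqp _) (hqp _)).2 ?_
        exact fun h => Fin.succ_ne_zero j (hA1 h)
    have hξ := Complex.isPrimitiveRoot_exp N hN.ne'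
    set ξ := Complex.exp (2 * Real.pi * Complex.I / N)
    have memK : ∀ (k : ℕ) (z : ℂ), k ∣ N → z ^ k = 1 → z ∈ ℚ⟮ξ⟯ := by
      intro k z hk hz
      obtain ⟨l, hl⟩ := hk
      have : NeZero N := ⟨hN.ne'⟩
      obtain ⟨i, -, hi⟩ := hξ.eq_pow_of_pow_eq_one (ξ := z) (by rw [hl, pow_mul, hz, one_pow])
      rw [← hi]
      exact pow_mem (mem_adjoin_simple_self _ _) _
    have hAK : ∀ i (j : Fin u), A i j.succ ∈ ℚ⟮ξ⟯ := by
      intro i j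
      rw [hA, Matrix.of_apply]
      refine sum_mem fun a _ => ?_
      obtain ⟨ω, ζ, hω, hζ, h⟩ := aux_split (m j.succ) (q j.succ) (n j.succ) (hqp _) (hmp _) (hA2 _)
      rw [h]
      refine mul_mem (pow_mem (memK _ _ ?_ hω) _) (pow_mem (memK _ _ ?_ hζ.pow_eq_one) _)
      · exact (Finset.dvd_prod_of_mem m (Finset.mem_univ _)).mul_right _
      · exact (Finset.dvd_prod_of_mem (fun j : Fin u => q j.succ) (Finset.mem_univ j)).mul_left _
    obtain ⟨ω, ζ, hω, hζ, h⟩ := aux_split (m 0) (q 0) (n 0) (hqp _) (hmp _) (hA2 _)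
    have hωK : ω ∈ ℚ⟮ξ⟯ :=
      memK _ _ ((Finset.dvd_prod_of_mem m (Finset.mem_univ _)).mul_right _) hω
    let D : Fin (u+1) → ℂ := fun i =>
      (-1) ^ (i : ℕ) * (A.submatrix i.succAbove Fin.succ).det
    have hDK : ∀ i, D i ∈ ℚ⟮ξ⟯ := by
      intro i
      refine mul_mem (pow_mem (neg_mem (one_mem _)) _) ?_
      rw [Matrix.det_apply']
      exact sum_mem fun σ _ => mul_mem (intCast_mem _ _) (prod_mem fun k _ => hAK _ _)
    have hexp : A.det = ∑ i, D i * ∑ a ∈ s i 0, ω ^ a * ζ ^ a := by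
      rw [Matrix.det_succ_column_zero]
      refine Finset.sum_congr rfl fun i _ => ?_
      have : A i 0 = ∑ a ∈ s i 0, ω ^ a * ζ ^ a := by
        rw [hA, Matrix.of_apply]
        exact Finset.sum_congr rfl fun a _ => h a
      rw [this]
      simp only [D]
      ring
    let c : ℕ → ℂ := fun a => ∑ i, if a ∈ s i 0 then D i * ω ^ a else 0
    have hcK : ∀ a, c a ∈ ℚ⟮ξ⟯ := fun a => sum_mem fun i _ => by
      split_ifs
      · exact mul_mem (hDK i) (pow_mem hωK _)
      · exact zero_mem _
    have hsum : ∑ a ∈ Finset.Icc 1 (q 0 - 1), c a * ζ ^ a = 0 := by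
      rw [← hdet, hexp]
      simp only [c, Finset.sum_mul]
      rw [Finset.sum_comm]
      refine Finset.sum_congr rfl fun i _ => ?_
      rw [Finset.mul_sum, ← Finset.sum_subset (hsub i 0)]
      · refine Finset.sum_congr rfl fun a ha => ?_
        rw [if_pos ha]; ring
      · intro a _ ha
        rw [if_neg ha, zero_mul]
    obtain ⟨a, ha⟩ := hB2 0
    have hca := aux_indep hN (hqp 0) hc hξ hζ c hcK hsum a (hsub _ _ ha)
    have hca' : c a = D 0 * ω ^ a := by
      simp only [c]
      rw [Finset.sum_eq_single 0]
      · rw [if_pos ha]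
      · intro i _ hi
        exact if_neg fun hai => Finset.disjoint_left.1 (hB1 i 0 0 hi) hai ha
      · simp
    rw [hca'] at hca
    have hω0 : ω ≠ 0 := by
      rintro rfl
      rw [zero_pow (hmp 0).ne'] at hω
      exact zero_ne_one hω
    have hD0 := (mul_eq_zero.1 hca).resolve_right (pow_ne_zero _ hω0)
    apply IH
    simp only [D, Fin.val_zero, pow_zero, one_mul] at hD0
    rw [← hD0]
    congr 1

/-- **Nonvanishing determinant of exponential sums.**
Given distinct primes `q j`, integers `n j`, positive integers `m j` with the coprimality
conditions (A1)-(A3), and subsets `s i j ⊆ {1,…,q j − 1}` satisfying the disjointness and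
nonemptiness conditions (B1)-(B2), the matrix of exponential sums
`S i j = Σ_{a ∈ s i j} e^{2πi·n j·a/(m j·q j)}` has nonzero determinant. -/
theorem stmt_13 (u : ℕ) (hu : 0 < u)
    (q : Fin u → ℕ) (n : Fin u → ℤ) (m : Fin u → ℕ)
    (hqprime : ∀ j, Nat.Prime (q j)) (hmpos : ∀ j, 0 < m j)
    (hA1 : Function.Injective q)
    (hA2 : ∀ j, ¬ ((q j : ℤ) ∣ (m j : ℤ) * n j))
    (hA3 : ∀ i j, ¬ (q j ∣ m i))
    (s : Fin u → Fin u → Finset ℕ)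
    (hsub : ∀ i j, s i j ⊆ Finset.Icc 1 (q j - 1))
    (hB1 : ∀ i i' j, i ≠ i' → Disjoint (s i j) (s i' j))
    (hB2 : ∀ i, (s i i).Nonempty) :
    Matrix.det (Matrix.of fun i j : Fin u => ∑ a ∈ s i j,
      Complex.exp (2 * Real.pi * Complex.I * (n j : ℂ) * (a : ℂ) / ((m j : ℂ) * (q j : ℂ)))) ≠ 0 := by
  exact aux_main u q n m hqprime hmpos hA1 hA2 hA3 s hsub hB1 hB2
end
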